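/- For every n ≥ 336 there exists a graph G on n vertices with at most 4n edges such that Maker, as first player, has a winning strategy in the Maker-Breaker Hamiltonicity game played on E(G). -/

import Mathlib

/-- `MakerWins X F t M B` : in the Maker-Breaker positional game on board `X` with
winning sets `F`, from the position where Maker has claimed the elements of `M`,
Breaker has claimed the elements of `B`, and it is Maker's turn iff `t = true`,
Maker has a winning strategy (he can ensure to claim all elements of some winning set). -/
inductive MakerWins {α : Type} [DecidableEq α] (X : Finset α) (F : Set (Finset α)) :
    Bool → Finset α → Finset α → Prop
  | claim {t : Bool} {M B : Finset α} (A : Finset α) (hA : A ∈ F) (hAM : A ⊆ M) :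
      MakerWins X F t M B
  | makerMove {M B : Finset α} (e : α) (he : e ∈ X) (heM : e ∉ M) (heB : e ∉ B)
      (h : MakerWins X F false (insert e M) B) : MakerWins X F true M B
  | breakerMove {M B : Finset α} (e : α) (he : e ∈ X) (heM : e ∉ M) (heB : e ∉ B)
      (h : ∀ f ∈ X, f ∉ M → f ∉ B → MakerWins X F true M (insert f B)) :
      MakerWins X F false M B

/-- Maker, moving first, has a winning strategy in the game `(X, F)`. -/
def MakerWinsFirst {α : Type} [DecidableEq α] (X : Finset α) (F : Set (Finset α)) : Prop :=
  MakerWins X F true ∅ ∅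

/-- Maker, moving second (Breaker moves first), has a winning strategy in `(X, F)`. -/
def MakerWinsSecond {α : Type} [DecidableEq α] (X : Finset α) (F : Set (Finset α)) : Prop :=
  MakerWins X F false ∅ ∅

/-- Edge sets of Hamiltonian cycles of a graph `G`. -/
def GHamCycles {V : Type} [DecidableEq V] (G : SimpleGraph V) : Set (Finset (Sym2 V)) :=
  {H | ∃ (a : V) (p : G.Walk a a), p.IsHamiltonianCycle ∧ H = p.edges.toFinset}

/-- Edge sets of Hamiltonian paths of a graph `G`. -/
def GHamPaths {V : Type} [DecidableEq V] (G : SimpleGraph V) : Set (Finset (Sym2 V)) :=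
  {H | ∃ (a b : V) (p : G.Walk a b), p.IsHamiltonian ∧ H = p.edges.toFinset}

/-- `Tpl G m d`: with Breaker to move, Maker can reach the (monotone) goal `G` as soon as he owns
`m` and Breaker owns nothing in `d`; Maker only needs to play inside `d`. -/
inductive Tpl {α : Type} [DecidableEq α] (G : Finset α → Prop) : Finset α → Finset α → Prop
  | base {m d : Finset α} (h : G m) : Tpl G m d
  | step {m d : Finset α} (x : α → α) (m' d' : α → Finset α)
      (h : ∀ f, f ∉ m → Tpl G (m' f) (d' f))
      (h' : ∀ f, f ∉ m → m' f ⊆ insert (x f) m ∧ insert (x f) (d' f) ⊆ d ∧ f ≠ x f ∧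
        f ∉ d' f) : Tpl G m d

namespace Tpl

variable {α : Type} [DecidableEq α] {G G₁ G₂ : Finset α → Prop}

theorem step' {m d : Finset α}
    (h : ∀ f, f ∉ m → ∃ (x : α) (m' d' : Finset α), Tpl G m' d' ∧ m' ⊆ insert x m ∧
        insert x d' ⊆ d ∧ f ≠ x ∧ f ∉ d') : Tpl G m d := by
  have h2 : ∀ f, ∃ (x : α) (m' d' : Finset α), f ∉ m → Tpl G m' d' ∧ m' ⊆ insert x m ∧
        insert x d' ⊆ d ∧ f ≠ x ∧ f ∉ d' := by
    intro f
    by_cases hf : f ∈ m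
    · exact ⟨f, m, d, fun h => absurd hf h⟩
    · obtain ⟨x, m', d', h⟩ := h f hf
      exact ⟨x, m', d', fun _ => h⟩
  choose x m' d' h3 using h2
  exact Tpl.step x m' d' (fun f hf => (h3 f hf).1) (fun f hf => (h3 f hf).2)

theorem mono {m d m₁ d₁ : Finset α} (hG : ∀ s t : Finset α, s ⊆ t → G s → G t)
    (h : Tpl G m d) (hm : m ⊆ m₁) (hd : d ⊆ d₁) : Tpl G m₁ d₁ := by
  cases h with
  | base h => exact Tpl.base (hG _ _ hm h)
  | step x m' d' h h' =>
    refine Tpl.step' fun f hf => ?_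
    have h1 := h f (fun h => hf (hm h))
    obtain ⟨h2, h3, h4, h5⟩ := h' f (fun h => hf (hm h))
    exact ⟨_, _, _, h1, h2.trans (Finset.insert_subset_insert _ hm), h3.trans hd, h4, h5⟩

theorem map_goal {m d : Finset α} (hG : ∀ s : Finset α, G₁ s → G₂ s)
    (h : Tpl G₁ m d) : Tpl G₂ m d := by
  induction h with
  | base h => exact Tpl.base (hG _ h)
  | step x₀ m₀ d₀ h₀ h₀' ih =>
    refine Tpl.step' fun f hf => ?_
    have h1 := ih f hf
    obtain ⟨h2, h3, h4, h5⟩ := h₀' f hf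
    generalize m₀ f = m', d₀ f = d', x₀ f = x at h1 h2 h3 h4 h5
    exact ⟨x, m', d', h1, h2, h3, h4, h5⟩

theorem and_mem {m d : Finset α} (x : α) (hG : ∀ s t : Finset α, s ⊆ t → G s → G t)
    (h : Tpl G m d) : Tpl (fun M => G M ∧ x ∈ M) (insert x m) d := by
  induction h with
  | base h => exact Tpl.base ⟨hG _ _ (Finset.subset_insert _ _) h, Finset.mem_insert_self _ _⟩
  | step x₀ m₀ d₀ h₀ h₀' ih =>
    refine Tpl.step' fun f hf => ?_
    have h1 := ih f (fun h => hf (Finset.mem_insert_of_mem h))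
    obtain ⟨h2, h3, h4, h5⟩ := h₀' f (fun h => hf (Finset.mem_insert_of_mem h))
    generalize m₀ f = m', d₀ f = d', x₀ f = y at h1 h2 h3 h4 h5
    refine ⟨y, insert x m', d', h1, ?_, h3, h4, h5⟩
    rw [Finset.insert_comm]
    exact Finset.insert_subset_insert _ h2

theorem and_base {m₁ m d : Finset α} (hG₁ : ∀ s t : Finset α, s ⊆ t → G₁ s → G₁ t)
    (hG : ∀ s t : Finset α, s ⊆ t → G s → G t) (h1 : G₁ m₁)
    (h : Tpl G m d) : Tpl (fun M => G₁ M ∧ G M) (m₁ ∪ m) d := by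
  induction h with
  | base h =>
    exact Tpl.base ⟨hG₁ _ _ Finset.subset_union_left h1, hG _ _ Finset.subset_union_right h⟩
  | step x₀ m₀ d₀ h₀ h₀' ih =>
    refine Tpl.step' fun f hf => ?_
    have h1 := ih f (fun h => hf (Finset.mem_union_right _ h))
    obtain ⟨h2, h3, h4, h5⟩ := h₀' f (fun h => hf (Finset.mem_union_right _ h))
    generalize m₀ f = m', d₀ f = d', x₀ f = y at h1 h2 h3 h4 h5
    refine ⟨y, m₁ ∪ m', d', h1, ?_, h3, h4, h5⟩
    intro z hz
    have := @h2 z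
    simp only [Finset.mem_union, Finset.mem_insert] at *
    tauto

/-- Two edge-disjoint games are played in parallel. -/
theorem and {m₁ d₁ m₂ d₂ : Finset α} (hG₁ : ∀ s t : Finset α, s ⊆ t → G₁ s → G₁ t)
    (hG₂ : ∀ s t : Finset α, s ⊆ t → G₂ s → G₂ t)
    (h1 : Tpl G₁ m₁ d₁) (h2 : Tpl G₂ m₂ d₂) (hd : Disjoint d₁ d₂) :
    Tpl (fun M => G₁ M ∧ G₂ M) (m₁ ∪ m₂) (d₁ ∪ d₂) := by
  induction h1 generalizing m₂ d₂ with
  | @base m₁ d₁ h1 =>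
    refine mono (G := fun M => G₁ M ∧ G₂ M) ?_ (and_base hG₁ hG₂ h1 h2) subset_rfl
      Finset.subset_union_right
    exact fun s t hst h => ⟨hG₁ _ _ hst h.1, hG₂ _ _ hst h.2⟩
  | @step m₁ d₁ x₁ m₁' d₁' h1 h1' ih1 =>
    have hmm : ∀ s t : Finset α, s ⊆ t → (G₁ s ∧ G₂ s) → (G₁ t ∧ G₂ t) :=
      fun s t hst h => ⟨hG₁ _ _ hst h.1, hG₂ _ _ hst h.2⟩
    induction h2 with
    | @base m₂ d₂ h2 =>
      have := and_base hG₂ hG₁ h2 (Tpl.step x₁ m₁' d₁' h1 h1')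
      have := map_goal (G₂ := fun M => G₁ M ∧ G₂ M) (fun s hs => ⟨hs.2, hs.1⟩) this
      refine mono hmm this (by rw [Finset.union_comm]) Finset.subset_union_left
    | @step m₂ d₂ x₂ m₂' d₂' h2 h2' ih2 =>
      refine Tpl.step' fun f hf => ?_
      simp only [Finset.mem_union, not_or] at hf
      by_cases hf2 : f ∈ d₂
      · have a1 := ih2 f hf.2
        obtain ⟨a2, a3, a4, a5⟩ := h2' f hf.2
        generalize m₂' f = m', d₂' f = d', x₂ f = x at a1 a2 a3 a4 a5
        have hsub : d' ⊆ d₂ := (Finset.subset_insert _ _).trans a3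
        refine ⟨x, m₁ ∪ m', d₁ ∪ d', a1 (Finset.disjoint_of_subset_right hsub hd), ?_, ?_, a4, ?_⟩
        · intro z hz
          have := @a2 z
          simp only [Finset.mem_union, Finset.mem_insert] at *
          tauto
        · intro z hz
          have := @a3 z
          simp only [Finset.mem_union, Finset.mem_insert] at *
          tauto
        · simp only [Finset.mem_union, not_or]
          exact ⟨fun h => Finset.disjoint_left.1 hd h hf2, a5⟩
      · have a1 := @ih1 f hf.1
        obtain ⟨a2, a3, a4, a5⟩ := h1' f hf.1
        generalize m₁' f = m', d₁' f = d', x₁ f = x at a1 a2 a3 a4 a5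
        have hsub : d' ⊆ d₁ := (Finset.subset_insert _ _).trans a3
        refine ⟨x, m' ∪ m₂, d' ∪ d₂, a1 (Tpl.step x₂ m₂' d₂' h2 h2')
          (Finset.disjoint_of_subset_left hsub hd), ?_, ?_, a4, ?_⟩
        · intro z hz
          have := @a2 z
          simp only [Finset.mem_union, Finset.mem_insert] at *
          tauto
        · intro z hz
          have := @a3 z
          simp only [Finset.mem_union, Finset.mem_insert] at *
          tauto
        · simp only [Finset.mem_union, not_or]
          exact ⟨a5, hf2⟩

theorem full {m d M : Finset α} {z : α} (hG : ∀ s t : Finset α, s ⊆ t → G s → G t)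
    (h : Tpl G m d) (hz : z ∉ M) (hm : m ⊆ M) (hd : d ⊆ M) : G M := by
  induction h with
  | base h => exact hG _ _ hm h
  | step x₀ m₀ d₀ h₀ h₀' ih =>
    have h1 := ih z (fun h => hz (hm h))
    obtain ⟨h2, h3, h4, h5⟩ := h₀' z (fun h => hz (hm h))
    generalize m₀ z = m', d₀ z = d', x₀ z = x at h1 h2 h3 h4 h5
    rw [Finset.insert_subset_iff] at h3
    refine h1 (h2.trans (Finset.insert_subset (hd h3.1) hm)) (h3.2.trans hd)

theorem makerWins {X : Finset α} {F : Set (Finset α)} {m d : Finset α} {z : α}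
    (hG : ∀ s t : Finset α, s ⊆ t → G s → G t) (hz : z ∉ X)
    (hF : ∀ M, M ⊆ X → G M → ∃ A ∈ F, A ⊆ M)
    (h : Tpl G m d) : ∀ M B : Finset α, m ⊆ M → M ⊆ X → d ⊆ X → Disjoint d B → Disjoint M B →
      MakerWins X F false M B := by
  induction h with
  | base h =>
    intro M B hm hM _ _ _
    obtain ⟨A, hA, hAM⟩ := hF M hM (hG _ _ hm h)
    exact MakerWins.claim A hA hAM
  | @step m d x₀ m₀ d₀ h₀ h₀' ih =>
    intro M B hm hM hdX hdB hMB
    by_cases hfree : ∃ e ∈ X, e ∉ M ∧ e ∉ B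
    · obtain ⟨e, he, heM, heB⟩ := hfree
      refine MakerWins.breakerMove e he heM heB fun f hf hfM hfB => ?_
      have h1 := ih f (fun h => hfM (hm h))
      obtain ⟨h2, h3, h4, h5⟩ := h₀' f (fun h => hfM (hm h))
      generalize m₀ f = m', d₀ f = d', x₀ f = x at h1 h2 h3 h4 h5
      rw [Finset.insert_subset_iff] at h3
      have hd'B : Disjoint d' (insert f B) := by
        rw [Finset.disjoint_insert_right]
        exact ⟨h5, Finset.disjoint_of_subset_left h3.2 hdB⟩
      have hMB' : Disjoint M (insert f B) := by
        rw [Finset.disjoint_insert_right]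
        exact ⟨hfM, hMB⟩
      by_cases hx : x ∈ M
      · have hm' : m' ⊆ M := h2.trans (Finset.insert_subset hx hm)
        by_cases hfree : ∃ y ∈ X, y ∉ M ∧ y ∉ insert f B
        · obtain ⟨y, hy, hyM, hyB⟩ := hfree
          refine MakerWins.makerMove y hy hyM hyB (h1 _ _ (hm'.trans (Finset.subset_insert _ _))
            (Finset.insert_subset hy hM) (h3.2.trans hdX) hd'B ?_)
          rw [Finset.disjoint_insert_left]
          exact ⟨hyB, hMB'⟩
        · push Not at hfree
          have hfull : MakerWins X F false M (insert f B) :=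
            h1 _ _ hm' hM (h3.2.trans hdX) hd'B hMB'
          cases hfull with
          | claim A hA hAM => exact MakerWins.claim A hA hAM
          | breakerMove e he heM heB _ => exact absurd (hfree e he heM) heB
      · have hxB : x ∉ insert f B := by
          rw [Finset.mem_insert, not_or]
          exact ⟨fun h => h4 h.symm, fun h => Finset.disjoint_left.1 hdB h3.1 h⟩
        refine MakerWins.makerMove x (hdX h3.1) hx hxB (h1 _ _
          (h2.trans (Finset.insert_subset_insert _ hm))
          (Finset.insert_subset (hdX h3.1) hM) (h3.2.trans hdX) hd'B ?_)
        rw [Finset.disjoint_insert_left]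
        exact ⟨hxB, hMB'⟩
    · push Not at hfree
      have hdM : d ⊆ M := fun e he => by
        by_contra h
        exact Finset.disjoint_left.1 hdB he (hfree e (hdX he) h)
      obtain ⟨A, hA, hAM⟩ := hF M hM
        (full hG (Tpl.step x₀ m₀ d₀ h₀ h₀') (fun h => hz (hM h)) hm hdM)
      exact MakerWins.claim A hA hAM

theorem makerWinsFirst {X : Finset α} {F : Set (Finset α)} {z : α}
    (hG : ∀ s t : Finset α, s ⊆ t → G s → G t) (hz : z ∉ X) (hX : X.Nonempty)
    (hF : ∀ M, M ⊆ X → G M → ∃ A ∈ F, A ⊆ M)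
    (h : Tpl G ∅ X) : MakerWinsFirst X F := by
  obtain ⟨e, he⟩ := hX
  exact MakerWins.makerMove e he (Finset.notMem_empty _) (Finset.notMem_empty _)
    (makerWins hG hz hF h _ _ (Finset.empty_subset _) (by simpa using he) subset_rfl
      (Finset.disjoint_empty_right _) (Finset.disjoint_empty_right _))

end Tpl

/-- Binary lookup tree for the table of templates. -/
inductive TplTree where
  | L (x : Nat) : TplTree
  | N (l r : TplTree) : TplTree

/-- Lookup: the low bit of the index chooses the branch. -/
noncomputable def TplTree.get (t : TplTree) : Nat → Nat :=
  TplTree.rec (fun x _ => x)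
    (fun _ _ gl gr i => cond (Nat.beq (Nat.mod i 2) 0) (gl (Nat.div i 2)) (gr (Nat.div i 2))) t

/-- Weight of a vertex, read from a packed table. The weights `0,1,2,4,8,14,19,24` have
pairwise distinct sums of two; the edge `ij` is stored at bit `w i + w j`. -/
def wtN (i : Nat) : Nat := Nat.land (Nat.shiftRight 106873953984576 (Nat.mul 6 i)) 63

/-- Move one edge (in both planes) of a pair of masks. -/
def mvBit (mc e s : Nat) : Nat :=
  Nat.shiftLeft (Nat.land (Nat.shiftRight mc e) 281474976710657) s

/-- Relabelled pair of masks. -/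
def appMask (mc a b c d e f g h : Nat) : Nat :=
  Nat.lor (mvBit mc 1 (Nat.add a b)) <|
  Nat.lor (mvBit mc 2 (Nat.add a c)) <|
  Nat.lor (mvBit mc 4 (Nat.add a d)) <|
  Nat.lor (mvBit mc 8 (Nat.add a e)) <|
  Nat.lor (mvBit mc 14 (Nat.add a f)) <|
  Nat.lor (mvBit mc 19 (Nat.add a g)) <|
  Nat.lor (mvBit mc 24 (Nat.add a h)) <|
  Nat.lor (mvBit mc 3 (Nat.add b c)) <|
  Nat.lor (mvBit mc 5 (Nat.add b d)) <|
  Nat.lor (mvBit mc 9 (Nat.add b e)) <|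
  Nat.lor (mvBit mc 15 (Nat.add b f)) <|
  Nat.lor (mvBit mc 20 (Nat.add b g)) <|
  Nat.lor (mvBit mc 25 (Nat.add b h)) <|
  Nat.lor (mvBit mc 6 (Nat.add c d)) <|
  Nat.lor (mvBit mc 10 (Nat.add c e)) <|
  Nat.lor (mvBit mc 16 (Nat.add c f)) <|
  Nat.lor (mvBit mc 21 (Nat.add c g)) <|
  Nat.lor (mvBit mc 26 (Nat.add c h)) <|
  Nat.lor (mvBit mc 12 (Nat.add d e)) <|
  Nat.lor (mvBit mc 18 (Nat.add d f)) <|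
  Nat.lor (mvBit mc 23 (Nat.add d g)) <|
  Nat.lor (mvBit mc 28 (Nat.add d h)) <|
  Nat.lor (mvBit mc 22 (Nat.add e f)) <|
  Nat.lor (mvBit mc 27 (Nat.add e g)) <|
  Nat.lor (mvBit mc 32 (Nat.add e h)) <|
  Nat.lor (mvBit mc 33 (Nat.add f g)) <|
  Nat.lor (mvBit mc 38 (Nat.add f h)) <|
  mvBit mc 43 (Nat.add g h)

/-- Vertex number `i` of the packed permutation `p`. -/
def pN (p i : Nat) : Nat := Nat.land (Nat.shiftRight p (Nat.mul 3 i)) 7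

/-- The support of a child (both planes), in the coordinates of the parent. -/
noncomputable def kidMask (T : TplTree) (x t p : Nat) : Nat :=
  Nat.lor (appMask (T.get t) (wtN (pN p 0)) (wtN (pN p 1)) (wtN (pN p 2)) (wtN (pN p 3))
      (wtN (pN p 4)) (wtN (pN p 5)) (wtN (pN p 6)) (wtN (pN p 7)))
    (Nat.shiftLeft 1 (Nat.add 48 x))

/-- The packed `p` is a permutation. -/
def permOk (a b c d e f g h : Nat) : Bool :=
  Nat.beq (Nat.lor (Nat.shiftLeft 1 a) (Nat.lor (Nat.shiftLeft 1 b)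
     (Nat.lor (Nat.shiftLeft 1 c) (Nat.lor (Nat.shiftLeft 1 d) (Nat.lor (Nat.shiftLeft 1 e)
     (Nat.lor (Nat.shiftLeft 1 f) (Nat.lor (Nat.shiftLeft 1 g) (Nat.shiftLeft 1 h))))))))
     17318167

/-- Validity of a child. -/
def kidOk (i mc x t p P : Nat) : Bool :=
  cond (Nat.blt t i)
  (cond (Nat.beq (Nat.add (wtN (pN p 0)) (wtN (pN p 1))) 1)
  (cond (permOk (wtN (pN p 0)) (wtN (pN p 1)) (wtN (pN p 2)) (wtN (pN p 3))
      (wtN (pN p 4)) (wtN (pN p 5)) (wtN (pN p 6)) (wtN (pN p 7)))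
  (cond (Nat.beq (Nat.land (Nat.shiftRight 9084392560510 x) 1) 1)
    (Nat.beq (Nat.lor P (Nat.lor mc (Nat.shiftLeft 1 x))) (Nat.lor mc (Nat.shiftLeft 1 x)))
    false) false) false) false

/-- One step of the loop over the children. -/
def kidStep (i mc acc x t p P : Nat) (k : Nat → Bool) : Bool :=
  cond (kidOk i mc x t p P) (k (Nat.land acc (Nat.shiftRight P 48))) false

/-- One child, given by its code. -/
noncomputable def kidCode (T : TplTree) (i mc acc x t p : Nat) (k : Nat → Bool) : Bool :=
  kidStep i mc acc x t p (kidMask T x t p) k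

/-- The loop over the children of a template. -/
noncomputable def kidLoop (T : TplTree) (i mc : Nat) (fuel : Nat) : Nat → Nat → Bool :=
  Nat.rec (fun _ _ => false)
    (fun _ rec kids acc =>
      cond (Nat.beq kids 0) (Nat.beq (Nat.lor acc mc) mc)
        (kidCode T i mc acc (Nat.land kids 63) (Nat.land (Nat.shiftRight kids 6) 4095)
          (Nat.land (Nat.shiftRight kids 18) 16777215) (rec (Nat.shiftRight kids 42)))) fuel

/-- Check of one template. -/
noncomputable def tplOk (T : TplTree) (i kids : Nat) : Bool :=
  cond (Nat.beq kids 0) false (kidLoop T i (T.get i) 40 kids 17592186044415)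

/-- Check of a list of consecutive templates. -/
noncomputable def tplsOk (T : TplTree) (l : List Nat) : Nat → Bool :=
  List.rec (fun _ => true) (fun k _ rec i => cond (tplOk T i k) (rec (Nat.succ i)) false) l

section TplData

open TplTree (L N)

def tplTree0 : TplTree :=
 (N (N (N (N (N (N (N (N (L 2478308556706646872593272900)
 (L 2557029036747806244060790848))
 (L 2553349113122659764981204224))
 (N (L 2554611313141410792286191616)
 (L 79923863691675150005047560))) (N (N (N (L 2557028519144597471069470720)
 (L 2556990220254151939809345856))
 (L 2557029184301492635468632064))
 (N (L 2553325520599428544361402368)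
 (L 2477155053491207652021370944)))) (N (N (N (N (L 2479656750180427139882680320)
 (L 2477220452745131897629261888))
 (L 2556953626300406932514541568))
 (N (L 81148809508718395195916288)
 (L 2557024452790450731029106688))) (N (N (L 2557028887935363756916212736)
 (L 2557024314367812575581720576))
 (N (L 81061806440094144959352840)
 (L 81134836118097233721688128))))) (N (N (N (N (N (L 1311586994416409855149568)
 (L 2479657931722307382758867008))
 (L 78606969144299284840318464))
 (N (L 2556953616140286173166960640)
 (L 2479653209414371312626831376))) (N (N (L 2554611326890900454648316928)
 (L 2557029160961587566618873856))
 (N (L 2478447825513734023761892352)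
 (L 81063414648499197610295360)))) (N (N (N (N (L 2557028887716939174988808704)
 (L 2556989634576774477757023296))
 (L 2556953331080444159125880832))
 (N (L 2554560410348686708231639040)
 (L 2554610151014548551443152960))) (N (N (L 2478438734574556599361208344)
 (L 2557024462004815568629141504))
 (N (L 2556947700416729450905867280)
 (L 2554595735960415533248036928)))))) (N (N (N (N (N (N (L 2477186053143301325320947200)
 (L 2479657858077194471954976832))
 (L 2556953312912923262309368320))
 (N (L 2477192855395932308592657408)
 (L 2554573544151244012537319424))) (N (N (N (L 2557029164708582456597414912)
 (L 2554573252761592726452469824))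
 (L 2554608823909572952374448128))
 (N (L 2557027985341940846408241152)
 (L 77505116185149007798469696)))) (N (N (N (N (L 2557013687962362208317605120)
 (L 2557027856226000116945798208))
 (L 81072929979892695560356864))
 (N (L 2557029035653431534668480512)
 (L 2557019734963596277195997200))) (N (N (L 2479647863303843643234976768)
 (L 2557019739575282304200740864))
 (N (L 2557023281419950250658894848)
 (L 2556979146303488594009915744))))) (N (N (N (N (N (L 2477125100563505164386059264)
 (L 2554554516636473160394358848))
 (L 2553312681670056842016854024))
 (N (L 2557029174004012087490117632)
 (L 78726227428052135345459200))) (N (N (L 2555697171359318880483804192)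
 (L 2557028879936970827283566600))
 (N (L 2557027487054670875016040464)
 (L 2557028735911863531415273552)))) (N (N (N (N (L 2557029035365201158518865920)
 (L 2557028594028200279119298624))
 (L 2557029184159629247206412288))
 (N (L 2554609994915281862793695232)
 (L 2479540134485086378455204928))) (N (N (L 2553326847904814322493424640)
 (L 79940161543186384846590976))
 (N (L 2556991091853802214808355840)
 (L 81095236563300453445566784))))))) (N (N (N (N (N (N (N (L 1272774614791560678932488)
 (L 2556953331310127740111814720))
 (L 2557029017927263401462202368))
 (N (L 2554611184014202276321165312)
 (L 2555815517315118500772057352))) (N (N (N (L 2557024239499972370185060368)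
 (L 2556991400845772648634908736))
 (L 2557028889155839255934140416))
 (N (L 2477229454515297287894470656)
 (L 2477240078860350821484200000)))) (N (N (N (N (L 77435235507321960810151944)
 (L 2557029179638015234135818304))
 (L 2556915394337946659274620960))
 (N (L 2556986681929038297537971200)
 (L 2478437347760848348475621888))) (N (N (L 2557018553286608049584473344)
 (L 2557029184006506868459704320))
 (N (L 2555819077964566691315717120)
 (L 81149090839580192710590528))))) (N (N (N (N (N (L 2555701013040139493261444096)
 (L 1340225152511478096543808))
 (L 2479576457265830005290893568))
 (N (L 81148799853000794379911176)
 (L 2554609856855192282029199360))) (N (N (L 2557029183155326530306965504)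
 (L 2557029170473189988209004560))
 (N (L 2556952298351006416117961728)
 (L 79937508684315075023470656)))) (N (N (N (N (L 2555820257119539119018541056)
 (L 2554611175887456752945397824))
 (L 2555819077964566682734429184))
 (N (L 2554609561853654090566078464)
 (L 2557020919104053513780461648))) (N (N (L 3692849235300488598257672)
 (L 2553400045738229102685523968))
 (N (L 77398190754522057283998720)
 (L 2554609857015061551947710528)))))) (N (N (N (N (N (N (L 2555728904436113874067194384)
 (L 3770459454678785923481664))
 (L 1312601421225271774954496))
 (N (L 79928644782845077422900224)
 (L 2477239932277198945785024512))) (N (N (N (L 2557019720047674311340983296)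
 (L 2554610146245236546058354752))
 (L 2477202070253922863641858048))
 (N (L 2557023276810516032045256704)
 (L 2566491427217547554979904)))) (N (N (N (N (L 2557028002635763406929657856)
 (L 2477161552210248541736796224))
 (L 2556948904145593245355999232))
 (N (L 2555697014710621837748864000)
 (L 2554607785071002310490226752))) (N (N (L 78731082096781258234265616)
 (L 2554527284538219346303979536))
 (N (L 2557028003635562532787196928)
 (L 2557029178631460717418512448))))) (N (N (N (N (N (L 2557013830922376979752944896)
 (L 2553309628819489832024691776))
 (L 2475955374953249095349764096))
 (N (L 79925421428239179116971008)
 (L 2554597165641636557747195904))) (N (N (L 2557029183078765336641668096)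
 (L 81143719288217961922319360))
 (N (L 81147925215672570505924608)
 (L 2547348307296056433705024)))) (N (N (N (N (L 81134392932368428337987848)
 (L 2557029184179895458338963520))
 (L 81149105660926291718701056))
 (N (L 2476012555164874983414272000)
 (L 2477221189684901519070068800))) (N (N (L 2479615208112773145842156560)
 (L 2555782179862481453971936256))
 (N (L 2557029018287551371651842048)
 (L 81147925229183373615825984))))))))

def tplTree1 : TplTree :=
 (N (N (N (N (N (N (N (N (L 81055362543380036193616400)
 (L 78716787108614035076579392))
 (L 2553349114275581269588050176))
 (N (L 2554611331583651266368372736)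
 (L 2555813755930282638406848776))) (N (N (N (L 2556991330508544872344978432)
 (L 2556971335399906479655879744))
 (L 2556991405432680073090109440))
 (N (L 2553401226329841024138219520)
 (L 2477154629148548758383886400)))) (N (N (N (N (L 77430946202475659486560512)
 (L 2477240080155135718443728960))
 (L 77437316170349805983236112))
 (N (L 81149104656623574546644992)
 (L 79922078894876625023308816))) (N (N (L 2479657930627932669087843328)
 (L 2557024461941765165256036352))
 (N (L 2557017516805671817117175816)
 (L 81139650718300471847551040))))) (N (N (N (N (N (L 2477191665565176955358430720)
 (L 2556991405245780692778352704))
 (L 2554487066166307233097582080))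
 (N (L 2478443682990206769118069760)
 (L 2557024461869707579808026624))) (N (N (L 78731252940833122532197376)
 (L 2556911106699432220067631120))
 (N (L 2479581193469622738613440512)
 (L 77446146774455958381264960)))) (N (N (N (N (L 78612672363255523516154384)
 (L 2556990224872584827872740416))
 (L 2556953331368674535275495424))
 (N (L 78607292047888697088282624)
 (L 2556990149934938566248367168))) (N (N (L 2478438808361532893930979352)
 (L 2557029184371298429684420608))
 (N (L 2557023281413194851217838096)
 (L 2554610004589013866746232896)))))) (N (N (N (N (N (N (L 2477190775509784194965636608)
 (L 2479655543001806022151766080))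
 (L 2554611009911796081614914048))
 (N (L 2476021118277672472470945792)
 (L 2554611323373589145660231680))) (N (N (N (L 3777833538370451542377472)
 (L 2554568531259800985262391360))
 (L 2554605872286405970636132352))
 (N (L 2556947128648727959202436112)
 (L 79932412557343730593956928)))) (N (N (N (N (L 2557018557902797667639231488)
 (L 2557028002647031202015609920))
 (L 81072957650008806124422144))
 (N (L 65329441374618014188576)
 (L 2555810813602545279118086152))) (N (N (L 2557019143582418408310834176)
 (L 2557029184308248034901233664))
 (N (L 2557027929999456825465966592)
 (L 2557019581715116953050284352))))) (N (N (N (N (N (L 2567432035524921075713024)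
 (L 2554573406104656438786801728))
 (L 2553326848769505450952495104))
 (N (L 2556952504723955740751954960)
 (L 78650678720144263441092608))) (N (N (L 2555810812674803755879760896)
 (L 2557029175084876006636392448))
 (N (L 2557027856205725131186638864)
 (L 2557019586326802971494449216)))) (N (N (N (N (L 2554573469355461401175458048)
 (L 2557014403870321578047210560))
 (L 2557029175078120598613804032))
 (N (L 2477238742894542959653752832)
 (L 2479577922640321372471689280))) (N (N (L 2556953625363658210017542144)
 (L 79930735256964719534149632))
 (N (L 79901787631769456514696192)
 (L 2557018406728217188689281344))))))) (N (N (N (N (N (N (N (L 3766626853115301263114240)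
 (L 2479657636718517391481897024))
 (L 2557014989466625721497813000))
 (N (L 2553396945532303214886518800)
 (L 2555820258128345444126822656))) (N (N (N (L 2557019664707442090484695040)
 (L 2479620153002122399881101376))
 (L 2557024166861413980326854656))
 (N (L 2553348961860258805609960448)
 (L 2477240079150832997382488128)))) (N (N (N (N (L 81137593888321579916722184)
 (L 2557029175026329215708430400))
 (L 2554535326242266376514306304))
 (N (L 2557024460860901254699679744)
 (L 2555809623933919512737419776))) (N (N (L 2557029178611194506286203136)
 (L 81142022174252390343774208))
 (N (L 2555819077960063091688346624)
 (L 81149095449014136513495104))))) (N (N (N (N (N (L 2553325077012879646883316736)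
 (L 2554610446004827743846416448))
 (L 3700223391049744055075072))
 (N (L 151065230841007103344640)
 (L 2554611037590928187516325888))) (N (N (L 2555744699544043580846769152)
 (L 2557019587234269508952658960))
 (N (L 2555818930395117701266674688)
 (L 81030367578958928665903168)))) (N (N (N (N (L 2557024165271643311864545304)
 (L 78655694809143309607436352))
 (L 2557028003640066123833278720))
 (N (L 2553257041878654698940339200)
 (L 81135748943698244128473184))) (N (N (L 2556944180342462098870370304)
 (L 2476025177718793792928157696))
 (N (L 79816042393751040755504128)
 (L 2554590892609231999052349504)))))) (N (N (N (N (N (N (L 2555733626802596743712408064)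
 (L 81141717818737764214505536))
 (L 1350380353088228932469760))
 (N (L 2557019715282865905583031296)
 (L 2477240080141633711425785856))) (N (N (N (L 2557028869632734871278584832)
 (L 2554611331158061105931649088))
 (L 2554611323013309971566759936))
 (N (L 3774002596383433681342464)
 (L 3777778432325411231760448)))) (N (N (N (N (L 2555820238663787846056542208)
 (L 2557029184094335848694415424))
 (L 2475940460609794913660387360))
 (N (L 2557019720047674311344915456)
 (L 2554610146402862533015797824))) (N (N (L 79940100438346632240562192)
 (L 2554604249110296068922347536))
 (N (L 2557018558911603992751510528)
 (L 2557029183243146727255965760))))) (N (N (N (N (N (L 2554605276012067106603729152)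
 (L 2553385186683215746348106816))
 (L 2555744553123021291870224384))
 (N (L 3776966757571777896907776)
 (L 2554606610374593500944601088))) (N (N (L 2477197577690357584199943168)
 (L 2557023871645954806558773248))
 (N (L 3653817158826825667907584)
 (L 3756274126910685339975744)))) (N (N (N (N (L 81139290975265562451509256)
 (L 2557019721144300833481949248))
 (L 2557019739498721101958086664))
 (N (L 2476012555453105359565918208)
 (L 1279410846734672053731392))) (N (N (L 2479657783198095267487286272)
 (L 2555820253946753190113317888))
 (N (L 81144215981213665357725712)
 (L 81147925231435173429510208))))))))

def tplTree2 : TplTree :=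
 (N (N (N (N (N (N (N (N (L 78637510906402852535795728)
 (L 81139661018032548927242304))
 (L 2555810647804777072154640640))
 (N (L 2554530746838050078116282624)
 (L 2555777743269661139307335944))) (N (N (N (L 2557029109438156029693002752)
 (L 2556977528819919833786286656))
 (L 2554601588088641646755942400))
 (N (L 2553316218752168182669381632)
 (L 2477230634417867258108837952)))) (N (N (N (N (L 77430946351094447189787136)
 (L 2554609976763523843782361152))
 (L 77446760903315270395822096))
 (N (L 2557024460856397655340744704)
 (L 79922171272712181646890000))) (N (N (L 2557029183083268936269037568)
 (L 2528238259558437361815560))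
 (N (L 2557018263907814001474539528)
 (L 79859889320378004701970512))))) (N (N (N (N (N (L 2479656750103865946083181056)
 (L 2554611332538414391590649920))
 (L 2556914666993096040051377152))
 (N (L 2556905354695232751625307168)
 (L 2557029184236190440863305728))) (N (N (L 1349591910153265005200384)
 (L 2556991386929641004036263936))
 (N (L 2479656751331096853122977792)
 (L 81073542199226040297455680)))) (N (N (N (N (L 2554492750934016073312305680)
 (L 2557028003444159814979092544))
 (L 2556953626516579714624126976))
 (N (L 2554572373217592696019095552)
 (L 3738892691314444480021568))) (N (N (L 2555810060816860365019152408)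
 (L 77437090479209604887678976))
 (N (L 2556985502490339093310870528)
 (L 2554602178341667813355946048)))))) (N (N (N (N (N (N (L 2477190780121470213392958976)
 (L 2479657931864170766793179200))
 (L 2556991082614658783175246336))
 (N (L 77512808664326854280282112)
 (L 2554601076205004400199012352))) (N (N (N (L 81149086209879500833162240)
 (L 2477197279092695094232907840))
 (L 2554535027703150677746323456))
 (N (L 2557027413490622761598456832)
 (L 79932431004087804303507520)))) (N (N (N (N (L 2554609846332522956727844864)
 (L 2557028003799952706622194752))
 (L 81068511691953066345512960))
 (N (L 2483181080603876229383200)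
 (L 2557019739431167107547529224))) (N (N (L 3739459771068719875228672)
 (L 2554608676400922557294383104))
 (N (L 2478334488711389752835970048)
 (L 2557029026448082692340711488))))) (N (N (N (N (N (L 2479656436572267087803991040)
 (L 2554578689860595458994619456))
 (L 79864622126204535657463808))
 (N (L 2557028343756413591074374656)
 (L 77515244724415693618483200))) (N (N (L 2478449004952433227988993024)
 (L 78652154313303176604028928))
 (N (L 2557027856070617142365524992)
 (L 2557029031059768710768099392)))) (N (N (N (N (L 2553402405475806261310193664)
 (L 2557028792042468695349952576))
 (L 81134863693637477371757568))
 (N (L 2475907044684186159731250176)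
 (L 2479581192334715636743929920))) (N (N (L 1284423963357684833714176)
 (L 2568927530090592016011264))
 (N (L 2555772425937143884877136896)
 (L 2557027999188257904986685760))))))) (N (N (N (N (N (N (N (L 1273078990572376513904640)
 (L 2557028889173853654368124992))
 (L 2557029165789446367288229888))
 (N (L 77470219469227374694891536)
 (L 2555820258416575820278534144))) (N (N (N (L 2557029109440407829506686976)
 (L 2556991405457458667058102336))
 (L 2557019444494931110681116680))
 (N (L 2554557887679873434784665600)
 (L 2554535773740191825300357184)))) (N (N (N (N (L 81147905465136396225479680)
 (L 81101720593842362286866752))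
 (L 2556953478798511936878149632))
 (N (L 2557029035648927935041110272)
 (L 2555809633233852743257489920))) (N (N (L 2557019729255283749499962880)
 (L 2557029184294737244609318912))
 (N (L 2555819077969070290943086592)
 (L 81148795680415739445510208))))) (N (N (N (N (N (L 2555819076816148777754952704)
 (L 2554576791082194239500599360))
 (L 2556952145012446294960242944))
 (N (L 81149095433251537960304640)
 (L 2554611323515452533922402304))) (N (N (L 2478439560142906295301702656)
 (L 2557019439806683907165786136))
 (N (L 2557027561066827151090651136)
 (L 81111311905465165052117056)))) (N (N (N (N (L 81149081300955907005349904)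
 (L 78731254114020829811507264))
 (L 2557027999172495293481746688))
 (N (L 2554465967698269328115044352)
 (L 2479644280199447723410260064))) (N (N (L 1268052257315890288410656)
 (L 2553401226329841024138022912))
 (N (L 79817222985371758166803456)
 (L 78635626262548513728561216)))))) (N (N (N (N (N (N (L 2553278134577581481278113280)
 (L 79897295428500934527291456))
 (L 2554601712689732537208292352))
 (N (L 2478363264474728423013745664)
 (L 2554611332596961182513958912))) (N (N (N (L 78730349054877110521562112)
 (L 2554611331453046881390198848))
 (L 2554603944455292076190928896))
 (N (L 2555115525961802496151568)
 (L 81130141421730199832100928)))) (N (N (N (N (L 81111306845670983744880640)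
 (L 2557029036808613635102605632))
 (L 2475940460898025289812033568))
 (N (L 2556981959562555427892757504)
 (L 2554588305232699279807152192))) (N (N (L 81139636793170149083447312)
 (L 2554606610365595097782882304))
 (N (L 2557023281278086862396724224)
 (L 2557029183245398522774683712))))) (N (N (N (N (N (L 2557027998024077388502270208)
 (L 2554594186289806674651792448))
 (L 2555744691473593048598904832))
 (N (L 81148514360813215840994304)
 (L 2557023867106326382161498112))) (N (N (L 2556991404151405979107329024)
 (L 2556984321822157173914882048))
 (N (L 81138480484958631029182464)
 (L 3775163592842163918733376)))) (N (N (N (N (L 79892291084889996017009664)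
 (L 2557019739591044907124392000))
 (L 2557029175008314804393738248))
 (N (L 2554600407575833922815954944)
 (L 1354968710460586376888384))) (N (N (L 2479648486039082118141706240)
 (L 2555810809216039250653351936))
 (N (L 2555744224540383682828173312)
 (L 2557018254407470591764398176))))))))

def tplTree3 : TplTree :=
 (N (N (N (N (N (N (N (N (L 81055362545631836007301136)
 (L 79940179931383929625903168))
 (L 2557029018357357165741867264))
 (N (L 2554535773724428951672324096)
 (L 2555815526970836101854400520))) (N (N (N (L 79935235028532398053654544)
 (L 2556980780132872218946306624))
 (L 2557028889225645050153734144))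
 (N (L 2554610152077398059274997760)
 (L 2477225662790664608800587840)))) (N (N (N (N (L 3771773913546627278454792)
 (L 2554611304640866499842555968))
 (L 2554535765293690449234558992))
 (N (L 2556948755423222750699847696)
 (L 79922171281719380633195536))) (N (N (L 2555819961967130340168564992)
 (L 2528385833511027036131336))
 (N (L 2556952150777053826441548800)
 (L 81073537587540296814559296))))) (N (N (N (N (N (L 2557013835452998204887664128)
 (L 2555814945686728588931895360))
 (L 2556943000820446288664658432))
 (N (L 2557018843822827210513843232)
 (L 2554611314292080771946516480))) (N (N (L 2554610446067878134272230400)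
 (L 2557029018287551371517382656))
 (N (L 2479656751328845053309292544)
 (L 79930628053279455832440896)))) (N (N (N (N (L 3687605746045736848523792)
 (L 2557028003516217409016954944))
 (L 2556976039017895300247584768))
 (N (L 77430798919005245640803328)
 (L 81110145151154311288325184))) (N (N (L 2557019733729609979296481304)
 (L 77437164266185899717496832))
 (N (L 2557023281422202050472579072)
 (L 2554593327507392134667567168)))))) (N (N (N (N (N (N (L 2478392617779665723840071168)
 (L 2557028298875791495915896896))
 (L 2521376356741585156964864))
 (N (L 2554601886855189126973489152)
 (L 2554611258809984887684141056))) (N (N (N (L 2557029164636524862559486976)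
 (L 2554537743569641366260060224))
 (L 2475905776051696326876925952))
 (N (L 2557027408881188542984818688)
 (L 81143718223116650280386624)))) (N (N (N (N (L 2557027707487858227711049728)
 (L 2557029184103343047881850944))
 (L 81068825579336295186956288))
 (N (L 2478363412057679415855809568)
 (L 2557019739575282295623385088))) (N (N (L 2555781883566158361062016000)
 (L 2554608823830759958895464448))
 (N (L 2556952445922707205980689408)
 (L 2557029174022026485924102208))))) (N (N (N (N (N (L 81147901004321240058692608)
 (L 2554597579326526937575473216))
 (L 2555744109248233222141117440))
 (N (L 2557028519144597479386776576)
 (L 78726458005597657248632832))) (N (N (L 2553397609615081072605791232)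
 (L 2557027976030748608232181760))
 (N (L 2557027856214732330441379840)
 (L 2557028874262444084236976192)))) (N (N (N (N (L 1359336046925831378894848)
 (L 2556952717525793529146146880))
 (L 79938703020921855072551936))
 (N (L 2475907044756243753769177088)
 (L 2556952444787800104111178816))) (N (N (L 2479582372908321942840541184)
 (L 79940179987678658742457344))
 (N (L 2556990796620319846442996736)
 (L 2557027999190509704800370752))))))) (N (N (N (N (N (N (N (L 2554482194784719897314525696)
 (L 81125189545054919977336896))
 (L 2557026647804376714762781952))
 (N (L 2554568830001578663038943248)
 (L 2555820258560690999764455424))) (N (N (N (L 2479657543318364723815121920)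
 (L 2554464398524822562491367744))
 (L 2557028889227896849971544064))
 (N (L 2554600393821840660828033024)
 (L 2554535773742443625113976896)))) (N (N (N (N (L 81147924065002857265627136)
 (L 2557010141433950662471713088))
 (L 78645208026540385675247624))
 (N (L 2479647738869385938971149312)
 (L 2557018558911603988464992256))) (N (N (L 2557019738489914785423164416)
 (L 2557019739566275104945999888))
 (N (L 2557028003428396949928218624)
 (L 81149095442258737038884928))))) (N (N (N (N (N (L 2479651875195960097771946240)
 (L 2554609838135971639134797888))
 (L 81058177196320021220163840))
 (N (L 2557019729271046348199690248)
 (L 2554606610372350497223938048))) (N (N (L 2555820257403265895811252224)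
 (L 2557019734963596285773352976))
 (N (L 3766480936487378627923968)
 (L 81148721900194844182577216)))) (N (N (N (N (L 2554606087731856744611119120)
 (L 2554611037536876200123236416))
 (L 2557027994560809275188576256))
 (N (L 2554522636096063763922620416)
 (L 2557016122950594349297041504))) (N (N (L 78639305000882529326351392)
 (L 2553402333134494242669924352))
 (N (L 79902225802739793505027072)
 (L 2554591262697034977841840192)))))) (N (N (N (N (N (N (L 2553315913509444438439821824)
 (L 2555815227150446300553019456))
 (L 2555772278577103481408328704))
 (N (L 2557019738485411185795793920)
 (L 2557028593938128290933904384))) (N (N (N (L 2557028574484829691925758976)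
 (L 2554611332533910791959117888))
 (L 2554611323445655535790133248))
 (N (L 2564560258927541518143504)
 (L 81149030887661678410858560)))) (N (N (N (N (L 2479657912037073407304794112)
 (L 2557029184382566224779018304))
 (L 2477149977013441481601466400))
 (N (L 2557019443346513205701640200)
 (L 2554607199319323975801700416))) (N (N (L 81149081298704107191664656)
 (L 2554611249575353851761987584))
 (N (L 2557028003644569732041936896)
 (L 2553388382365453734559973440))))) (N (N (N (N (N (L 2479656436585777886820303872)
 (L 2554601269839522183026590784))
 (L 2555744405549068702193811456))
 (N (L 81149104652119975187709952)
 (L 2557023871573906008605528064))) (N (N (L 78731252864271929135072256)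
 (L 2557022100758523730435526656))
 (N (L 81142381962323021352947712)
 (L 3751569995502707183976512)))) (N (N (N (N (L 2554568581038087662636909568)
 (L 2557029184324010637824884800))
 (L 2557029184231686841248514048))
 (N (L 2554609857001550473826406400)
 (L 2477235351729059546047512640))) (N (N (L 2479657921548675820309184512)
 (L 2555744548223096109794332672))
 (N (L 2557029017206687460952899584)
 (L 2557027708652038744061247584))))))))

def tplTree4 : TplTree :=
 (N (N (N (N (N (N (N (N (L 81057728338307489451999744)
 (L 81073547887272369666392128))
 (L 2557029018359608965555552256))
 (N (L 2554601563595815073305853960)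
 (L 2555819954189413792146788360))) (N (N (N (L 2557028961794397645792346128)
 (L 2479618953959254017718636608))
 (L 2557029184373550229506555904))
 (N (L 2554610152000836865609699328)
 (L 2477225662799671807786893376)))) (N (N (N (N (L 2557027827382687507568394248)
 (L 2554535608642732814809448512))
 (L 2556948599553639647406981144))
 (N (L 2478434173767946165964243968)
 (L 79922466429624559985497104))) (N (N (L 2554535773429443176075428096)
 (L 2566169377060002755252232))
 (N (L 2557027708496664552689112064)
 (L 81144004149901592725815360))))) (N (N (N (N (N (L 78640176746900079778202128)
 (L 2557028593881833287006552128))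
 (L 1277478822760732766258176))
 (N (L 2557028583708201728784466944)
 (L 2557029161319623736990666752))) (N (N (L 2554611331516097271957554176)
 (L 2557029091930412478283911168))
 (N (L 2479656751324341453681922048)
 (L 81139064962118262788194376)))) (N (N (N (N (L 2479567684316806282351804944)
 (L 2557028003732390191130738752))
 (L 2557018549467555569869275136))
 (N (L 77430799063120433715610624)
 (L 2556914665858188946763154496))) (N (N (L 2557014707063907487481593880)
 (L 77494939464121433468243984))
 (N (L 2557027929992701426024910848)
 (L 2554607790979725021600284736)))))) (N (N (N (N (N (N (L 2479603904782521787577337344)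
 (L 2478410912212000035691824192))
 (L 2479648164290665739714822656))
 (N (L 2554611036440249686644752384)
 (L 2554610147305834253942099968))) (N (N (N (L 2478444264134702685002941440)
 (L 2554537762016385439967514688))
 (L 2475981333915413445107322880))
 (N (L 2556947128578922169273225216)
 (L 81148435619877331222921280)))) (N (N (N (N (L 2554609247106074536946435072)
 (L 2557029184031285453843877952))
 (L 81073547941315565204799488))
 (N (L 77436867539769325846003760)
 (L 2557019739503224701585457152))) (N (N (L 2557028588319887747211854848)
 (L 2554604248966172085156122624))
 (N (L 2556990224854570163142398976)
 (L 78728799327964739860955200))))) (N (N (N (N (N (L 78730053974526200322982912)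
 (L 2554504109683321446623954016))
 (L 2555701899490418069256274176))
 (N (L 81148514360813224426734592)
 (L 78725351135651040204492800))) (N (N (L 77517604817786018763637760)
 (L 2557028003714375517678604288))
 (N (L 81147915913487540172362752)
 (L 2554468687178898713365512768)))) (N (N (N (N (L 2476021117996197495760289792)
 (L 2557029161265580545688502336))
 (L 81149105732983885484016640))
 (N (L 2476012698268996146967171072)
 (L 2556952444790051903924863040))) (N (N (L 2479657930767544257804763136)
 (L 79930583062318911923950592))
 (N (L 2553364609468545316697146368)
 (L 2479618972414996498884870208))))))) (N (N (N (N (N (N (N (L 2554482342358672486988841472)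
 (L 2479638967458341488968663104))
 (L 2479616588146303369933493248))
 (N (L 78726364630214783168151568)
 (L 2554572815793083477165936640))) (N (N (N (L 2479657912325303783454147584)
 (L 2554464416971566636196725056))
 (L 2557029184375802029320175616))
 (N (L 2553389401966890051061420032)
 (L 2554606609239686669792182336)))) (N (N (N (N (L 2557022837115077204161855744)
 (L 3746987197824102010224960))
 (L 81073538578332214777348104))
 (N (L 2557028445357621175962829824)
 (L 2557018557614567295782289408))) (N (N (L 2478449000261934216082883584)
 (L 2557029184299240844236427264))
 (N (L 2557028003712123726452495360)
 (L 81127032915670198909943872))))) (N (N (N (N (N (L 3761443381080983662231816)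
 (L 78726225788741875318931520))
 (L 2556952441313272978785698048))
 (N (L 2556953168732432991858524176)
 (L 2554611332738824570776129536))) (N (N (L 2555820238961025421460636672)
 (L 2557028884548656845711478784))
 (N (L 2557027256695549934881017856)
 (L 3774517463655429182128192)))) (N (N (N (N (L 2557029182930146548938440720)
 (L 2554611328073095361048674368))
 (L 2557027856210228722232721664))
 (N (L 78677965690264729404379392)
 (L 2557025641470536383425675328))) (N (N (L 78648749733848268616778752)
 (L 2553402406777355349432274944))
 (N (L 77483940662773003166942208)
 (L 2554610152160714656609009728)))))) (N (N (N (N (N (N (L 3686203793496134918668816)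
 (L 2557024157581746948088004672))
 (L 2557019573626643226264077312))
 (N (L 2556991371716481462785278208)
 (L 2557028593940380090747588608))) (N (N (N (L 2557029164778388250817725440)
 (L 2554606310479894318571618368))
 (L 2553402406849404147511398400))
 (N (L 2557019872944881669284892688)
 (L 2557026739047313952728940640)))) (N (N (N (N (L 78655676416442152201224192)
 (L 2557029184391573424033497152))
 (L 2556948608995436266191323168))
 (N (L 2557019738494418385054466048)
 (L 2554609560718738192737566784))) (N (N (L 1269753962701290557440016)
 (L 2477202300905768983332982784))
 (N (L 2556952372137982710964555776)
 (L 2554599669368301006759231552))))) (N (N (N (N (N (L 2479656450416332342475161600)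
 (L 78730654509270041206210624))
 (L 2555744700696965085453615104))
 (N (L 81035251349948839382482960)
 (L 2557023871718012400588361728))) (N (N (L 2554611308372098786900837376)
 (L 2479539798899360136427491328))
 (N (L 81147925208917171073191936)
 (L 3777543236338471332741184)))) (N (N (N (N (L 2554606516767275246329806848)
 (L 2557029184396068227567845440))
 (L 2557029036513619063492071424))
 (N (L 2554609833866559462902075392)
 (L 2477216162794019045651841088))) (N (N (L 2479657538625613903505163264)
 (L 2555820106375052400267366400))
 (N (L 2555818911502517255859867904)
 (L 2557027708654290543874932800))))))))

def tplTree5 : TplTree :=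
 (N (N (N (N (N (N (N (N (L 81057728340559289265684480)
 (L 3769870467164131817947200))
 (L 81147906768928488208732160))
 (N (L 2554611331579147666741002240)
 (L 2555820249337318971499614208))) (N (N (N (L 79930051502454885058610176)
 (L 2479609527605478357727187520))
 (L 81144383438558610149343232))
 (N (L 2477238899246011227371212800)
 (L 2477239839126987257111658560)))) (N (N (N (N (L 2556952430648749061306646528)
 (L 2554611314163727911915372608))
 (L 3697250078546956937856016))
 (N (L 2557024460858649454885995520)
 (L 79924832296609607273419776))) (N (N (L 2557029182934650148561879296)
 (L 79925694179743694877364232))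
 (N (L 81133222874667247657308160)
 (L 81144373084783066648412224))))) (N (N (N (N (N (L 81058028386129063249707536)
 (L 2557029184177643645645094976))
 (L 1278069262686279413548544))
 (N (L 78593773818067196122825744)
 (L 2557029165931309755418021888))) (N (N (L 2555697475807166086449726464)
 (L 2557028870713598790430887936))
 (N (L 2479656603759396063260250112)
 (L 81139655329986215531774016)))) (N (N (N (N (L 2556953177667574652561588240)
 (L 2553401226345603897644549184))
 (L 2557013541248597151766020096))
 (N (L 2553310878789063084019028992)
 (L 2556990223719663061272888384))) (N (N (L 2557019733882732366627078160)
 (L 77515009521673354649604112))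
 (N (L 2557018559046711981572624392)
 (L 2554609707999957081512755264)))))) (N (N (N (N (N (N (L 2556975157237858054758467072)
 (L 2556991110086616510095688768))
 (L 2557028713977072750287913472))
 (N (L 2554611331588154865995481088)
 (L 78728297863405226856878080))) (N (N (N (L 2557024433114223950466139136)
 (L 2554549642082108678922076224))
 (L 2475983695098654879927832576))
 (N (L 2562425057308209026502656)
 (L 79939514700179096627314752)))) (N (N (N (N (L 2554610150910965755794424832)
 (L 2557029184175400641919730752))
 (L 81064103212853425541742592))
 (N (L 77436867683884513787641904)
 (L 2557019739647339889657118720))) (N (N (L 2557019733727358179482829824)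
 (L 2554608971548827736646684672))
 (N (L 2557028003786433120304107520)
 (L 2554611257816941174074638400))))) (N (N (N (N (N (L 2557027984189019333220107264)
 (L 2554504478618202920816034880))
 (L 2478330937719919750703808512))
 (N (L 2557028592931573765635048448)
 (L 78726531803832951146876928))) (N (N (L 2553326552756917939237553152)
 (L 2555735103699547744590893056))
 (N (L 2557027994493255289225090048)
 (L 2554544245042624627680543296)))) (N (N (N (N (L 2554611331299924489843834880)
 (L 2479651138846162036437090368))
 (L 2553388230522088698060754944))
 (N (L 2476017420635479016612368384)
 (L 2557018557918560279144170560))) (N (N (L 2479657930769796057350013952)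
 (L 79940175378244440145530880))
 (N (L 2556991386929641004030755840)
 (L 2556990223715159461645517888))))))) (N (N (N (N (N (N (N (L 1348332629388062519263744)
 (L 2557010294853575555594846272))
 (L 2557026804745816529369826304))
 (N (L 2477159282393775750978273296)
 (L 2554573553665098225360637952))) (N (N (N (L 2477239322802800777836643328)
 (L 2554464490758542931026542912))
 (L 2554573553737155819398565888))
 (N (L 2554600707416489913890377728)
 (L 2554601886873203800146968640)))) (N (N (N (N (L 2555738058716177045404255488)
 (L 2557019568873093832391033152))
 (L 2556953617144588890070323208))
 (N (L 2556981203246057201894163456)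
 (L 2557018558983661582502920192))) (N (N (L 2479657930767544257532396544)
 (L 2555817527929157741954732040))
 (N (L 2557023281350144456434652160)
 (L 81148947872809747224739904))))) (N (N (N (N (N (L 81132695836417246548459784)
 (L 2554611037462566806405267520))
 (L 2479576157508490611621363712))
 (N (L 2553402244071299215710552080)
 (L 2557028880006776621507874816))) (N (N (L 2555820257398762295915447296)
 (L 79940101519210551386837008))
 (N (L 81133504322622635424879632)
 (L 3776878646896863870517312)))) (N (N (N (N (L 2479581925214490185194078224)
 (L 2477164521933373633885962304))
 (L 2557028003781929512095450112))
 (N (L 2554558044261025279200530688)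
 (L 2557027855077573428758185024))) (N (N (L 2555728743027103228974351872)
 (L 2553402406921461741415108608))
 (N (L 81111308430938048278299648)
 (L 2554581743021919914170515552)))))) (N (N (N (N (N (N (L 3686351367448724595081728)
 (L 2554611332680277775624962112))
 (L 2557019720982171234013025280))
 (N (L 2557028883310166939736998144)
 (L 2557019734891538691735425032))) (N (N (N (L 2557029164780640050631148544)
 (L 2554611332605968385996521536))
 (L 2554606315154630727554371584))
 (N (L 2557027989944619665580953616)
 (L 2557026748275189589211086912)))) (N (N (N (N (L 2557029164492409674485727232)
 (L 2557029184393816427754160192))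
 (L 2554521072820072184832589824))
 (N (L 2557019433900212987292025888)
 (L 2554610003440595961766756416))) (N (N (L 3687605604182348720504856)
 (L 2554611332587953983260266496))
 (N (L 2556909944338382807130705936)
 (L 78699225517773687766483008))))) (N (N (N (N (N (L 1268790268942226932711424)
 (L 2554610742017424051512885312))
 (L 2556953036144208162257440768))
 (N (L 81111030214315668030881808)
 (L 2557024457399884949642874880))) (N (N (L 2554611303773923567355560960)
 (L 2556986683005398608475344896))
 (N (L 81147925073809182243689472)
 (L 3777769193190775846862912)))) (N (N (N (N (L 2557029109435904230147751936)
 (L 2556990223712916453629887552))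
 (L 2556981802760727201998455808))
 (N (L 2554531628967116290418085888)
 (L 2477140438902841068503711808))) (N (N (L 2478395919681552731854603288)
 (L 2555820244725632953072291840))
 (N (L 2557029018215493777479696640)
 (L 2556968235043101212530705472))))))))

def tplTree6 : TplTree :=
 (N (N (N (N (N (N (N (N (L 3721888954604540032975112)
 (L 3777853295662021036474432))
 (L 81147906683360095288693248))
 (N (L 78730736508560252331884560)
 (L 2555815536191956338895492096))) (N (N (N (L 3762873150113679885271296)
 (L 2479618972410501691055542336))
 (L 2568336009301125836571648))
 (N (L 2553398837474231953683386368)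
 (L 2477230468397179390866227264)))) (N (N (N (N (L 2479656740880493909362622464)
 (L 78626550309090336229572672))
 (L 81068521126994285718142992))
 (N (L 2555814944745476266819322880)
 (L 2557015017278605228779770880))) (N (N (L 2477240078912142217073394688)
 (L 79860757028918218828288008))
 (N (L 2478441996342606731543598080)
 (L 81148283794526967926095936))))) (N (N (N (N (N (L 81058032997815081677095424)
 (L 2557019435217516153100828736))
 (L 2477158147833446824916829696))
 (N (L 81030514923227933118104592)
 (L 78730659247056844971642880))) (N (N (L 2557019646179633223482475520)
 (L 81111012920493098919825408))
 (N (L 3776672762588103138414592)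
 (L 3753866835816269891502144)))) (N (N (N (N (L 3777187828018477990477824)
 (L 2554610152165218526819254336))
 (L 2557028003495950940052389888))
 (N (L 2553310888012434845995897856)
 (L 2556990223721914861086572608))) (N (N (L 2479657898485742128546971648)
 (L 77515014133359373076992000))
 (N (L 2557028003779677720863051776)
 (L 77503636973347798126199872)))))) (N (N (N (N (N (N (L 2556980474516340901163566592)
 (L 2479657636707258388420493376))
 (L 2555766228031536506061194752))
 (N (L 2554605428330561908009926656)
 (L 2475975883188527036610744320))) (N (N (N (L 2557023114246332074084795648)
 (L 2554573549062419410407948352))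
 (L 2553392805030883405409095680))
 (N (L 3771064952389695435247616)
 (L 81148440591851319705731136)))) (N (N (N (N (L 2553324929441178857020589056)
 (L 2557029183166594325388739648))
 (L 81073547657588788680458240))
 (N (L 77436867755942107825569824)
 (L 2557029184380305628939157504))) (N (N (L 2557029178613446306103821312)
 (L 78731254156805021917843456))
 (N (L 2557027929997205025652281344)
 (L 2554610151012296751497609280))))) (N (N (N (N (N (L 2557023257208598645333820672)
 (L 2554504479771124425422880832))
 (L 2555739978330491011901423616))
 (N (L 2554611331585903066177864704)
 (L 2554604101615156472724918288))) (N (N (L 2553402405768540236820775936)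
 (L 2556991391106729658422398992))
 (N (L 81142893796420672002002944)
 (L 2556981059941517058890007104)))) (N (N (N (N (L 2557019655195839677478207496)
 (L 2557027999120703901986783296))
 (L 2557014786617743105163612160))
 (N (L 2553401078751384834701332480)
 (L 2557028002651526018434596928))) (N (N (L 2479657930763040657909219328)
 (L 79940170766558421701431296))
 (N (L 2556991386857592206085325824)
 (L 2556990224870332766066049088))))))) (N (N (N (N (N (N (N (L 1348480203340652061458944)
 (L 2557019444438636115331121216))
 (L 2557029018355105365934474240))
 (N (L 2554606018484508874296524816)
 (L 78720628411132004351938560))) (N (N (N (L 2554610722692478046249944064)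
 (L 2554497848236435720930099264))
 (L 77435983674565182314582016))
 (N (L 2554529567399350865433481216)
 (L 2554611184032216949760983104)))) (N (N (N (N (L 2557023280269280537284444416)
 (L 2557029032052803645390979392))
 (L 2556953617149092489697689608))
 (N (L 2555782312380900480770901008)
 (L 2557018549832347139686072320))) (N (N (L 2556991372009215438564361216)
 (L 2556906402338340673528270856))
 (N (L 2557028003707620126825124864)
 (L 79930411009050814288232512))))) (N (N (N (N (N (L 2557026969185749715101417728)
 (L 2554560410290139917301597248))
 (L 2479576470954521076978417920))
 (N (L 2479657178778996477347823632)
 (L 2557026813971440366038093824))) (N (N (L 79940178837008945640374272)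
 (L 81149101125801475265531920))
 (N (L 2557013670668539647796188176)
 (L 81149090332924963948331072)))) (N (N (N (N (L 2479657930483817481012051968)
 (L 2554611332252435815382188096))
 (L 2557013687813743420614378752))
 (N (L 2554609999961565245262336000)
 (L 2557027855079825228571869248))) (N (N (L 2556948312629307387628766208)
 (L 2492765249517678659440640))
 (N (L 2554573535362469339727135744)
 (L 2554600707430000992010108992)))))) (N (N (N (N (N (N (L 2556942995344069141782135296)
 (L 2557029184319507033907265600))
 (L 81139490288822745772065792))
 (N (L 2556981807223794432454427904)
 (L 2557029170401132394171142144))) (N (N (N (L 81138977317565914605945856)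
 (L 2557029027445621226592010304))
 (L 2554611332524903588610248704))
 (N (L 2478397931306650088983826944)
 (L 2557028519162620665328042048)))) (N (N (N (N (L 2556905958607676579390685200)
 (L 2553335113210348918951380032))
 (L 2556948608999939865818693632))
 (N (L 2478438595937988673705935136)
 (L 2554607789831307116620808256))) (N (N (L 81058858059518611606732824)
 (L 2554611332732069171335073792))
 (N (L 81067045468533465668390928)
 (L 78701586701015122586992704))))) (N (N (N (N (N (L 1268790271194026746331136)
 (L 2554610659230003901383065664))
 (L 2556953626440018520963026944))
 (N (L 81149104654371774735056896)
 (L 2557013831708255127605350416))) (N (N (L 2476031005595144987980334080)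
 (L 2554606158055564925999271936))
 (N (L 81147925217924370319544320)
 (L 3701694825134397082042432)))) (N (N (N (N (L 2555743588127713139846284304)
 (L 2556990077147770180484464960))
 (L 2557029035648927935036933120))
 (N (L 2553401203266907607118123008)
 (L 2477215996766566982826868800))) (N (N (L 2479604845501167360760874008)
 (L 2555810514063630471673221120))
 (N (L 2479653042083127149356908800)
 (L 2557027856216984134484230208))))))))

def tplTree7 : TplTree :=
 (N (N (N (N (N (N (N (N (L 81095502593182233455231240)
 (L 78707642268095678314446912))
 (L 81062903802941665150505472))
 (N (L 77522308751035613315334144)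
 (L 2555815536194208138709176320))) (N (N (N (L 81139438269994975230951680)
 (L 2556990224865837958236733504))
 (L 81149105732983885504970752))
 (N (L 2554610152147203853367119872)
 (L 2477240060704088923740045376)))) (N (N (N (N (L 3776072088232394710384640)
 (L 2554516737706862277922144320))
 (L 2556953617221150083735617552))
 (N (L 2557024442414157180990129152)
 (L 2557015017280857028593455104))) (N (N (L 2557029183150822930675663872)
 (L 2555816393449893609189953544))
 (N (L 2556947197677651247732117504)
 (L 78709845516853855672860736))))) (N (N (N (N (N (L 81019963241502587438301712)
 (L 2556926753731258253658558536))
 (L 2556952427397150130210866688))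
 (N (L 81068293855090890279813136)
 (L 78731254168064020986269696))) (N (N (L 79930729415795994005603328)
 (L 81149087000261235434328064))
 (N (L 2479656456185443473583837184)
 (L 81130210597020476241346624)))) (N (N (N (N (L 2479648485748599941907939840)
 (L 2557027856230495195492253760))
 (L 79901188096824453676926464))
 (N (L 2475901861221159041384076288)
 (L 81147850296041248489734208))) (N (N (L 2479657926160361838736572416)
 (L 77522180774496802262028288))
 (N (L 2556980780123856223665656832)
 (L 77503710769331292219114592)))))) (N (N (N (N (N (N (L 2479618380950510820160439296)
 (L 81144079001979199035080768))
 (L 2555767998918967582180246016))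
 (N (L 2479652613200831039270092800)
 (L 2476013662120381197679431680))) (N (N (N (L 2555729333406230455664247808)
 (L 78728597701809422343897152))
 (L 2554611185095066186876522496))
 (N (L 2557022691126391691766992896)
 (L 81148883313709088736542784)))) (N (N (N (N (L 2554605280767868313241125120)
 (L 2553327724055360825758860864))
 (L 81073547936811965577428992))
 (N (L 78645954984567107080945696)
 (L 2477229153906777560419958848))) (N (N (L 2556953473096954808625004560)
 (L 2554602768759075357638594560))
 (N (L 81034588129601523057692672)
 (L 2554611322380545432054136896))))) (N (N (N (N (N (L 2556947708570496567678927104)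
 (L 2554580037634841543653277760))
 (L 2555744682250221011744064512))
 (N (L 81149104654371774729028608)
 (L 2554530904864866198999879680))) (N (N (L 2555820252796083476742800384)
 (L 2557029179694310216666451968))
 (N (L 2557027699417407703910256640)
 (L 2557019438752850381801783360)))) (N (N (N (N (L 2557019424539481166097416200)
 (L 2479657927256988352216891456))
 (L 2557014620590291042336526344))
 (N (L 78725175603351963680657408)
 (L 2557023280287294948603068480))) (N (N (L 3777704622831118330118144)
 (L 79940179989930458556141568))
 (N (L 2556983703932800702722868224)
 (L 2479656308613742687957303360))))))) (N (N (N (N (N (N (N (L 2554600705903280443395211264)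
 (L 2553402396484369605122850880))
 (L 2557029156705685918756111360))
 (N (L 2554606609221671996350267408)
 (L 78731254026200632724099072))) (N (N (N (L 2554611313141410792281998336)
 (L 2554611185032015796322205760))
 (L 77437164266185899591667712))
 (N (L 2554534594285729738989506560)
 (L 2554611036458264360084570176)))) (N (N (N (N (L 79852948717157397997880320)
 (L 2557029184175391858711594048))
 (L 2556953626372464526552465408))
 (N (L 2557029017206687460958929920)
 (L 2557018554444033158113460224))) (N (N (L 2557029173999508487858816000)
 (L 2557029183875902479263600648))
 (N (L 2556990224784764368918156288)
 (L 81139650713796872488616000))))) (N (N (N (N (N (L 1277792214747998302044416)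
 (L 1226445903029015279846400))
 (L 2479581193469622734326857728))
 (N (L 2557028731129031931130282008)
 (L 2531060978445075701895168))) (N (N (L 2555782478475906538008478720)
 (L 2557029179696562025063780352))
 (N (L 81024996115417169884353536)
 (L 79876394609939876212899904)))) (N (N (N (N (L 2556986510864310051499147520)
 (L 2554526328646946641200349248))
 (L 2557018559051215572618707968))
 (N (L 2553395738205054513485992960)
 (L 81072366219291354126615616))) (N (N (L 2556953625291600615979615232)
 (L 79932432357419492357246976))
 (N (L 2479534098932011345639638016)
 (L 78729767707719490498216000)))))) (N (N (N (N (N (N (L 2557018539372737000823326208)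
 (L 2555820244234740859914424384))
 (L 2557019721054228828050949120))
 (N (L 81148933727003317325005056)
 (L 2557028884476599251673026568))) (N (N (N (L 2555781592955629806285227008)
 (L 2557029175021825616081059904))
 (L 2554611332660011577305534464))
 (N (L 2478400292489891523806171648)
 (L 2557028666736573255012843584)))) (N (N (N (N (L 2521374915589704406532624)
 (L 2554572368621669551104361536))
 (L 2556948904141089645728366608))
 (N (L 2557028883030943762709741856)
 (L 2554609855576161471004934208))) (N (N (L 81144156164403414763044880)
 (L 2557028584705749054825500672))
 (N (L 2556947275999752367458226192)
 (L 2554600555100246920969355328))))) (N (N (N (N (N (L 3771940015308083957088256)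
 (L 2554609404914457284042571840))
 (L 2556953036148711761884742656))
 (N (L 81149086209879500839190528)
 (L 2557015012669171010166067216))) (N (N (L 2475987743352843521958904832)
 (L 2557024157570487949050531840))
 (N (L 2555818782821165111590261760)
 (L 3775481803681035303518272)))) (N (N (N (N (L 81068289470836927878922256)
 (L 2555747864243777011898716736))
 (L 2556985345472338076456997888))
 (N (L 2554610147537769634751844352)
 (L 2477235338337606054061293632))) (N (N (L 2479614290234133100051301392)
 (L 2563896173889088059936768))
 (N (L 2557029018355105365928182016)
 (L 2557028003790936724159594560))))))))

def tplTree8 : TplTree :=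
 (N (N (N (N (N (N (N (N (L 81095511816554270310007040)
 (L 81149105748746484142571584))
 (L 81147749611315891487916544))
 (N (L 1284442338044168800043008)
 (L 2555820184483232528967143424))) (N (N (N (L 81144290054168536808424448)
 (L 2553352526862444832036487744))
 (L 81149105796034280539815936))
 (N (L 2553396485444556761489739776)
 (L 2477240074539146978971877440)))) (N (N (N (N (L 2557017958239500084137164808)
 (L 2554535774375199102043443264))
 (L 2556953626444522120590393344))
 (N (L 2477187809846636579215638792)
 (L 2557024462013822759293947904))) (N (N (L 2553326847889051723797628160)
 (L 2555819944605753785236590600))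
 (N (L 2557020477514851046809161728)
 (L 78711911336017329028857920))))) (N (N (N (N (N (L 81020110815455177114714624)
 (L 2557009990196320037658689608))
 (L 2477153738786893635359359488))
 (N (L 145674086568872380531216)
 (L 2554593549996481517568757776))) (N (N (L 2479648476739148887353197600)
 (L 2557029165861503961193779200))
 (N (L 2479656751333348652936597504)
 (L 81111025911126228296269888)))) (N (N (N (N (L 2557029182936901948379561984)
 (L 81147925233687235370418240))
 (L 2556990210933943706359431680))
 (N (L 2554609543406910016856527872)
 (L 2557027928864549723596391488))) (N (N (L 81101405551285820515942408)
 (L 77512219534948799185227776))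
 (N (L 2557018559055719180827365376)
 (L 77506076564258745468601440)))))) (N (N (N (N (N (N (L 2554567649686929322704897280)
 (L 2557029184310499834686079040))
 (L 2555815222588299878259229184))
 (N (L 2554526328689722041638846472)
 (L 2554601588027843051778576384))) (N (N (N (L 2478368411127583987047072768)
 (L 78712341510846265483100224))
 (L 2554608971485777341863497728))
 (N (L 2555818487673259932237435904)
 (L 78688677950086868134527040)))) (N (N (N (N (L 2554519678494368281403850760)
 (L 2555745575694590084108011072))
 (L 81073400371866575155757056))
 (N (L 2556938941755384333311410208)
 (L 2477238308258898325996306496))) (N (N (L 2554600978208928308434042888)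
 (L 2553401521396681410198704128))
 (N (L 2556952445920455406167265280)
 (L 2554611331603917468908650560))))) (N (N (N (N (N (L 77435235507321960810152192)
 (L 77503779935614369644167232))
 (L 2478364003220441498923368448))
 (N (L 2557019738492166585236849664)
 (L 2554606462800649707361210368))) (N (N (L 2555781731382771561361572864)
 (L 2557028805715397159820464160))
 (N (L 81147915994552333464834048)
 (L 2557028883485816121091686464)))) (N (N (N (N (L 2557019738206188008902754312)
 (L 2557029179568209431322198080))
 (L 2557019739570778695991840768))
 (N (L 2554527353429774049966575616)
 (L 2557018557920812078957854784))) (N (N (L 3777252393874535921811456)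
 (L 2555815439051564176331771920))
 (N (L 2556986664635224524515968000)
 (L 2557027856225991333737676864))))))) (N (N (N (N (N (N (N (L 2479646710251734651468316672)
 (L 2476030539898173719912906816))
 (L 2557029165929057955602498560))
 (N (L 2554611322364782829140967424)
 (L 2554568457747544263465963520))) (N (N (N (L 2557029012450886254451754240)
 (L 2554603358924281331512279104))
 (L 78731097294178200790831104))
 (N (L 2554605411322717911076065280)
 (L 78728891849915755004952640)))) (N (N (N (N (L 79852957940529434852590592)
 (L 2557024461880966583104307520))
 (L 81072588715127340523324416))
 (N (L 2556948455652372553853304848)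
 (L 2557018559055719172245880832))) (N (N (L 79864616282784019154994176)
 (L 2557029184161881055601628160))
 (N (L 2557028003714375526266180608)
 (L 81149076927960669155754048))))) (N (N (N (N (N (L 3695791421174446886813952)
 (L 1302003766754929594876928))
 (L 2554533681167394490747731968))
 (N (L 2557029026430059497813704720)
 (L 2479610108450476093789507584))) (N (N (L 2555819667111959136464536576)
 (L 2557029175082624206822708224))
 (N (L 2555766384628451232374068224)
 (L 81085320429554505119170624)))) (N (N (N (N (L 2479652465635885644557385984)
 (L 2554601887951824436278132800))
 (L 2557028003784181311909134336))
 (N (L 2554602892981863879401558016)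
 (L 81147924080765468636349504))) (N (N (L 2555744699541791781029151744)
 (L 79939589694120091394838528))
 (N (L 2555772864114869629889021184)
 (L 78715814259037204018905152)))))) (N (N (N (N (N (N (L 2478442926662440747954095616)
 (L 2555815236229703424109184064))
 (L 2557019721200595815939441664))
 (N (L 2557029178606690906658832640)
 (L 2557029179624504431025852416))) (N (N (N (L 2554606590554251541167997952)
 (L 2557029179633511634508447808))
 (L 2554601887936061833354481664))
 (N (L 2478447811388193792531173376)
 (L 2557019517151512695066853456)))) (N (N (N (N (L 79892627370925971319292432)
 (L 2554572373233355569531716672))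
 (L 2556948904150096844983107584))
 (N (L 81148799990360582748373024)
 (L 78710887532714043182678088))) (N (N (L 81073016449005549663551504)
 (L 2557029175145674601605959680))
 (N (L 2556947723558476136149159952)
 (L 2554605129811712407629234240))))) (N (N (N (N (N (L 2555612358569094398870528)
 (L 2477239342211063376210116672))
 (L 2556948904078039250945179664))
 (N (L 81149104647616375560339456)
 (L 2479653204658570106123653120))) (N (N (L 2475987743357347121586013184)
 (L 2556948904073535651313635328))
 (N (L 2557027708568722146727040000)
 (L 3777842995929669112430656)))) (N (N (N (N (L 2555739460666474847520424976)
 (L 2555752586610259606666023488))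
 (L 2557029036657734251567924224))
 (N (L 2475939640155273798493687808)
 (L 2477216384154947930166460480))) (N (N (L 2479619109599144744002257920)
 (L 2555816933535071722341994496))
 (N (L 2557024295993126095910338816)
 (L 2557028003799943923414073408))))))))

def tplTree9 : TplTree :=
 (N (N (N (N (N (N (N (N (L 3646331237245613599097600)
 (L 81148810458977916527575104))
 (L 81149087288491611582104064))
 (N (L 77479664053574051404448000)
 (L 2555817887859091752500596768))) (N (N (N (L 81149030869647279976873984)
 (L 2475969674645426133474017600))
 (L 81139661072075740504129536))
 (N (L 2477231225848584722824630272)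
 (L 2476013499292745466329989184)))) (N (N (N (N (L 2555814197503722494009540864)
 (L 2554535774746746071301505088))
 (L 2556953626363457327297728512))
 (N (L 2554559062301972846396571912)
 (L 2555809189359073469755621888))) (N (N (L 2555820257403265895538885632)
 (L 2478439561007597432200040448))
 (N (L 2557022838700344281443356672)
 (L 81148947877313621461565504))))) (N (N (N (N (N (L 81020115427141195542036992)
 (L 2557010285632455593163227200))
 (L 2554534446639719555149349376))
 (N (L 2476025752657329421910344208)
 (L 2477232475316015137518882832))) (N (N (L 77436849518615141927617568)
 (L 2557029179692058425436934144))
 (N (L 2479654214899283118434308096)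
 (L 3763089924126347941642304)))) (N (N (N (N (L 2556948381507360088637112336)
 (L 2557028003804447785034448960))
 (L 2557018549465303765760672256))
 (N (L 2476019938557507078768103424)
 (L 2557027781292848933733662800))) (N (N (L 81101553125238410190258184)
 (L 77515244580300505810538496))
 (N (L 2557028003788684911527858176)
 (L 2553386155135019295199741024)))))) (N (N (N (N (N (N (L 2556990223701648649954264064)
 (L 2479634319599410858600955968))
 (L 2557028870776649176624398848))
 (N (L 2557029182930146553229475840)
 (L 2554535179751429497214799872))) (N (N (N (L 2557023852118355618373567488)
 (L 78715606584547312205856832))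
 (L 2554610447225303238493933568))
 (N (L 81137890180141073069773824)
 (L 78731179248432420063543360)))) (N (N (N (N (L 2554600106600270825787752456)
 (L 2556989044204411438279705664))
 (L 81073547943567365018484736))
 (N (L 2556944171184392252321432608)
 (L 2477238898554708684634849344))) (N (N (L 2554611326976468847568355328)
 (L 2554611037584163991982772224))
 (N (L 2479642279786061634396508160)
 (L 2557010275330471183555494976))))) (N (N (N (N (N (L 2555818777056557580108955904)
 (L 78712724201972801945485376))
 (L 2555735255964008142256209920))
 (N (L 2555819957569365303907582976)
 (L 2554604249191360862215016448))) (N (N (L 2555820109833816905493775360)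
 (L 2557029110519019940255633408))
 (N (L 2557027994565312883263016960)
 (L 2557029169408097463776116800)))) (N (N (N (N (L 2557029173715781711338471424)
 (L 2557029179712324619398021184))
 (L 2557029036729791845605852160))
 (N (L 2554605272985648157003370496)
 (L 2557028002653777809658347584))) (N (N (L 3777852201287307633885184)
 (L 79933091612347628425056272))
 (N (L 2556991386992691398821807104)
 (L 2557027856228243133551345728))))))) (N (N (N (N (N (N (N (L 2557023127651296369248043264)
 (L 2478449006044564933711495232))
 (L 2557029164771632851374571520))
 (N (L 2553391854221922876105179136)
 (L 2554534889285016130513604608))) (N (N (N (L 2554610423081505636169286656)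
 (L 2477191872964946999256843328))
 (L 78731254098258226762027008))
 (N (L 2554610152140448454058184704)
 (L 2554611331603917739623710784)))) (N (N (N (N (L 2555742485860445341979247616)
 (L 2557029184247449452749520960))
 (L 79859289636813947839710208))
 (N (L 2557029035651179734856892416)
 (L 2557019739214994329724583936))) (N (N (L 2556953625359154610390172672)
 (L 2557029165717388781705761792))
 (N (L 2557028003572512138004009984)
 (L 81149095446762336901136448))))) (N (N (N (N (N (L 79933828108512407134208256)
 (L 2477182082355529877900510272))
 (L 2553325364094837893615648768))
 (N (L 81138668258041494895591432)
 (L 2556991396222818835117445120))) (N (N (L 2555820257405517695356503040)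
 (L 2557029175075868807381651472))
 (N (L 2555771107066991421179302912)
 (L 81149072390584044209569856)))) (N (N (N (N (L 2556977149285807832243896576)
 (L 2554610742388971020904104000))
 (L 2554534740630199630267958272))
 (N (L 78651988004376132772450304)
 (L 81147924083017268450033728))) (N (N (L 2555696862524974433548109056)
 (L 2555819373116984257799065600))
 (N (L 2478330765932363773047473408)
 (L 78730073592205906624397376)))))) (N (N (N (N (N (N (L 2555819076732832184648599040)
 (L 2555801272046691425792296000))
 (L 2557029165933561555229868032))
 (N (L 2553322125522568854152414464)
 (L 2557029175012818412598464512))) (N (N (N (L 2557029183150822930679596032)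
 (L 2557024461878714783290622016))
 (L 2477240080213691305463713792))
 (N (L 2557027989953626864835694592)
 (L 2557028961884478434357280832)))) (N (N (N (N (L 2557019715066693123475243024)
 (L 81110127855080212954874944))
 (L 2556944181774606776083152904))
 (N (L 2557028888074975345364697120)
 (L 2554595605752343106712256576))) (N (N (L 81149100044937556119257104)
 (L 2557029170536240382992191504))
 (N (L 81069849364625195389947904)
 (L 1330185509797561851805760))))) (N (N (N (N (N (L 2555612367576293385176064)
 (L 2554610742314661626919272512))
 (L 2556953607997778046880842752))
 (N (L 79934570950249344271908864)
 (L 2557023867106326390750908416))) (N (N (L 2475993079089329441142211584)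
 (L 2557024388154788870426218496))
 (N (L 2557027634844796246680408072)
 (L 81129615689524373851471944)))) (N (N (N (N (L 2556948381651475276712903696)
 (L 2555762335788811956015665216))
 (L 79934718596259527981548544))
 (N (L 2477238881233864513540083712)
 (L 2476004414546008741611847744))) (N (N (L 2479657635624142677810873344)
 (L 2478443974600534449782329344))
 (N (L 3772660586744863602786304)
 (L 2557028003802195714637824064))))))))

def tplTree10 : TplTree :=
 (N (N (N (N (N (N (N (N (L 3648697032173058267546368)
 (L 81143488717427839464898624))
 (L 2557029165931309755418279936))
 (N (L 78731243501288303565733888)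
 (L 79826815233743566835552256))) (N (N (N (L 2553391844566205275022819336)
 (L 2475969748432402428312158528))
 (L 81149105805041479526121472))
 (N (L 2554605125339637973288554496)
 (L 2476020582842460974721564736)))) (N (N (N (N (L 2555818624870918972005220352)
 (L 2554611323384848148956463168))
 (L 2556953607925720452842914816))
 (N (L 2556976913941202104743887112)
 (L 2555771854288478987213672960))) (N (N (L 2557029183078765336637735168)
 (L 2568927172054421505904640))
 (N (L 2557027708640779740764966912)
 (L 81148505155455577621528640))))) (N (N (N (N (N (L 81138479259979528098021888)
 (L 2555820244667086424141987904))
 (L 2556942410812866306110718464))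
 (N (L 2557024446942526606311227408)
 (L 2554608897768615637208338448))) (N (N (L 79854701157844400274932768)
 (L 2479619558013552442015486976))
 (N (L 2557027837763484657104474112)
 (L 81148509767141595915223104)))) (N (N (N (N (L 2557029109152177453355040768)
 (L 2554554069379499362693480512))
 (L 2557027985256372444906915328))
 (N (L 2477110333872816565852062728)
 (L 81147554859905418241523776))) (N (N (L 2557019410920595888634331144)
 (L 77522328350701191751077888))
 (N (L 81148497066990646860186624)
 (L 2554595671250444287375065184)))))) (N (N (N (N (N (N (L 2478432614648776767924666896)
 (L 1359705200231887455912000))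
 (L 2557029165924554355977224192))
 (N (L 2557029164555460069267080192)
 (L 2554611327985275164087095296))) (N (N (N (L 2557024442414157180986196992)
 (L 78731254035207836198797376))
 (L 78730064139150284546183168))
 (N (L 2557017968759908822121714688)
 (L 81148735739756499060129856)))) (N (N (N (N (L 2554610150996534148714463232)
 (L 2556892226468140577724580928))
 (L 81073252797913985479344128))
 (N (L 2478326061938306778606339104)
 (L 2554529252741852104606629952))) (N (N (L 77521501273636824426741784)
 (L 2554573553800206214181752832))
 (N (L 2557023281417698450845224960)
 (L 2557028869648497482783523904))))) (N (N (N (N (N (L 2477200220314807528293991680)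
 (L 78712797988949096515256384))
 (L 2478373448241637614365442048))
 (N (L 2557028888077227145174451200)
 (L 2554568831442739339875913728))) (N (N (L 79934331207878588965585936)
 (L 2557029175082624198234886144))
 (N (L 79938999398309741144839168)
 (L 2557029178631469500630827072)))) (N (N (N (N (L 2557029182939153748193181696)
 (L 2557029174956523421484188736))
 (L 2557029184303744435282264064))
 (N (L 2554610004575503063503343616)
 (L 1359188707160422325682240))) (N (N (L 2479657340476237498458047488)
 (L 2555702194786933248796660752))
 (N (L 2556981942268741654870754304)
 (L 2557027994576571886559313984))))))) (N (N (N (N (N (N (N (L 2554482637578635260379595008)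
 (L 79935162405736606782193728))
 (L 2479657908706661482851766272))
 (N (L 2554601739281236537297092608)
 (L 2554611037449056003161657344))) (N (N (N (L 2557029160168954032204022784)
 (L 2554563125420283266433844288))
 (L 2554601652296461534190702592))
 (N (L 2554610152149455653178707968)
 (L 2554611331606169264559489088)))) (N (N (N (N (L 2554609998666780352534806784)
 (L 2557019739516735513272778816))
 (L 79859309238731325969531904))
 (N (L 2556991256721568577508868096)
 (L 2477230620276564428090049024))) (N (N (L 2557029183213873325458850816)
 (L 2557019739431167116124886016))
 (N (L 2556952445852901411756446720)
 (L 81149095451265936260071488))))) (N (N (N (N (N (L 81143201554404799544557824)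
 (L 2554572225510783921561814080))
 (L 2556952436701586960492527616))
 (N (L 2557018770040354515571441672)
 (L 2557029170542995782433312768))) (N (N (L 77517503288636019323192320)
 (L 2557024452718393136991195136))
 (N (L 2556977602516824136144131088)
 (L 3777543162029081641877568)))) (N (N (N (N (L 2557024460572670878547968256)
 (L 2554611258897805084645720128))
 (L 2557028592708645584214443008))
 (N (L 1356293615427763146346496)
 (L 2557018248865791250285003328))) (N (N (L 81073394319028675965878528)
 (L 2553401811865346576713322496))
 (N (L 2478330775155735801320703232)
 (L 2554610152090908862384717888)))))) (N (N (N (N (N (N (L 1348922927450220904333824)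
 (L 2555820253746343272920907840))
 (L 2479571748376369024846807040))
 (N (L 2479653199029070563333374208)
 (L 2557019739500972910349128704))) (N (N (N (L 2479619542881457685741437952)
 (L 2557029184245197644345901120))
 (L 2477239489622886375207014400))
 (N (L 2479656377777773961071890432)
 (L 2557019369575308305576755296)))) (N (N (N (N (L 1246137527608123026636816)
 (L 81014719984183499892458560))
 (L 2556944181783613975337893888))
 (N (L 2557028297783668586286416896)
 (L 2554609855866643646968234048))) (N (N (L 2556981659719647637008285712)
 (L 2557029027501916217705238544))
 (N (L 2556952445915951806539894784)
 (L 1349074975729040432595008))))) (N (N (N (N (N (L 2557982774189756481012736)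
 (L 78650226716367666762760256))
 (L 2556953625289348816169862144))
 (N (L 81144382290140705169866752)
 (L 81068221448467889774465040))) (N (N (L 2476021689989387764656768000)
 (L 2557024452709385929154908160))
 (N (L 79928585769927643498549512)
 (L 79914104082786055417233472)))) (N (N (N (N (L 2556953108854824146154029072)
 (L 2555781299041719729434660928))
 (L 81148958231088889845531648))
 (N (L 2476020529137035418056003584)
 (L 2476005004841810304224477248))) (N (N (L 2479657930772047857163698176)
 (L 2555817523758824487009718272))
 (N (L 2557028723211703786336944128)
 (L 2557028446451995885363527744))))))))

def tplTree11 : TplTree :=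
 (N (N (N (N (N (N (N (N (L 3648706255545095122321664)
 (L 3772803499471838852415552))
 (L 2555808434046869164559434784))
 (N (L 78731253017394316199329792)
 (L 2555820249335067163102285824))) (N (N (N (L 140656578936222957764616)
 (L 2553341016166200431347761216))
 (L 2554610871270733352831815680))
 (N (L 2476024656165928146138107904)
 (L 2476021173138271333360107584)))) (N (N (N (N (L 2557027993412391370209099776)
 (L 2554601887877506246334496832))
 (L 81026019761094464469205024))
 (N (L 2557014702389171074539454472)
 (L 2555733987743588879203111424))) (N (N (L 2557029183220628724899906560)
 (L 2555820258200403038298968064))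
 (N (L 2555819077680839914791440384)
 (L 81148800303361031785152576))))) (N (N (N (N (N (L 2553278134582085355766547968)
 (L 79934562888806011035451456))
 (L 81067643762736483419816448))
 (N (L 81021143833123313441309200)
 (L 2554604013984114923350855696))) (N (N (L 2555810499008096908779455520)
 (L 2557028589400751666358129664))
 (N (L 2557027856142674736403452928)
 (L 81149099774721582697021504)))) (N (N (N (N (L 2553321668544566464820085024)
 (L 2554554664286995739825995840))
 (L 2555819068657878052773299712))
 (N (L 2477148113957601027612234760)
 (L 2557027633718896344057266240))) (N (N (L 81063626686976857764790280)
 (L 2553347352458408364208361472))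
 (N (L 2557028280489846017171915776)
 (L 2554526542149085654868361312)))))) (N (N (N (N (N (N (L 2478437337015259637569880576)
 (L 2557029184175391845864964160))
 (L 2557014113318348610291368960))
 (N (L 2557029183146319331048293376)
 (L 2554601887864004239316553728))) (N (N (N (L 2478373280989197656930927616)
 (L 2554611314159224312289067072))
 (L 2554610152077398059274801152))
 (N (L 2556951855629148647088722944)
 (L 81144308521178808767742016)))) (N (N (N (N (L 2479580749594843456530023424)
 (L 2556991405387652872833877056))
 (L 81073547945819164830072832))
 (N (L 2556944028440550263016652832)
 (L 2477160223179975314395906112))) (N (N (L 81148278732480720406577176)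
 (L 2554606453417391087642824704))
 (N (L 2557028003775174121235943424)
 (L 2557029164796402662136348736))))) (N (N (N (N (N (L 2477200229538179565148701952)
 (L 2477146066240656260834869312))
 (L 2555744700694713285639930880))
 (N (L 2557029183225132324527014912)
 (L 2554606605762907482517737472))) (N (N (L 79939791455383406061290496)
 (L 2557029036732043645413249024))
 (N (L 81072367354198456004513792)
 (L 2557029178633712504351490112)))) (N (N (N (N (L 2476021030367407746199388160)
 (L 2557029009079941946174095424))
 (L 2557029184159629247210590208))
 (N (L 1358820677502477386649600)
 (L 1360000580072447651348544))) (N (N (L 2479652322885288256063668224)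
 (L 2555812580092211327685104656))
 (N (L 2555782461179840965172790272)
 (L 2557027994578823686372982848))))))) (N (N (N (N (N (N (N (L 2556900498450243754838523904)
 (L 2555744036265149460780683328))
 (L 2557029165780439167901372416))
 (N (L 77507246754815848737145864)
 (L 2554608971413719747825569792))) (N (N (N (L 2557028860404859234796454912)
 (L 2554610424029513361950016576))
 (L 2554563947151574871867199488))
 (N (L 2557027395046130487702590464)
 (L 2525599161435788769558848)))) (N (N (N (N (L 2557017819879912332060786696)
 (L 2557029184249701243973271616))
 (L 77436429929496859019052064))
 (N (L 81139217129742472191148048)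
 (L 2557019730135737476650697216))) (N (N (L 2554611331583651266364179456)
 (L 2479657931708796588234118144))
 (N (L 2557018558983661586789438464)
 (L 2553326391365921692721348928))))) (N (N (N (N (N (L 2557027997864199601730618624)
 (L 2554538568203494139662189632))
 (L 2556951708055196048965238784))
 (N (L 3729493904072103971258376)
 (L 2557024452788198931215486976))) (N (N (L 79897373079565709892142592)
 (L 2555819935663856724958254112))
 (N (L 2557015460002723593715717120)
 (L 81149090839579917732544576)))) (N (N (N (N (L 2521245788381188439671312)
 (L 2554611332684781379475537984))
 (L 2557029183150822930675418112))
 (N (L 2554609986126507189980123136)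
 (L 2557018253472973669084971584))) (N (N (L 2553326824832873431474373888)
 (L 2555742920442046784527994880))
 (N (L 2555768145195892275004310784)
 (L 2554610152018851268346789952)))))) (N (N (N (N (N (N (L 73303181608467768296960)
 (L 2557019444296772731296809024))
 (L 2556938278388661228717474048))
 (N (L 2557024460851894055441006848)
 (L 2479648487047888442981617672))) (N (N (N (L 2556991404223463573145256960)
 (L 2557029184389312828126789696))
 (L 2554611332666766976872419328))
 (N (L 81147625314217984597757952)
 (L 2557028814310525844680867904)))) (N (N (N (N (L 1246146750980159881347088)
 (L 2556913558898170611932070976))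
 (L 2478373005513015649820999680))
 (N (L 2475993060786700555508515840)
 (L 2554534593150822911997640768))) (N (N (L 2475945103575564553084207128)
 (L 2555820249328311772244873224))
 (N (L 2556935825192376086252491776)
 (L 78720329027591375516368960))))) (N (N (N (N (N (L 2479647305375403806571102208)
 (L 78717003857857176171200576))
 (L 2555734664438706289202168832))
 (N (L 81148957082670984872329216)
 (L 81144378831376199658246160))) (N (N (L 2554611331444039677919626240)
 (L 2555738493295526688273485824))
 (N (L 2555818782523927536183808264)
 (L 81125483618851863180345408)))) (N (N (N (N (L 81144151696832592867229712)
 (L 2556968439261086907524744256))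
 (L 2557029036799597639830094848))
 (N (L 2477233872951855700651560960)
 (L 2477232986296671863069212736))) (N (N (L 2553278881609926667625627904)
 (L 2555819958801099810574241792))
 (N (L 79928208050774813058531328)
 (L 79930578398841489264214080))))))))

def tplTree12 : TplTree :=
 (N (N (N (N (N (N (N (N (L 1268624241490163973505032)
 (L 81144079013238198103441472))
 (L 2555820239967579938299839488))
 (N (L 77522327195527887211200512)
 (L 79902401055815692997103616))) (N (N (N (L 140661190622241385086984)
 (L 2475993375255048136207372352))
 (L 2557028741653944260297228288))
 (N (L 2554604834731361218459340800)
 (L 2477230412840765591748870208)))) (N (N (N (N (L 2555742485934754735830860800)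
 (L 2554611332610471985623875648))
 (L 3697277820720661542207488))
 (N (L 2557015016127935515677687808)
 (L 2555809628622166724846879232))) (N (N (L 2554529870473591388832596224)
 (L 2555820258344518226240607232))
 (N (L 2555819077897012696905159680)
 (L 81146734186959983022702672))))) (N (N (N (N (N (L 2554609855765312376121067008)
 (L 2557028584802576438227632192))
 (L 2556952445852901403175158272))
 (N (L 81021143835375113254993936)
 (L 2554608823981639342371180544))) (N (N (L 2557019738422360791016539136)
 (L 2557025923839477615887389696))
 (N (L 2556945214799030311836455952)
 (L 81149081616208155722121280)))) (N (N (N (N (L 2553326390911049334465298464)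
 (L 2554608971501539944787148864))
 (L 2557013827387051272267121152))
 (N (L 2554519513986889884470350856)
 (L 2557027928866801523410075712))) (N (N (L 81063774260929447439106056)
 (L 2553362266806366145524076544))
 (N (L 2557028575565693602620507136)
 (L 2554528754317231415349035104)))))) (N (N (N (N (N (N (L 2556900041812263137234453008)
 (L 2557021109113173588165787712))
 (L 2557019426052699432679638016))
 (N (L 2557015006463210715068236040)
 (L 2476013878943942253447548928))) (N (N (N (L 2557029017127874467476030464)
 (L 2554600333732562636863275072))
 (L 2553397310931850185490894848))
 (N (L 2557027404269502524557430784)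
 (L 81139586154695939122528320)))) (N (N (N (N (L 2553316222571220941414859776)
 (L 2557029156649399719431259200))
 (L 2554492826096842054312395008))
 (N (L 2556944180630692470731046944)
 (L 2554533984403764605144531008))) (N (N (L 81100898549550574320222232)
 (L 2554611175934744544804933632))
 (N (L 2557013762600518841578622976)
 (L 2557029109456170441007693888))))) (N (N (N (N (N (L 2556989628794152272821224704)
 (L 2477221624104373379065266240))
 (L 2555744686573676654019805200))
 (N (L 81073030284063596357877776)
 (L 2554606527292196371306729472))) (N (N (L 2555819962259864315817362432)
 (L 2556991405374133277932130304))
 (N (L 81147925213420770692239360)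
 (L 3758953514235592104214592)))) (N (N (N (N (L 2476021039879010159205811200)
 (L 2557029175100638609560043584))
 (L 2478439556537774793339962368))
 (N (L 77521147470850372934045696)
 (L 2477218514690838049073397824))) (N (N (L 2479653208405564987786919936)
 (L 2555815531582522120281788432))
 (N (L 2556991387001698598068159488)
 (L 81142907642737730580382784))))))) (N (N (N (N (N (N (N (L 2556976047092849432120852480)
 (L 2555820258499892404799668288))
 (L 2556942677137733870294417920))
 (N (L 77507255978187885591921664)
 (L 2554601657279694521859379200))) (N (N (N (L 2557029155557268013776634880)
 (L 1348412338597867148641344))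
 (L 2554601735739155430107058176))
 (N (L 2557027980730254827980854272)
 (L 2525746879503566522351680)))) (N (N (N (N (L 2557027855061810817387462656)
 (L 2557027999188266688195068992))
 (L 79854281568726117234246688))
 (N (L 2555772295873186646429007888)
 (L 81133462610282607554920960))) (N (N (L 2557029183222880524713590784)
 (L 2557029184164132855415312384))
 (N (L 2557028003716627326079864832)
 (L 2557028731300177512987885888))))) (N (N (N (N (N (L 2557028002491648218853802240)
 (L 2554572815808846080089538624))
 (L 2556947723553972527940501760))
 (N (L 3729493908575703330193416)
 (L 2557029175154681792270766080))) (N (N (L 79897668227470889244967936)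
 (L 2555820249265261377461687296))
 (N (L 2557018411481766591150953472)
 (L 81144377696469089203519552)))) (N (N (N (N (L 79892498243717455352431120)
 (L 2556957758386850842458783808))
 (L 2556991405371881478120558592))
 (N (L 2554531481314350707397431296)
 (L 2557018262772906899605029440))) (N (N (L 2556953620751972191590154496)
 (L 2555819668120765453117231104))
 (N (L 2555782313605888375504765952)
 (L 2554610152162966456422629440)))))) (N (N (N (N (N (N (L 2475953381752369017432327680)
 (L 2479639023521401454318846016))
 (L 2556952445636728625356341248))
 (N (L 2557029173995004888231445504)
 (L 2557019739503224710162812928))) (N (N (N (L 1345584208636263715062816)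
 (L 2557029184398320027381530624))
 (L 2554611332669018776551886848))
 (N (L 2557027704029093722337644544)
 (L 2557029109456179224220008512)))) (N (N (N (N (L 2556991108785076217829130256)
 (L 2556914370563917054398694464))
 (L 2556953478938123525341315072))
 (N (L 2557028869632734871282516992)
 (L 2554610077225320456791326784))) (N (N (L 2553316356030892024172380184)
 (L 2557029175147926401419579392))
 (N (L 2556943001191993266503947264)
 (L 2554610147551280437995274304))))) (N (N (N (N (N (L 2478447058600257070020445184)
 (L 78726531673228566314631232))
 (L 2556944176955755174813503488))
 (N (L 81139659923657835524653056)
 (L 2557024162254231570104193024))) (N (N (L 2478439555459162682584728576)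
 (L 2557022690766103713121652736))
 (N (L 81062543949568852443009032)
 (L 81127531205192244860551232)))) (N (N (N (N (L 2557028961857448040575533072)
 (L 2556989689910259820659770432))
 (L 2557029036801849439643779072))
 (N (L 2477238899694119386131730432)
 (L 2477234462108255353602900032))) (N (N (L 2554563517627524606930780160)
 (L 2555820253804889801851147264))
 (N (L 2557019573626643226399342592)
 (L 81148958177045694263590976))))))))

def tplTree13 : TplTree :=
 (N (N (N (N (N (N (N (N (L 78639876768884025192612104)
 (L 81144083624924216530829376))
 (L 2477239323816110694120834048))
 (N (L 2554526033841306233217220640)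
 (L 2555819963410534029189976064))) (N (N (N (L 79929774873351373453262856)
 (L 2553364627998614779540275264))
 (L 2557028889225645050159955968))
 (N (L 2554605129663093615564230656)
 (L 2477240005363856702812717120)))) (N (N (N (N (L 2557027412339953048224007168)
 (L 2557029179347533058170421568))
 (L 81073399937269211114508288))
 (N (L 2475912771319608935803274240)
 (L 2555734075356616030051963392))) (N (N (L 2557024460856397655068377344)
 (L 2555810813755667675026035712))
 (N (L 2555743520105344376619668480)
 (L 81146734268024776315371584))))) (N (N (N (N (N (L 2557028002563705812891730432)
 (L 2557029175098386796866175040))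
 (L 2555743520105344368038380544))
 (N (L 81106446551945930543726608)
 (L 2554608971555591932046544896))) (N (N (L 2477240079047250206162682880)
 (L 2557029179694310225250096128))
 (N (L 2557023032384401655952593920)
 (L 3735051152357486521483328)))) (N (N (N (N (L 2553312223816104325157028128)
 (L 2477192699767291789316259904))
 (L 2557028003712123717871206912))
 (N (L 2554519523210261921325126656)
 (L 2556950083606810469102518336))) (N (N (L 2557019724362122754366111752)
 (L 2553364627989607580346421248))
 (N (L 2557028575493636008582579200)
 (L 2554528754605461791500681312)))))) (N (N (N (N (N (N (L 2556900189386215726910865920)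
 (L 2557023562674250571022073920))
 (L 2557017360017354389706769408))
 (N (L 2477202276989403162185302272)
 (L 2554606601007115072111185920))) (N (N (N (L 2557028131762971923030737920)
 (L 2554611253052132768319307840))
 (L 2554530752674715195176456192))
 (N (L 2557027413492874561412141056)
 (L 2541980086346033614291008)))) (N (N (N (N (L 2556952444772037492606239744)
 (L 2557029184319515829995585600))
 (L 2479577651688005178394673152))
 (N (L 2557019738489914785695531008)
 (L 2554610127796240672534855744))) (N (N (L 79901712547756469005583376)
 (L 2554611254256845664413093888))
 (N (L 2557018559051215581200060416)
 (L 3775477198750429030187072))))) (N (N (N (N (N (L 1282510104652838340985088)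
 (L 2554598927103024822047752256))
 (L 2555739677192789532052816912))
 (N (L 79864611747659194382417920)
 (L 2554606601151230260182847488))) (N (N (L 2555820248184397458315412480)
 (L 2557029183873650670866272256))
 (N (L 81142607655714751684612096)
 (L 3682505106467565752614976)))) (N (N (N (N (L 2557029109433652430334067712)
 (L 2556913412125858481041379392))
 (L 2557029184229435041434829824))
 (N (L 78730073578695103382556672)
 (L 1336379524286062773944384))) (N (N (L 2477197573222786753580237056)
 (L 2555819663653194631221351424))
 (N (L 78731087645215999276617728)
 (L 81072292425559659855742016))))))) (N (N (N (N (N (N (N (L 2479656150368510772703985664)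
 (L 2556953626455781119650955328))
 (L 2555766660305043139332425216))
 (N (L 2554594424996340723935150112)
 (L 2554611185023008592838594560))) (N (N (N (L 2555744681097299507133285376)
 (L 78719664793934134329771072))
 (L 2554487808643252600297295872))
 (N (L 2557027985339689046594556928)
 (L 3734672699118195629948992)))) (N (N (N (N (L 2479646420001502858678895616)
 (L 2479656751344616439441261632))
 (L 81063512912539467223401472))
 (N (L 2556981516550215482900217872)
 (L 2557019444211204334152647168))) (N (N (L 2477239465629959360268731392)
 (L 2557015017206547634741842960))
 (N (L 2479656751042866476971266048)
 (L 2557018991261680607386665288))))) (N (N (N (N (N (L 2477115651072486423075783680)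
 (L 78683873566299113783312448))
 (L 2556943001191993257922659328))
 (N (L 2479610384289197875089375240)
 (L 2557029184378053829125476352))) (N (N (L 2555815525741353395004916736)
 (L 2557029174940760818560537600))
 (N (L 81147777643971780645228544)
 (L 81149100062951954553765952)))) (N (N (N (N (L 81148661574477835329863696)
 (L 2556990815096337321958113344))
 (L 3763362927832159517429768))
 (N (L 2554609405054068868129296384)
 (L 2557027707505872638895456320))) (N (N (L 2556952583118114445800522752)
 (L 2555819668264880641058869248))
 (N (L 2479527296695134173824025856)
 (L 2556980627879670824650671168)))))) (N (N (N (N (N (N (L 2557027559837344444235137536)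
 (L 2556896653544854879759499328))
 (L 81029842997422803348882432))
 (N (L 2557029183218376925086220288)
 (L 2479653186346934021239345168))) (N (N (L 2477225662779396813244875808)
 (L 2557027985269883243782737920))
 (N (L 2557027999167991702435926016)
 (L 2557029109458422227940671552)))) (N (N (N (N (L 2479581925205482990234238992)
 (L 2556990224728469648386819136))
 (L 2556953478654396748802293760))
 (N (L 2557028888079478944992067584)
 (L 2554605428648065956675846208))) (N (N (L 2557018848439016828568600600)
 (L 2555820258407568621023794176))
 (N (L 2556952445924959005794373632)
 (L 2554533781489579794280546368))))) (N (N (N (N (N (L 2478447824212193723004748800)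
 (L 2477240051260040509238820928))
 (L 2556944181711556381316743168))
 (N (L 77522018214816727267540992)
 (L 2557024457402136749456494592))) (N (N (L 2557019738350303196978611200)
 (L 2562867702604775934676992))
 (N (L 2557018263394403648249270280)
 (L 81045051126443277190955072)))) (N (N (N (N (L 79939514751970492282831872)
 (L 2556990206419093884527182912))
 (L 2554610150980771549884514560))
 (N (L 2554534580378614089669480448)
 (L 2477235356784350127770828864))) (N (N (L 2554534888280713413747867648)
 (L 2555820253949004989927002112))
 (N (L 3777391895124801847820544)
 (L 2557029036745554444249202752))))))))

def tplTree14 : TplTree :=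
 (N (N (N (N (N (N (N (N (L 78639885992256062047387904)
 (L 81149105750998283922702400))
 (L 2479657913334110100107035648))
 (N (L 78731100829503908282105856)
 (L 2555820258558439199952867328))) (N (N (N (L 2555820183620793200600416256)
 (L 2554573553818229408712884288))
 (L 2557024009910966966732980232))
 (N (L 78715906479246769323249664)
 (L 2477240069639239380469022784)))) (N (N (N (N (L 81147776058704703361712128)
 (L 2557027989823022479869739328))
 (L 81073547801703976756314112))
 (N (L 2475912771328616135057753088)
 (L 79929407089139603917046272))) (N (N (L 1348770813869206838509824)
 (L 2555820258488633414316462080))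
 (N (L 2555819077966818491129402368)
 (L 79850421528982173341712464))))) (N (N (N (N (N (L 2478447529201648332286723072)
 (L 2557029184321758833720426560))
 (L 2479575880658710713977864448))
 (N (L 2557024451637529217844903952)
 (L 2554526025694303303382405152))) (N (N (L 2479657930699990263125771264)
 (L 2555810661558770067870585856))
 (N (L 2557027856212480530627695616)
 (L 78712285157304124305834048)))) (N (N (N (N (L 2553316946182587194802241568)
 (L 2554611174725528049218027584))
 (L 2556990215545629724786296320))
 (N (L 2554604544267208447530635264)
 (L 81145562899775833761644608))) (N (N (L 2557029169392326069062991872)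
 (L 2553402259347517947831717888))
 (N (L 2555819649815884776125760512)
 (L 2554529344901263354113310816)))))) (N (N (N (N (N (N (L 2557018253168980681428369920)
 (L 78688369888109482190897216))
 (L 2477223384827180092113568768))
 (N (L 2557029183074261737010364672)
 (L 2554606610230487108961767424))) (N (N (N (L 2557029017206687460954997760)
 (L 2554611258818992091158839360))
 (L 2554611328057332758125023232))
 (N (L 2557027999172495302063296512)
 (L 2542570454213986359443520)))) (N (N (N (N (L 2557028002631259807302288384)
 (L 2478335669023796080857579584))
 (L 3697277971591249024253952))
 (N (L 2557019738485411186068160512)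
 (L 2554610132567804477733863488))) (N (N (L 81148435962150911165333520)
 (L 2553402402300768523733766144))
 (N (L 2557028003784181320490422272)
 (L 2557029169408088680563802176))))) (N (N (N (N (N (L 3695786958107216162652416)
 (L 78719863091929601950106688))
 (L 2555739826061527014598247440))
 (N (L 78655676409686752760168448)
 (L 2554606536587626002199416832))) (N (N (L 2555820257407769495170187264)
 (L 2557028889158091064326754304))
 (N (L 3771793594277011629559808)
 (L 3683095402277924458201152)))) (N (N (N (N (L 2479657681664441668687904768)
 (L 2479577568195771699378061376))
 (L 2557029179620000822821126400))
 (N (L 78729773598427523993833472)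
 (L 2477216458095046612570095680))) (N (N (L 2475945998530873707938971648)
 (L 2521302430153710189941792))
 (N (L 2557019278406680453025366016)
 (L 3776672557674324337624128))))))) (N (N (N (N (N (N (N (L 2554534592835570663145406464)
 (L 2455484609428301095112768))
 (L 2556975586124657768507130368))
 (N (L 2554596786323697346842001408)
 (L 2554610152005340465236873216))) (N (N (N (L 2557029164776136451004040192)
 (L 78730659053402065222533184))
 (L 2554573406154196030468460544))
 (N (L 2479656732886604579227308032)
 (L 3772451630981152783269952)))) (N (N (N (N (L 77506813486013972163593472)
 (L 2557028003727895112584283200))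
 (L 2492779372806109971612672))
 (N (L 2477150206595700281971834896)
 (L 2557019739359109513505472512))) (N (N (L 2557029178611194506290397184)
 (L 2557015017208799434555527184))
 (N (L 2557028003781929520676738048)
 (L 2479624624756796805508759880))))) (N (N (N (N (N (L 2477125100417138180793582592)
 (L 2477202144353890540717097024))
 (L 2556952150777053817994477568))
 (N (L 2557024156043767675382661128)
 (L 78688752583739617841844224))) (N (N (L 2553397683330008569230656512)
 (L 2557015003220618991942766616))
 (N (L 2556904465862558493957952528)
 (L 2557023423249570311654342736)))) (N (N (N (N (L 81148952173747391038488592)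
 (L 2557028446454247689577103424))
 (L 2557014989390064527706443784))
 (N (L 2554610004354826681762205696)
 (L 2479511652712245367000008256))) (N (N (L 2556953616140286173162767360)
 (L 79935457623447589179363328))
 (N (L 2479539706742209753334940928)
 (L 2557018554385486371488792640)))))) (N (N (N (N (N (N (L 2557027412256636455117653504)
 (L 2479638373561903232206831680))
 (L 78602098915633449369092608))
 (N (L 2557029173999508487863009280)
 (L 3762191564087087171899408))) (N (N (L 2479648338390820134345245728)
 (L 81139342505452498566778880))
 (N (L 81147920606238351892221952)
 (L 81071180943927011571138624)))) (N (N (N (N (L 81148809148430425006276624)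
 (L 2556990077298632238204716096))
 (L 2556953478942627124951908352))
 (N (L 2557029183227384124340699136)
 (L 2554600706281583087030632512))) (N (N (L 2478396306928079078168789008)
 (L 2555820258551683809099649024))
 (N (L 2557013836689236315477118976)
 (L 2554610078375990161584488512))))) (N (N (N (N (N (L 2491154834348525016645632)
 (L 2477140162138638368292029504))
 (L 78655686722929899438358528))
 (N (L 81148804815967583475859472)
 (L 81134938710096479063642112))) (N (N (L 2557024211681237471917523968)
 (L 2557023281350144447978950656))
 (N (L 2557022248251411535415480328)
 (L 81120761099246605936099400)))) (N (N (N (N (L 2557018926684556754772033544)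
 (L 2556987849843034868504854848))
 (L 2556981959267569656590827776))
 (N (L 2554610142926083616458149888)
 (L 2477164521287107083126177856))) (N (N (L 2476025840362680365405503488)
 (L 2555819659041508612793963520))
 (N (L 2554573383165571732557005056)
 (L 2557029036603691056119152704))))))))

def tplTree15 : TplTree :=
 (N (N (N (N (N (N (N (N (L 81133295508722033602330624)
 (L 2557029179710072815309815872))
 (L 2557029161177760348860843008))
 (N (L 2554611331585903066183892992)
 (L 2555810813827725269063962624))) (N (N (N (L 2557029109296292641430832128)
 (L 2556991405385401073024368704))
 (L 2557028889218889650716803080))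
 (N (L 2554605429782972783534018560)
 (L 2477239414561391385834946624)))) (N (N (N (N (L 79938979726586560343442432)
 (L 2556991105558247097621807168))
 (L 2556948904005981656907251728))
 (N (L 2556986672701162661055841280)
 (L 2553391781594623485042295296))) (N (N (L 2479657326348445467392934144)
 (L 2556942853532472283924533248))
 (N (L 2555819077824955102867231744)
 (L 79935442644475494635929680))))) (N (N (N (N (N (L 79862831639107881352299520)
 (L 2477237938880412288450379840))
 (L 2556952445780843809137230080))
 (N (L 81148929268439686498484232)
 (L 2477155372402365061333618688))) (N (N (L 2557024013446292673950384144)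
 (L 2555820253876947395889075200))
 (N (L 2557023133848249460796182528)
 (L 81149100053944755567460416)))) (N (N (N (N (L 2553326391059668122168524800)
 (L 2554525582994963536718921792))
 (L 2556990224852318354747425792))
 (N (L 2554519836746364379231163392)
 (L 2556987862536421626450281536))) (N (N (L 2557029178615698105917505536)
 (L 2553402111773565358155304960))
 (N (L 2557028575637751196524217344)
 (L 2554605134502211694412955744)))))) (N (N (N (N (N (N (L 79848807418609525437235728)
 (L 81144000612324085024227392))
 (L 2554596999618679298455782400))
 (N (L 79923922416362207777686544)
 (L 2554610742301159619901329408))) (N (N (N (L 2478325614681332980887323648)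
 (L 2554611332317738009846906944))
 (L 2554611258882042481722068992))
 (N (L 2479575802406415397183098896)
 (L 2542575065899996196896832)))) (N (N (N (N (L 2557028002626756207674917888)
 (L 2557028003502715131417329728))
 (L 2554530756052414915716317440))
 (N (L 2557019148198608026348815360)
 (L 2554599816226181255666958400))) (N (N (L 81111321113074598959644688)
 (L 2554611328120383152908210176))
 (N (L 2557028003356339355890290688)
 (L 2557028883483555538065686608))))) (N (N (N (N (N (L 81147919453316838838239488)
 (L 2553290444205653448967869504))
 (L 2555744696085279067026227216))
 (N (L 81073546792897660225323008)
 (L 2554605429782981579626319872))) (N (N (L 2554606609064046009660736512)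
 (L 2557029184305996235089645568))
 (N (L 81143202851441504969297920)
 (L 3701984868209398744088640)))) (N (N (N (N (L 78716541293139169990672648)
 (L 2557029183891665082187317312))
 (L 2557024461865203971603300608))
 (N (L 78642391223131574012514304)
 (L 2477211597017695219930366016))) (N (N (L 2477240079132818598814547968)
 (L 79892554885489977366942752))
 (N (L 81147759122918304628621312)
 (L 81110146288313217207764032))))))) (N (N (N (N (N (N (N (L 2557028002347533035072913408)
 (L 2477225539281687831483289664))
 (L 2557019415593080502029124096))
 (N (L 2554601591702780347993817088)
 (L 1359992331729729993379840))) (N (N (N (L 2557029164771632851376669696)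
 (L 2554610742310158027291394112))
 (L 2554609995122447445652492288))
 (N (L 2557027976118568809553466368)
 (L 77505106961776970944742464)))) (N (N (N (N (L 79929535065678689834632192)
 (L 2557027994576580669767435328))
 (L 81072952966265193659368448))
 (N (L 2557019590920465795378053136)
 (L 2479648487192003622480117760))) (N (N (L 2479647568155938463882150920)
 (L 2557019721128538230491190272))
 (N (L 2555804818633649513646003216)
 (L 2479648329259780686137524544))))) (N (N (N (N (N (L 2477125100419389980605170688)
 (L 2554568655995999864541429824))
 (L 2556952445924958997213085696))
 (N (L 2557028878856106908137291784)
 (L 78612816701371780954656768))) (N (N (L 2555815535041286625524974592)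
 (L 2557019730351910267345965064))
 (N (L 2555818930386110502011933712)
 (L 2479655122201228243963478096)))) (N (N (N (N (L 3777685892360272124837888)
 (L 2557019149295243335921893440))
 (L 3773130478819188725010432))
 (N (L 78652006811408176671625216)
 (L 2479530689752120639164778048))) (N (N (L 2555744699535036381588096000)
 (L 79863792022721227311289344))
 (N (L 2556991239427754804484768768)
 (L 2557006673310956815986524480)))))) (N (N (N (N (N (N (L 1310996698606051149563392)
 (L 2557010294711712171359207488))
 (L 78606821570346695166002688))
 (N (L 2557029173995004888235638784)
 (L 2479643764609347983593443344))) (N (N (L 2557029183153074730493281280)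
 (L 2557029077807124046850035728))
 (N (L 2557027999176998901690404864)
 (L 81035744807108210552471616)))) (N (N (N (N (L 2557029182867096154155253776)
 (L 2556990220260898818035287104))
 (L 2556953331364170935650222080))
 (N (L 2553363447384467542840184832)
 (L 78730072443788276522811456))) (N (N (L 2555805938122691074223767568)
 (L 2557024462000311969270206464))
 (N (L 2556909944617605979732710416)
 (L 2554605420573111549922656320))))) (N (N (N (N (N (L 3701113745940675761078272)
 (L 2477140163291559872898875456))
 (L 81073547873761570794242048))
 (N (L 81111030144509878101606400)
 (L 81144383443062218085634048))) (N (N (L 2557029173859896899414262784)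
 (L 2557015017204295826340335616))
 (N (L 2557027708631772541510225928)
 (L 81130205985334732557123648)))) (N (N (N (N (L 81138700683958803373228040)
 (L 2555780703845992976149909824))
 (L 2557029183220628724899709184))
 (N (L 2554610151861225277161213952)
 (L 2477229970258519410899746880))) (N (N (L 2554610741292344507289894912)
 (L 2478434829769023296769101832))
 (N (L 79934110720648298438590720)
 (L 2557019582791468476505522240))))))))

def tplTree : TplTree :=
 (N (N (N (N tplTree0 tplTree8) (N tplTree4 tplTree12)) (N (N tplTree2 tplTree10) (N tplTree6 tplTree14))) (N (N (N tplTree1 tplTree9) (N tplTree5 tplTree13)) (N (N tplTree3 tplTree11) (N tplTree7 tplTree15))))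

def tplKids0 : List Nat := [
11596591778967524070129697,
11596591778839334444335107,
325586776575210227069029667487059810344463434252361,
18948062014330796039733262,
366328989219531516712622164845383323552197988319428,
11894092796792651567595548,
18948062015865431710236710,
18948062016015247855321103,
11894092796792643935797252,
18948053946259606954311694,
18948062016886061064519695,
13236499256542534952026139,
18948062017470718686789670,
18948062017704097715585039,
366508822483682999323645484538462457309352922448219,
13245796415578841687523352,
74027590452529158562148881945463882628,
16831917254944022178300931,
16299396642800751532572686,
18948062019472653577093139,
16827276744805784660213784,
18948062020061991809581075,
366508822527324212881266998776325323545331454182555,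
37695106735520912109716769929785508360,
366508666411813118493035592328835457524971497062933,
18948062019701351997505556,
83334422563696925143109353216376046280,
82171383550460469791173341472228377096,
62380944083188068009190426856763949576,
62380944083183563527577058661585913097,
7089311659571426290026206771664948728472497231177421157559600971164858450901,
15616571964010790509608988,
18948062023123773465821208,
18948062023390776550227982,
16166137363459143517863979,
14187916609274437154635808,
18948062024235742646239270,
1589425715946556874799851513145137611852278506797620518482609446,
83334422581028085693108615026072093384,
127560441086802419658907223137209474831774090791083,
6990368224983773150664172388006910037903585080759406109072678745248450479846,
16720351344075396209442859,
18948062025872293226610712,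
16299396642875212157681697,
18948062026434761204170771,
83334458089326460030405672749062161824,
15393448219736650572365845,
18948062027427843258974251,
18948062027561143086874648,
6483146252975141650956331,
18948062028150481319362587,
16831917255043572423458849,
18948062028686561017856019,
366508822698060890483886543606969708171470628195168,
70392947183501474363006494745896683686,
16005503125608244955054123,
83334458102592005484007262042590285158,
8037321339127257459064853,
6798741220976859195375641,
18948062030757504456327211,
83334458107470018731186271457806125386,
83334458107535301094378961980956346539,
8041969914099987479003155,
18948062031835021153927189,
18948062032186869572436011,
366508822761523551914650387365668983812742948587850,
30166960860714751881953491559672448294,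
13559317282340074793467931,
18948062033338847834669089,
18948062033471094456057870,
11989138492856063328518177,
18948062034034585575358483,
18948062034368295944323086,
366508822806015471389577733973032385578321976495440,
16129465237128758773940243,
366508822818349544115921204458599586315986238702886,
11665494652050323626111877492391813987803486744600275374659735569545488170325809264067037141485655918192263075818713408238609885017587845514,
30228294818805733625661610899896533355,
29065220370794941152895043935009768152,
30166960850249608195709959519839716040,
79209178201906223278524964226329478040,
137127230641053886197840221674426499510150381920532980915961172968600322665064017738920589936069447241,
361393410971067391067379059311440262754140350841376,
18938756786402034524094478,
18948062037815998229512230,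
83334458138281003876758851982046005968,
6194934326918555751153689,
18948053958641131026645017,
16831925323248032213368857,
366508822892702404362708981658079381499689020953923,
296403687120885702179342232261953701184018713939471,
603091938385450630499046014041501136086292813510526810728131232256868556800993086242760292587252401208099147614602,
18239920332185192177336328,
18948062040276010056810521,
18948062040582740597014531,
18948062040912593850466313,
16005511196007013336219673,
366508822937194323837632120678514316932217391288923,
80310918691369538630096459470221607624,
82171348084716019851794744061059925147,
137127230680107685319916710438835714400321272900225714573721493009152729056408154629050763753069481417,
82171348085293626146906014752429834982,
82171383550922052264162819535372815577,
18260588761002885173739523,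
366508822976241725406249460302924060968348475720208,
18948062023361267979255833,
18948062043938449851940879,
83334458166291513402278508280437277414,
8037329408474903176282137,
18683609494229014120759321,
366508823007037279648170314211487508632428181722704,
30166925325645924203183155450476495590,
83334422564161152649771583850955145755,
603091938583388072089053734853313254056769241073028730746868249986814637970558114463087765292702404092279136457936,
70392982674025696445499344698646463192,
74027554963314151918003526239858459544,
8041969915739859528712197,
18948062047034672010231811,
83334458179683056028946914236009023626,
5954241206766010368262147,
18948062047932889006604293,
18948062048236353980989455,
366508823071807964347834483553932211982463077189008,
11987588999525261127974937,
366508823083037282456156423928065240256136658289003,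
6873118494427864092639241,
366508823094774041464912008933084230255182224557216,
603091938708813777651037252112222375624032877102135811424173686918150472877159178600719280656995537727198261679184,
11596583708371795333873667,
14187400126810146130100228,
16005503125533475580674080,
83334458195440445299635361582386774560,
274354293533808919395815944852351530437414393741832,
83334458186698181245467496941021825162,
366508823006299422101752487771025155806514683052953,
80310918696534060442398323347305005600,
814855784559406291382155800365011554513721105441499646959550992,
26082534801624811164527555779598746120,
137127230756814821303779585412278628432113913280994508171586321966353361973306818076799872021246773072,
30228259313809848815561966819599188331,
2652426397432244141483700038315730337936360551945130146442687484631985318715606617757341357070393115507309411867677974650164187,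
49596211270400999278091387801163531424,
70392947179799668757158589582213645016,
18260588761002885173739528,
83334458211998307048653381528707138080,
41981672349066662981649473939607390351,
137127230772920136991677785193666235361747617353711508837224815992205923774642373994545761167192626122,
83334422592324288551602041017342099984,
30166925391348787495479449658572407531,
31179122465580632006249926836443653574414404010315060016140597272281046105263337329921446,
13183815364458648569118729,
18948062056605836491620367,
366508823236334488789533390049500088251131535294827,
67394395729591800352956985187271442960,
361213733758068284677812179674780163787004852830752,
137127230791030659968780780254637066407263610117820233147388414365977579998261343670835034136158151240,
30166960808143928397449743983140143451,
11913211729666994459377684,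
366508823267640405212301085215415648540476405973704,
83334458229329741340264475296306037483,
137127230801374983286106875363421083936511061328268463710715935741104205936389851400272137062205884809,
74027590460025907450456266899902693896,
31179122471645242680050859292550646772877316373316787925504405521851558373938516558095946,
38492448884901711523762437073699603622,
83007343481162110690516692449085096856,
30166925446521418421026064361129509784,
52394859283908229090415521257414984208,
9608032780919324255977486,
83334458241592397389243444895842043296,
29635672039919998359350353818815349594951202752658492626030549563985324543828509490943056,
51495293815565593428158226024546435435,
29065220512840096114147807373096387849,
137127230826774275616032977164799786674757511825769111873416749256071274560147756184359610430085146203,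
7089311666979487806399979149798854355324300241358260697373770222098171824520,
31179122464314156030209408700461383148944202749009177802364770142522406974162421269137801,
1632983146891114294550229061574159467540192212838363151251823230861592048066526556669655115354320258952497852121998143888993902313527671899467143912531228200923266961074529814661836778612834472099900578753934193504582191821251387765089634272,
301768867960899976990179334251545523686000912761179,
83293533222415306936293310911525945692,
301768867960887342184905297991215432625771228693664,
73991244377520190669974589152690176904,
137127172436538476221722913677922105113669137345057559691694358849278788638656867595076777918198711264,
73991209068781094971649443187656753360,
8082774110855383509631009,
18948062065664391041253414,
83334458260945825866450007804396700192,
6306500230454140584591385,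
18948062066456520449589263,
83334458265113945608969279989380023584,
73991209068775333323661815539484852432,
83334458260955240789495901328651584032,
102610748356126861155167640437459137917878465793473576131134483333406628661419976814179589062689566096,
62399117127163774283527050950780912924,
6306508301021856720224294,
18948062068448316901818411,
10528451510303765160788001,
18948062069059645366861867,
366508823474670322389375084479987179249755811217632,
62358227993188875757478269939448022172,
62399117127164042876194592453948605148,
603091682480895400139297371069095133993969343498541096527009505060422645135646340572458642836598505282386423449308]

def tplKids1 : List Nat := [
71680996781543450439138000522348331232,
1611922852489448090018465133170299496931959791612168383122908764,
16298363648556178056937515,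
18948062071207357720035352,
16112420448396423360413739,
18948062071770307673456664,
366508823528775218729816602199804138507857530203864,
31179122492565641340784122175582093905904208909564884108993449114146823621255715656566492,
62358227989925523793683948655899317595,
83334458260952592124077927912987165216,
366508823463767481917442018516779229648927644975328,
137127230905518447576230975081004973022245425885966033768078787438783149604701971857762052584889134496,
71680996788971090674850282171743076576,
31179122495179984817544144725760268403302215915357116646289863773658715731480187523564508,
77693965600458232411096036174616068316,
52887802998916811789155601704076707228,
63562191613335714500392661655845077205,
603091939516801693391865682316788940519805269680011298138355651341829005925968320761080614612552347260556287160917,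
8082774110600296811986977,
18948062075797490202837030,
83334458305513894975278516872083943136,
83334458305518433538351617809355637280,
73991244500965499705998031969908163460,
31179122500014304543204585713506733213665940522532517396788574798112038464288024491471432,
82153210729719901062955602012668953308,
71701441550333211223813870629276353691,
119647780376050660375628259559824193829316111369372,
62399117126796525294911071283115459272,
7089311680443006095093129484026899597204387925710639891005642101473794864324,
366508823588918945835529984667702322391255720657435,
73991208965705883256231479270000559378,
594543244640930646004336073092374456411578030120006546621646593866676372346409089635669679609930168007126119886235,
1431506390301000694828836524261586538019652858071715783670498268,
7080133484309646437073562591275553288063868920750202326289990785292005342577779428157568060770800906562516419132873325611751211571221306190353889503626203845274085874343322322896602461579748461729548746483352997352289691385610325592448386173552931384661,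
14187908543802510468710409,
18948062080249275108032527,
366508823693299214811807838769545779114289190142675,
52949101413196005013371281975227187413,
18902092728142689481261094,
18948062081396196010885153,
83334458330259965301984611018479764891,
83152727665865780047933786974035378899,
14178619483163090286018580,
366508823730616184474228982718094965055418909327573,
7089311682104965697987900404151276363407722891962762485386608846291475639688,
67367171648072692062801711573778825446,
51724728554115899982167775907923624661,
80826543428744380406804996968857731302,
1192122842470499984905708035780813373079075132568688900981129446,
136888000434902672747731183363984143265761800584791119204492282593876022459627821758618149593420938634,
83152727748221936146849700146135172384,
137127230987532854197706515767629601708773327695130918043852245815184030802309565883395600273299746186,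
1563017261915975568664691473191545201451270679422429948605891283,
361223724491492018822640345452789005272412468806171,
80806134009320106078409061174480208411,
31124727785643498389856046537955689074326934529691927155889823494149464029439294410073674,
6948626476178232419799227558044806483946975865069899979030480288713059349700,
1609110711490296405657041289082472892809300512729332359842774596,
70863174612782599478977055293433716304,
137127231003638169885601046387189500432762785922523695876334257060568303123769376916815884569995654346,
248178570800691667125970922967985716707404044829582,
16831925324932018962694164,
83334458357642929211722638191442788565,
83189038551374264285966141727875269902,
603091939935353992086438330171706938024558824933659264347504734899126301338798125874715594835406197703263041894608,
6934575014944338683887630,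
8045585478749346462957592,
18948062089255986162565134,
83334458365278281696104596498597021089,
1611922854117362846279689340908418846207894339557972421885568586,
2596271783270450772991119948912081696023133689170877002264048205338016497220,
31111129062851674591769282670006976933109059371884183162236202791868376748173836347781712,
31179109238881862606106679600772530813585761970164922193820138493713764049180918435292746,
370649619561780360890302252711658227246907589160799043612625624028917668050524995469241052651662436523913107505330178077096483670949015712525579378373367738066587233713698714357812059952203305565024034145465883643217121267167888,
8566226412978550880600580,
31179122524105945170146140044065443868051486433446188361910226134138940540838130856494812,
38492448885143659675055420805962793883,
6594712192576668561572187,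
31179122525416194119646634309900660899744718751926107154133284111707639566332012611512726,
50332219389054472245089296287434818347,
38512893553935398815216934117175463254,
31179122526783988173762737699571729656444196590796821785939380750783285873644310013945430,
30228294947912551176451322922640869705,
31179122527674040913306113350025135866024687343349025871483310936902324222428644642924118,
6990368229113829252849902645554367152134598253265659453140735559516888770134,
7089311686211962239920323175535705976049343533850725536430180833917034054990,
121573448769095203255855928261775748213734042614683750270315715229692133092414612264304543715391718734,
743498382994750135722057471999544895939807044757153381479363140,
29065220318770715265737081959588561243,
31179122530508018219329305667878886488063380643678166784188939121526348348672556757165670,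
7073851761683201270144011080780941885777379443004816665487550677732060046930,
70392982764629550764998488675573827739,
59779928041499478605745566927451856299,
50332219389054472245088553018163462891,
29003850894355249712155921330953258139,
30228294947353698365964593844740686536,
52397130779789246213775491457693516488,
603091940235619771584718543395227384615449845698825016498593050698275461078400873333710004311076514156056185677414,
16294239693116567789240345,
83334458403666251490798281206358082459,
210333670975881122351949819299500578756438309995224,
137127231089201801004808847134328874071542056753279422525501856469160289055864266554834195425286700203,
30155567482693662752731383376562356936,
137127231093785131951559298674778968482334656848323732670799300104856533754088498323013756044393588326,
603091940269215942658986967980792325864523351265118497316283223354728959684301998182482345389208708116246807452425,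
52449378568830802004612524588876955990,
31179122538421093142114863291042867910819811364289126918387092702360107609243470826325326,
6990368232145031480578363797129394200804986975333996642315705377287680566870,
1632982454592362684206589622785537462532242951124848738473304929777881233931276210049260124576750031366634936518401758088108549180919848033441337304714539126942315429941895989550352214646210643866522606730634239140317265281935315233885133138,
277211643924885302469290706244717670433954990130062,
29003886444478216575453713860896491666,
78061969639945224324553006889559917454,
23330983050154553003235256040833263838249026187569163389184756916213671131827888204038360,
56429273809207379893599457241009750734,
1611922855204247908080708955771095498041343216601006185396581572,
18906741307681011396509716,
18948062103101006397308971,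
62358228154518021445385861877354207969,
7089311689882860001144996400170401243264125590461277326353513439687021182532,
67448914872342441802941708323583427480,
29065220322484799836101345310652236123,
14443071996611650975432719,
83334458432146126318237437879503816860,
137127231133761962987135485754969371623222761560068869386813577317524919098473132089947941614848575196,
16110870930752272303391890,
51786062345586901998447724500191543654,
274254387370184577304246317314992491089596952872353,
274254387773605208832572336096543992091183023398507,
14187400093923146811572262,
18948062106730371874029601,
366508824205499297845212408407888670216385338809963,
137127231149604801038500373293941474156977978544787180758639145944209707412732186521725494617278785116,
78061969639949455048419297052672131413,
31179122550933875785320011053688199743263732035039309994019726625192840627546125271843032,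
446026108953266021478936456182928712345604189002339756283312344435535588309727741598153477542590943013400813253834,
14363867798841349280791812672665534011872404314946691393270710128307140204328910484426606366044784198506999615441726698740398630295881459177675487173287384133149264431258843762326040547072577488294002948,
1589425717001410573445801804909041490039087163217076261906035268,
14443072006171274309271893,
31179122553115381644868410713543712159452570667062341906539711333023531134721819341238856,
1589425717001505115761095199767569992154175006207511791119902290,
1589425716929797378574287587940242970461786636808318076300833348,
1611922854117312163130709245714922187330009640151210229562877514,
1589425717001643497415846212963980874428107262677331561811027538,
1554976985048364155356270004699846126957678749001714409005921476,
584700257739125179804809350637342642806281069395060186085860946,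
14029864930226972183756820,
16129473399515694512734241,
18948062111743686175883284,
83334458464340415691400538058194683307,
47806131311759352798479259047966016206,
1611922856071893931361919549184078516147226331156699473686573636,
311629721623180044776259134419291690778145405010150,
7089311693462832398877145568552592243306822295115749562262689566018039457372,
25235635133735338088172571313127303803716693046331992353159760362067635209005221508294236,
52949101413267122893341682772740145510,
35527971897322476091259945788662350165,
61558614155658394572999879512477926084,
31179122562158471435770872684087451819985834607004325328933941132951834767306579182102930,
1589425719036855951155495055789657788219609555052001403521217092,
28513214391077429123004189605674091676,
7089311694352456118129778264119498401226220035310222092966342900654826335621,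
14371785690704428769738777,
83334458481204666496298295596610225560,
7089311694668392993138074586334698642259797287468204563651152606984459530820,
137127231186553842477142277397322270666940299454004619547836451091208528874491050338887500345806693970,
7181935852146859843284903156429528246762945398154057415789194581774451119084450149501462696961180269054696921672045704003906378733719957049506873771790552000110637906926929749940266363813857222912411381369994223006428009776359197245537874027359470892048,
78061969639945488785144808372485226837,
7089311695080826064581014370430264076779045642115183614394936791303761182277,
78061969639945488785143963947555094869,
31179122567607936635497642992462044272332228742811887498173624766591919651307754738689618,
52949136834449163619655398343697236309,
38492484435016992735634242288706913177,
210253745105515107350884524903764846809614425260379,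
343050579853293203342527533440640115060821081458063,
8570883030626985477931016,
18948062119664049559961604,
366508824455188628849495917987165299223253389149330,
35384859274308263030855086719803327182,
2652426406819772118033971280432260639233576814193770772369350269056937847605899015215038236803468911733969243725233957864736476,
38492484434891803456155581868174230305,
7089311696443892410488158663664665220796642264331057931672259410732282822213,
366508823732159190400968578859449500296121537540357,
31179122573527807197761630070412817304184019733534614827247746287754880762716923376188997,
1611922856718323233071704867816510104142154585253927883731123780,
590324542166826990364425811542849212627177454800741704122242066,
5374157920820740153574584536946065842932277532365557620874041085992875761226822061825752609363824547984958721789180582079744750193805947780399106205297961878690684283680823262128841839302630803565247639796739478782390257620332563419384208282907750446344,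
63559884711820776390646863479063970320,
83334422564156652832926113341177332635,
31179122576321291350613372646651840571595104622829284410215286492245045263648021905687904,
56926760752148300070373573825933869403,
603091941065865150700760566808217830273173311019125095519482918923170731941821822527310581766138954804017135371608,
67367171869670881854681481146275988395,
135213386889781759190732253806206203548808313132265430422718774609531588040649070167957292303245135259,
31179122438716867300165444541447535760056839709616676179283383736237318685650577881566630,
6990365210841885695709306897121897877578777546788910703399562815572178897288,
49739323953024093154400102295562879515,
137127231282360114116114993893923304484411959313904756875003624752958082357540981458483325107540593034,
8570874964680589325631508,
366508824576418392812924898439418352873267003392544,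
70392982677749041510880612331320247590]

def tplKids2 : List Nat := [
31179122581835889600541801943872412922902251834936387242989159049744277966099682093697418,
83334458075918947983618803241545106342,
594674764554891687433727422625996838088289177772856991765688472183728504898697619064539095108897441600404621363721,
59779892401051005074769216068627989395,
137127231298851817405762416371816602638266255507336180389116926378210065525594163201603623406771651918,
47806166801580100621865700487309033830,
603091941209174297659363912863866741190148901243841068032441851446745503798982943778817776123807396474800681536918,
83334458221676990764256515648076645270,
135213386922884028977432334433637116358971605702358583670158836820328604241211818132097087583478105416,
31179122582754185200189188671624809581920278585240465820441204094504308636566436655940942,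
1611922162078050994715949346047321108279831060840306321144169806,
7081699693339833310605169751407112415512174496766739045460760575733684050211676952220418184131017283528460163414371643996629658706709871774736519849619032304966868346647687235429245430083920040969353908424451143901424541882730717190345182153373944654730,
38492484435011508436826752495145452435,
7089311699896160971747892962815194077794014921661318303086749351753533104712,
8756818158173647028879403,
18948062130858054681624596,
366508824673208913046440037367374357476957541637522,
355388979628060963499302873167457420897867637195480,
29003850950301662890966554260004668120,
31179122590693984427198520183389965072913234998958287105452546687165379368965486395012292,
51786062376791476099014442682465387947,
31179122591598610124365133567362094835079318557075555214315412949007593567005685974056516,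
451286844426729373086273820747276276941772683595551475948424769013826371927035265959125680228847874541395728413898,
73882206529465933828600597407473074395,
7089311701043055151063244471472319398993557919411692265748797154996449719253,
18943929974109451797659686,
18948062134057916382314528,
18373187688033339371159584,
18906741419457822198857753,
1611922857951221348786508841815613545725727605337848396300426826,
315186423654455908232570025242703959389945291084384,
80390390686075910712689090895097627558,
83316285130466112648031849328456768336,
361313642234470535007936279664543871567306386571808,
74027555235693056501638877600945538464,
12980835454162314186457109,
18948062136819889591287841,
18948062137176123842494502,
366508824791717263049683259528311871509725597402406,
365869417825384827193988117476258802772260585473312,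
603091941515353923646852211088107780284600393829786743168584998278754982670125897153076225244214403891687665451233,
80826543396561569926028291143450757984,
6855032648305008858890258,
18948062138913352214380582,
366508824826442024983093263345743394275646482166043,
14340803216468573994090505,
83334458585428093582926342096821683594,
6855032645846653062086672,
18948062140254688754532370,
18948062140602202074644518,
366508824859109132207503363426258606859125430432027,
365869417827951890034582402860910262082036155298075,
603091941618662149879827110843294699593807162932891365914795376711844553747982095125894623688214597486701912800864,
73882206421560599712683985392770220952,
31179122606923435081382515365231968390234896358310502395042057292701973770569838003236249,
18948062016038398633181208,
18948062142477220513579027,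
366508824897615245590398046926349291837820030419163,
16828309761022694451839000,
18948062143321645443710995,
83334458603071307749355872072629485787,
31179122610038401391959670084590657445807111518258096916449337890972893937706343581361738,
19195624723459488254542223864494686792548980641169692638241654830387625440730027070057646224948799817545823601435087225651127404457697193409534898017986792742366262269424078346924010198741218698962424772,
37695106854522129117964068207156268374,
6990368269627668654695938649540000904916028953175354462168300047727524324949,
12980827383711706892206083,
18948062145340048027156518,
18948062145503550622400537,
6859172767852215551655979,
83334458613760912598090183837732599067,
19266676967157459033577421081008923881483061333467480037572368011172667048398062213932635,
583513885518399370137893607383084692823156501893692852757603931,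
68512038066722538963660211442916786918,
82171383672049393016678853121744569238,
51168179144990014274806181166592295846,
31179122616573516371744567602836832905799303216982182000434076419208007795364968284579338,
80653935211409218727200657978129911131,
4380735156337060740210573662595610630240732044215324873901716234016936437334,
117102886675633871091730302250194430425963296648042617940366243080230741701248442658318095930328630601,
7089311674561950310093056787821316915874765547736810872277092457956400703899,
224255628872795538186565983983928847240271197082508398013864456836844394763021966344797536839423030400413958703496674608062897419956123293488476541942870203184365728390507218139289198525133749940474899575591885369949012231210826,
73991244377511404346316314344838661280,
7089311707180092770604899045036272289333223809616428645269121517176894795160,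
686551829734631980499808815260608079574577370117246084601361608,
31179109263849281397323782862938638888129560656481824491059261873140572664678894413031004,
1589425718554999510725691270534658881615206449253999678614418627,
155464562010463348385281636642388476662883712762069,
62399117126791769281567011191679615880,
137127231469777413021011866267683458129363530372570124668628813595954649268152296006793900729449850442,
30077629218104618047879668304288184100632840648514323632533280594923190425017492571176082,
63521302837486770557521448711728924048,
1611922859439106744423080352171854293233321336567800286702220488,
52397130913886209980850195824379960725,
6590580164083097192628443,
31179122625475033231865228785520444820193899618228369247968179053676232590136656372181397,
45836628648205969062886668452256285217,
31179122626251856390163208575460984808075719562416948353485607934766231703897902726267086,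
2352971439986945684924809934773193734357392130487650889389321937077686764496,
7089311704231348603198549423083331458424787683224553254770449531996867933379,
349005058752906202341602254145460687619182804600092,
11427685319645649149624363,
18948062155172937682124832,
18948062155346378009608217,
83334458655761134803421384715593058437,
137127231502911076323583521625806456163603057915349351052165552601713133311627532139558026864142321195,
7181935867083212172939054605481242847906418949360116655631788012639410216890666393513319864359504197267585891423021143750911408081036825090339625580616418935233926257062041714285320253786369988147019409543781371896080970940890969947203934637887179465938,
12943638753859910443991045,
83334458660786862936279545224747811168,
155624256904515360000014671435111909717033800171858,
37690563475769438463669985506062500552,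
137127231514974148745943561777206893140664575196934199467595687670958148134018191160967601231910418651,
1553395151661036052560469143673035290601224787784371734900387651,
26541122034185876733448576754248549211103370601935704045437800193918093074146996441328021,
70938174030063829957045910911565431317,
11286800262257275623268759381456694529411507988403149331904738196328447957723223225805194,
82153210827586459803281726886633537755,
31179122635512759967602437638663018439970080940420554834906283984177320776153688436911939,
83334458265111788668030504357379199631,
6285200009952465226760712014273488242544161978486416244958010809375759795080,
46976986407167023765259217732563371154,
13094459332933043772981273,
83334458678117195006108148810049913736,
2652426412478269601645589287726161664957682092037438314710616560902583757971338445385988310866965508228264158497732506068986258,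
114702366556280722349788251145323560736273796694920,
274254232325802703091096497162555225330892727911136,
47017911857057276920547577648038019976,
2652425282901555963408711024207744541644031444666147541077466088221977300673811868544256132152015453895470024874894755677350290,
2677825850683438483575391725562664936149620660086577377026109169093111198920,
70856359659490074816923735331761554122,
13094459332799666902269961,
1611922860380071466480692729728921653990670228982359267284615904,
324787362149055176165104374640656424377122876818144,
50925079157529457999317210141869211872,
27204755582959366501287909025181340240,
137127231563831183490852037936057079389858257944464714944549068521840940493658526752499962275321361616,
7089311710731785983883924293812111542829248926114535804860357495715524783939,
11991721064233073369153539,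
366508825332750638529768454224342739135450643955925,
10681846566720070142394406,
18948062165760493423427599,
17712056398135235946217499,
18948062166332239587311625,
366508825359068999806230398859645475941890268598858,
63521302409231178220138627898429145429,
35364449963749123809844096735092147593,
52397130907015977880425101460854801107,
137127231587925499648438939195484430971102715305371692348778565830325818270323389775505946584799000142,
14109363453924795242900190326621896076297719561876095571293232543575000187158705429558226,
7181935871689143142451982124198499993809128542730780197756509658449923677971710688733281784175679333592978599053131697526492655468807264587419338523883056363157828729331880853719131860403817688177906906088711896425010010299763690061398479530318253533842,
63544018788344222579977222353185670409,
82171383554174289900959590316584730966,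
165784833187191625154089005608884935597081048910550,
594674765897896714618012987985946642632570279723403430527444871285879012517949730828847581552824611815768983630851,
324937225022716171060083920559634377609414783009115,
137127231604412324423960194119655493145571003543283343028151633554677600526525437264396908105132149129,
63559884712289508378892065863511575782,
61631271039801767973858329457282256213,
6990368279461515027042358095853412318839210972035252999554329489655988251862,
11987581027027245902856230,
18948062171394850431434776,
83334458726765923645977907581966893867,
226478541503074904313461681620834640109579085808521,
6990368280006177035515804879053639585435630910539512207281769141641204992393,
315186423644675734215916490787140242430314196239637,
169061952291544749986110626830519489766463948206339,
82171348088560148433871247701904212779,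
361393410693386475643578810465962287650421124367638,
603091942651464444116801559374683703243341618335640865888464528758607838255511891611891826170963470927070306006730,
296283955204334777581359335349089868920920263885739,
82153211039956462015100437523301668163,
30743964828838976064863522457310491636064862826191752654012201181682734826098135281204507,
27642602071794527740957091648068646521202393895017264699514006414351854131018854194743689,
1610192091565445771441900534917300705893840903151233752920190075809798302049839559860919591428682057936694517381246634888788988782901020222975049101854969332332483996569393250170605530176471741191081705848597826418333551404720940235360335818,
1429089714578421292750490252045497453367812194528466182434991512,
31179122635512759967621698732191633624469397565048467961126175930779874757216178282967619,
6738371682065857063662341736113657209028029255084654898024396249874393212490,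
296643623151526269178662890167680547203376765732267,
13578436185554538109075480,
83334458749155085498010780922758307425,
2652426414716180422331940109775518077286746656124090361498795597922616583567065142205078013264912458713821765031985938736101601,
18335999045808003064266790,
18915005612281978490454049,
18948062177895169988231195,
16303012208963036402417683,
18948062178535819121262635,
83334458757369196543044824326251494409,
13392484933489490453856272,
18948062179296222795530243,
83334458761519375343066472793382067594,
137127231676059134312054675985269123180908638699290864665466073531937576991754883480920294034155519568,
52887767424322866687715026153330978318,
71665095604779550212520377841061462555,
361223568195769671648221736220153397993563609891995,
603091942883697977071415373591433296630517640362645425097968584122626898799172720533591105733717744676180708327555,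
135183482743952648015641956977404633358209804766453121550727180534116098968704350022376759375203162139,
50997807475599385274166482527038997403,
71665060410171833577071092231588282907,
71680996788979496856154485971713261792,
52905941079831582316483403034520458587,
31179122673955733594425125194074346620842439878096406061695779955379592685511432657212257]

def tplKids3 : List Nat := [
12025294116746782230970376,
366508825681741608854359518088294953839897400836635,
15843319378377130599776264,
18948062183883385306611716,
83334458781354016219516659498492363282,
73882206513168158479695273394318868699,
137127231710211315602796462955293260544257277452813514557240568679704764401949901747446126795242369284,
7181935877953742702143881796956010525443006127162658819702395549121279041916389801981268416182833764380974729181486173534920319714538866945633481599017522195699535977566990458228003473929502341077394030613434676732087755065708847018300053382774424348882,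
964075734076149399218550609627816008952817963364320766161071846,
73841281344398056513500590403754132636,
137127231718474861811009834406682324368653943893254985323917276103132275443273830278090308734830283932,
18647936841249553445819845612464961881120564793622060575482926937778244088532758937504924,
1632983157500619646503115924013983617357029819797853192632468206399901703601307680809560313744872911200751584451131339888526282354176717958816621592997003742678360710189455670652074110638315362453148229024592204079346521984373655684050339666,
7089311664403585957096588922820031794933225693921963741841837264636649417115,
4281788659407623646868226067696386690523317362822811587656228827735579960934,
1611922850359674908943720744745829977270289198918557692818622857,
361393413621675766619345970299105385349720490379414,
7089311721394655515323950408469998696271656437059921575172489448042019162505,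
371297224344829686715017996110866227236709600383855330205058392298973369137454171005840229254442527804240343900548499294313286264664258419900153534085474231923779491717931478046265356768154669778116782194920708323359216067676754,
83189073953191027314054376193194459680,
324937381803412872268009003998625400133693793633160,
74027590757124936490656986618210288521,
31179122684717160887920624577157825466678916300600480434209803115935152200013903214950624,
156253672849625504452882227957484503729071183626963,
324757389835711463900854622692368662240266184297817,
13225449171524958951938977014486905146767786905549102550137269503995087106840832560347361,
1609110711898252573850713542178754558540635815194721469050398282,
365869416461804438686214417321413958313413953192672,
83334458265113677016308493945781095776,
603091686332836404546838041264817992988529669748815138587068654203320410190099776042220826136152538461564542396818,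
31179122637010820122099720963453876230930174581958992145525748121257443084831297082754016,
26813082303315701709865251507851425318627023982862161292613040964281378813209776092096074,
279369644325194579243325266143839774704486184125840,
7089311723079674679852399091928714284689145442198216381568808920558889611080,
7089311679665279894025003272401785180785068472947388630489521673505404355552,
31179122685580828113117252549996977163435005541794352529035095229065467010204945977976394,
248168580042923984448551709774489383558896886481796,
63539475942518996969412024923504782857,
83334458264569698184434161463397974364,
31179122692692341034142544811662982031736073996728963468512721914586449490601574922191840,
7181935881504460387653286586116148049421881816783283436016584726703086566218808512735422978637007137823972720612088109347533985548757503514910333837223284684439772681881861562209010548982947481644148682723536348109778542577758858549446588196382192967698,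
1611922862620543699862608322881525907473098049295374404345147976,
136888001013229863509214939418244981213187566123653219907794652284741388559422715979181102536698376784,
63521267343460086133382355699883836110,
7089308704738892707659344419549686678208455969758595907109739774848769474116,
2465831846537920748019882815624445599732648969944547768452616785906787955908,
7089311684234245783019218783683804149778395164257926951145064980902053950020,
10681330087461875045629995,
18948062196506275801727014,
18948062196800936462254113,
366508825946376570093413604740982611712227332588059,
31179122698038703692431167536737815561936855905483827515716696390717188545625818979632080,
11634296957499552127254537,
18948062197914093083688965,
366508825971151907305031134608224481293425600132380,
7089311725388281894714773178141241315733428127576914658090276549687391564996,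
4364579758372073382792893960103576174480072479948031647687682987970715178847565480194227512623648437681562084331807293470595121470348153006349316020697152010611100302450069047814549548323780,
451286590598730089456667175809848863438880091692164246692589602836369472999905641052961101194298715144038960345685,
69611542577668123820973650522968956523,
7089311725809486945929140312028322328602041465221515793459631057563532932292,
52397095285488490830992177353770140818,
18010082037707417237586150,
1611922863528218060737717154405394472608692259126236195246322244,
227487763284718399489467519600634875417868036736288,
7089308706807291936904473608437084991712981215813042932191155827175432663368,
169051960038833832769863027594465700785619923382856,
325506850769622981569662178240324505429578937795104,
83334458585423896440231737135122612938,
71685540063682713499425020435438240480,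
348365652678489323957705254644272073328788869481162,
137127231841377335266488794271705805465930292057605255120353102539503337888925920633040880952164756896,
4364579759338537702302978443885254382248479067837781379755341869042017586856511680271487513515861939259484482242707180332760610194931668140947845734968931311869970262560494875151796235424708,
10686503213823308079562768,
18948062203584152141561889,
83334458867831067502680641822175527659,
10422050812967204574986243,
18948062204427156513095689,
18948062204607476418215944,
83334458873050039889431853011260670688,
305794976844450083313224796822487679913924942365386,
61631271431869334982054040991919542744,
6590580163555693326237729,
1611922864009367783771442719915703423402051902262430902438080667,
31179122713013852695296075407256641241087996019776040363938409266319507651570426347531658,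
7089311722117054513810848627641423924757012655812502186291168230662893479498,
31179122685585601557192594332762485962677588576303500352592265949043115621347306519144010,
7089311700340447202229573421919156962162703450363060359074171160055215302236,
81489894666945070548755563723616158866,
7089311728910291572690565900016840539804638124049198428585499743483672405596,
2465831846537920748013360883368988797168521077864416918976957996980188227164,
135183483212439529043315321049673436719381751153680388877356672938761599825643736353994327158939726418,
7181935886915554099936591444083053991803621279048652787167979847587501407525206997685954891132813207678066873709804496072582735393928288672305108945665542978657611408850593686436934482032154299611869414927036622637566176074021851847685705418231542462979,
81680712177436645742484227891531125208,
8863735501495026606932011,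
366508826186624046794838779783516809022642812360021,
74011689114489498115349100660634158496,
603091943807172731080811238157757376449416200424462890428745544136399940070535659676508851374466987662465703357834,
7089311722260213410305359109465345337792779812727631702205537739597712209092,
78000635709985866139287371549870392466,
7089311730069778038667232364268362456965474033596870646570918732345475347012,
4364579761224865336399250606755113817805418153100556667807008580261415950423340800757694534517092442632813105192848526340325170710804313838844617064818100002838315997728664441766973798372292,
138918843677394830585467410101773179179062569830340854904116882059360903527658740511897239903518988894285741752084491122660307755457545889555195080362802543412041733100599875933507041959408698168660686372462827082960899806275607513529829720142922033811525990241787779444809673746,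
46168321794283757051564676397785942164,
1561304301090916844357294427151549415299354548718029407306908960,
346986932158551619004850234105218976564383575966606,
31179122723261452589781481667771195029582468461672840244874951374366004926178123447279456,
12006183286865918324375560,
18948062213123044205133833,
18948062213417984139198467,
18948062213765405033627663,
17933630630173454911930388,
1611922864705276403404995152838342087104892219715912627864470419,
83189074601281541337253283541093975195,
13257159609905092468408352,
18948062215106004399685659,
18948062215348726557573158,
18948062215581798242713615,
366508826311293419183551614589490216388298212115856,
156923051695908097681736280331698827530852410327955,
603091944011689422850969194925437450652593386393305083871094463435646641425026051143312278587260875918302429621264,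
5997119509467595198955558,
18948062217020312595464224,
18948062217350043945664539,
14443588595025060533633062,
18948062217912763952398379,
1611922865038264936454539299355793647522368668109906546274602200,
18014214206826657070710827,
14187400133368497605443616,
16204367286887987030261792,
7161330620942220728991776,
366508826383063712463298664385915512789824168005141,
8740298116160265952428056,
366508826394425944284593995788498540947907727590699,
80717540488930865304214931852090150677,
366508826376969099554067712916571366217007966979360,
81817009608683451871159636150133503304,
349804318462533302547556239813281271535876595254699,
8112739693990687560171534,
18948062221805035114725384,
18334449522731267494248476,
18948062222385807200878616,
996019920260078146474790815696133017222493553820302092716501019,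
9343572249155163800993824,
18353043969039681191936032,
1611922865498088427598245886581861656224707967747220867825841482,
2652426421262454358056270150699932323628398912768843434532328865157286002123485956222269705537176749951092745076269217889693717,
201491875116851152902107548838915050005610471883667,
46168321794289679858228890250365633691,
137127232000106997984963784014058244028692088197797714142218239619211539305173395046929473718181702043,
39024010227969863476470988227722871312,
9343580320168646000508960,
11991712969906269811113993,
18948062225772072008941578,
83334458965993274423985775537744557386,
603091944325953606987857788000005047163284712430017826090424475374875956878616573367782654895400746644942287581205,
232862622654941596972859114812709972477678543177115,
27550007777125833351938530739411223067,
39024010227758246412832820071730776213,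
31179122747852797544581599315329172003230131825896482340834940533650017957204746108710933,
18948062214204404864909315,
83334458974654572332299403357004760341,
26350587651626863534603756209314988560,
274424229183471090974554893999912210938441320631125,
31179122749994951195472488656160723713161914295361436645528951534750721780464739099345872,
15319071087586062490403347,
7089311736975887199219585161162493857319629134362357204850203979119216296912,
6766196494151997215669600917815305820448847110252911454525118813314465408592,
80717540995922364731770558792526202022,
7089311737299023187362711111204987139414791661560646438853365123730661966800,
62396810668935819097007282986399580949,
7089311737515686161234360085326307809682561635394838866036475577090168599504,
6295828715551965879078577658474096480894688850179963006240117127760996217808,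
69068622467696718201332785878812066707,
80717541292914594871445041817824789659,
1611922866222806167504959697102114781292270205187794547362541588,
27550043285883256686225501704769767573,
80717540524521343924523846934571527915,
80717540524521674482164538349176488475,
18084459375555700192182297,
366508826649386876008206150402394773782129828430352,
221992701576367537434356804237484751513900898583979,
56572386700341622765751731217261397269,
137127232069366221180351942879232443011260947325810449955425449861760917698471466982354638255306072870,
354999497199599077522675505629954159620153229443988,
12026319181182316509921323,
18948062235034057313615904,
366508826687782773839586644952645914520750280149723,
354999497874621808444786272284777141129812044154011,
31179122761747848253062700489403877288024421566337123684370919023314912420300126156795924,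
80717540996047820087069977499360302403,
583513903779856959282636512978083274004968025929001702619398296,
56654165300358415323033287538260575509,
31179122763426610924208128694252569471194432592932500961554087513400271185426351938077648,
1632983161889060679867782086193255795832009851693419317122854962210306469845400078906288307467799927913033524474125365102219564497853254623070354361615946541460816647366008954786469105973575219026958857547064475703254657327434991697248922267,
6866688945209410805181721427406789075223381454301542293467592698698074695270,
794907847454588961562173369108952025405866485721575114378874002,
600724355706445988815791195339786751883795036207512204288278462035406285196302707541428671892830052798121543476818,
1001643500973043624315158566347768083670149223427025831439902282,
1428298117324090107014915378843019665843161247041366895152345678,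
7181935898449552065213142281215176548862676574368639924089317647451191712067467401560277849245016107397346970604457005675044929468114482601087131741778442513472914773541584686144615404234259167090409253935893610230537750389473253726807080767088157011285]

def tplKids4 : List Nat := [
78893422503375819441469858917462050219,
7089308721235075895500088677045767784772758897783816370278464256993537304151,
248178573582083738872400250922526392128582000325828,
63062397858499927430404915771425686419,
51783756114121459552186030266456736648,
73659586581566806266915672217425806748,
31179122769947375572182070590644777347947013879623665321827898778194542996415184034084036,
1564116445134679385446280814894029438487775848793193204248749655,
39024010294821320732906469360981508316,
31179122771344117645587224046273255426577261271453404986636491571274147851307843720324710,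
6960994442085836632567942016609171236211060146251203781970312507807106085842,
278270665323381938061639701878192922987286789105239,
6826410756661055994175760747184305561156796957362318928755621585337415439845605734779613201820063554053045232476245994800906439628834011902832871579444508981079063146419798330955274305811058124574271510230299773690255961241785628702837821546421993617744,
1297182694521209045558732727777834716768346821024643792823661784,
6037923906030851789422827,
1611922867191604941327896374063592439060264376620640446288245956,
51783756114299972900453779858480433312,
11476761735296469520351241,
18948062244402431208194073,
14371785728958646718562329,
366508826873580744379942980359536201705779200262683,
5995562034569278910627861,
18948062245484350530650135,
83334459051995226140075473244327510743,
31179122778320591025157143476769075713818275789871976715060835706639002820073861075183200,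
83189074414381650141979983302574997867,
50413962398872863096285888775956201810,
137127232160682724556992215649518545503178840488579056441731671178157236003454970634313934106221618775,
4287779434078596549860871573522142405672131167781380301528395384375857918922,
309331855732810433055615788232143714938180218139611,
6335605949152467514561337949884752896347074049698537907328929373341645198024737779281816997704442566093774343188985231188477829967637606075611735124867610854201171951122958650123892503620506815052427326756486082540477581958769467595750709742475568762576,
3434202027550702580227219801697001086926698564998366786931575342519017276370,
349724389971524386789517742592550178432656923964632,
780847142994475605467825030087562142501123942459851694453818332,
1564116446663356293712568398605928892499771753442196938651874504,
4287779390719516664195716414829092736769858535192427828754262428057461601480,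
5078750179415985111692480674823006329165982830956699100198965389930887394504,
5364758518750478107056588534388317740507861640494353996182145318025183626204,
1561304304726396321215024061764104116822473186288987232333211223,
1632983163000763698598015790544144016488227727377321832118784845656205330312337088481178679436510678896199714853412480568011628193707631707728884546212290763550936990537080432028893582979437693382749397621089380761935855070426893418479264144,
126041852339019955571866481111435886308898539570460,
7089311744987311022801607321187853079621416138854521194441736832114512412810,
156923055409865908187443787197364146017491029602894,
59700421349767865630867573476046406950,
365709564755525485017203821926784546441406787354844,
7089311745397652990805182400115509413232580887581646927816529116150911480791,
49101604100098037909058692826838799452681342126071317492917233470800478827315286196158256711357968970,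
5080296128362812653249068557545358968211558807723577161886302960230472925326,
1561304311748217432338466809518335401017156695675340497503661902,
23526464340331644256014375385326047968022439791086644340129381156733396715156789824633564,
42258812045850031101021614360995578647,
31179122790825301247801866096651411571583610444667479347767993890745331715914653881345623,
18906741374874503398555668,
83334459089686051549081214143210500395,
262645000258796492163633834531384995528026345177618,
13995259007761980124561412,
366508827070492404435235117146381339140361092858076,
18605092132457109388263439,
366508827078500704841073645888999140862876081718418,
31179122794668986624354541388707490269583338735955132286196982131502407556184294803140228,
5927692616949973764277802852055902102475916223184827084401343609682301813724,
295184976010410221641849876182654477972893591670123,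
81680712293904616905464137034299084139,
27695428217926933657388923238090018128,
31179122796869036319864164520459777278175982936983880939202260268343423761901291327993040,
3496038672589427910601834344168426216091015408565201245566904788398003727758,
371297383856803679091912418785387229147990499273562589237801733860212492271328465536502897267929914850612563320837010448052844983834774657263798121125681609527329168665099090757378061733590552482488150848843828644296842746537751,
81826096048518745332523471517451026779,
6253893743511467666122432732957840565270699615514278926073756480692331491918,
309331856259306448567023748565233880223383489349792,
7089311748038687805305077178952965063101843334407965528233228735082985170519,
1334794405447043085442732502769770500529846654155207005322621915,
16933575834027704706943070642271410566758489920223151035812083266789197048706124567061479242209382356094642230949417115553668769373417179325954905868045424953595711906250534213158789512599856055643586834,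
30200017515324206567757502090855762043719686992944829875933727341162414742659935462491090,
3927566510373621760088227323661218029808974719002970308481795124377694552216,
1561304304702809237630470349686281781568517733711336619829625820,
63062397858507170433719691190013526739,
69068586947592880479563581222882902549,
31179122803259312244650035242923864633350502105074269265648261575558150441244972248204245,
130339006901443279207701069555921575676080254539152606295433728251054406598621825351434256160001098716,
46313670787825363669678159974029591236,
7089311749217698611762110106040354592804973243361206871608541471061303362524,
52801445846794417387878992460650648899,
7089311749398801175885211836905434620818126220194953239346858121072801219530,
6266261660548773783066548455595285320890187185333353384312290572752281404370,
5088719836105522199331160113665280076918196662852450248995733506516334574827627089687038106827653762378707397549638277714734610738327160279473277540425815121047933529976408005462630562807808651261700238534919819059556846233270340179485464346694659351767,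
5808651255937296699292182080867597251237953752204875035009508943781278265166,
1142118778645007389322356687158428330814146371190139492277170766,
1611922867459593101996361148057155114625405645871000291698278950,
18386100572699327717441559,
366508827255623278698554859176607493882259358101650,
15690440807231617354694670,
366508827265236110144414829141313107251800926324114,
52801481267630642242072168505750585894,
603091945581330534978808503305516279297120985697067327471827926129891215007550534598548835921935302866614391943771,
11290818706761008424419332,
366508827288279752387872935854486999750527697551570,
31179122812148745993506109897524645204075387755488520240193103074836468548047963842425435,
27559310247737651874149534743295365113961412182869420115136766430090006287194214595870867,
4487408580218957377450677900203828545315830236610383189706769016570014617003,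
324228036836993888028422016901690319578793318023708,
120926597805723538626469213874258262914549011185884,
365070159471960971549628016109311629749419763565066,
28658599225991158966952044537315328732,
7089311751621568322189907660254181493712161085146861284775882914468078825820,
371297384072258845619377809209641131101999983185567602375934249434870633472515189313540216943301964321378779717931484555460230183450886561125397581134979887690118360501306288560410285440258978892527969367734120883966568512405783,
4800468732139943611136618888920536080714612502294538030412811738288211637448,
6281721547704122984220713000768698855667976675298474288620633184218548011986,
510046701305692140328181038192076642806641335674351147433339302,
4800468714230297669356845372967942086323280002261176699150599146180003798054,
794907855857248732872233118565550774269562794762277766016795602,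
300300232055185956856048961563564363963799309386706,
510046701305645133925710252358896100497946565802915929211824655,
7181935910612010390788758867726996601672891571215329484562383197332670020812933005450249858841429124940900984592048736302554802264507365980622808211845705312078388404735919347958406768365261510856805477018671612816862216789386580067392260773964238823447,
29758060407198183173081563106592190663135122263745650539871785641491134830634726175575195,
510046005368702222991519253558197747083376465191179592033907278,
817404976297790873831262755397546429561426150737501011807580750,
31179122798653991603915893483492969304162134860775753308430913102971117250196799875974098,
115971036548014932916336530410901058787972214699214,
1424783631605641670151236147921347966477597287855814899578962898,
19809761130732315468584206629842689387877145418903778024919103878527115169452849033651814,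
7061483844113174426191429749453207759906445461020493189461314000208816780242,
31056734409703209239612344741689393132941122284171126170675915407461307548925760355968614,
7181935911678892700049778132531694929115932513793937207302908584491145979085072909999127877424954697487631733422221289416855240604549908256475105003937835956228787282337399423714748565316368926818990024505448752632513082265695599133847199951231234623498,
130877333783359681529016634517350466358391910276874609627287110254000339897078051858147808853593458780,
1564115764885888964279819291517343626782144128306599427863217106,
78893422503381151870534144946838962918,
7089311754016726419053405925932394027145365684345428857956437842500249742981,
6879053905887991811940082002374264965151533719517601082031470646207900034647,
26411921126153515132971945322751197720,
7089311754355308590692524474288401711473502504618103118900028929438155586456,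
137127232370209435270893383200595792777522295649623403909673307355890045529439001323743549665035958340,
1610191404770254689759620687040527864021827535109726478115171120018537186153203264628330941089616375885149706389934996819520792664945376443071591172961886916490586631366475322132769510297337268197752918841399441431704948678316095910407341002,
6879056881208747631087442739306521669389140730108567392060327625679462999644,
30021577423321674894335418813416211616,
1611922870071629167963171425722354461575201334265008467872855256,
73884477760765686026403303988519764170,
137127232384788510640924621930050582420532976776789102656880036481233874616284132612168928843037451479,
7061483863352784957027400245306328029523949771137367891082382647646171956170,
69007253536169749971403482115434611400,
7089311755424968457262538141806458193184565596904867355244778019665138156508,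
84423250944154163158673408425374912987220933399012070144521917222554424610161873256464511753192824025464112249958735016867547653875976319909927096657627769663946070466349192176340454574523568557841100632047436742930,
3434199033438216390207408414076867478047040768619432043073517885619435484360,
4487408580218556734465260543683417407629051345597361786860609775485396976594,
507233864316303850564066654203357371065660305961895364908820070,
6738371742990457353055717661407225817738218789421618625338315580494680434278,
371297384298055860140171849387087227510440892995253730079232746473460823857761910952274768496623277524149191984842459505312542501442887208214827109205818299339220576892665873305637532860716933551791842321209570824050968910676234,
31179122814838508800373840173334686507643272671919208536731950036167761615740823249364560,
28513215054838610296814168273682694864,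
49657509795107312091718439997972415003,
50402604529230883062383135748264071974,
11286800464802038228578781154841167747703662946754872138971348796160578640411027734299984,
81717057711808882446031566139077690264,
7089311756782247968185926281113555951657794110887602183905921547812072600771,
51749716298324830509386267774135829188,
7089311757021040386457341255106052152233974869878646552320707177715242948484,
1632983165836686639661620630173655362976810754419561559549329652423000149330097690218008789143323141646011460061062664011292767545666048949378817468933015015074446236382091597389713029910780404875342152350488801028506988077805927223783637258,
25111547429480417197655928464754870265620870964542080989023111754660762818250620497036245,
359235571728696655678183938724692932947953668093222,
115971192620123808355964509571344781142284719883558,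
49639873424242077007894876471773003687894403256131577408215729468875191221449711348620125620379071696,
7089311757386612055525601619128521808979587755057660635440867685264030446798,
366115296179965047577182004101271649851622849696958143285150046993010396752257659724864346759790590038405638437029229903004107134244654187632542083419616376192235486333830436504200337590517755658288782576565716232879783708500368,
5717437754190100724733947468061477566940744014640050440990123502260002501828,
31056734468544744323211001555535082063513930138359474551532135147825171640265743976903259,
7181935916148129373688521573928212420811149416713915095033911539230556879085201099474775415867820895179645668197518909274804229080922927664258739806529682404422895666141321886818311172694539943553975497630857925415507632437886064516704057402932982994258,
130368910748285762247405534170788246821521370308896335593086772454563146867547045005452402466513540996,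
1610192101147393372362505543283112218236452177789215991596071552030247227971055975786237126991174808617992045937630508064859741378258930360269516994184823877677140929596869671231643978122814612972511774529971527810201130519528962125986059536,
138918844228744207287789663382008718024832177017809326286489708693639171421100808639051525592283032252305410345953901883325500074347719944816717565551685014059556220278952744333191735524211361034498972255570525116452012517902262679406538922791521858777821446920502202726042577943,
26321830062479113626921458610039522102200672549573572337718327523467140475646998892285079,
1223802685013625540161921844238779319281753760574015863034795931,
1020142123689430139637367344083981338124333063958581146246185948,
5382341167949517457450732410273368674819521327485040620940965846556226880476,
1428298799997601369965049959356703584449146776922428377367873676,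
48136167511074000328935865490837914392906544383351487876206376348606860125710580896435526560823937272927438462554321568120609905616751116240298894350008205864647705686355652850590287638638673712583518326978387408855,
18569969477139337230417934,
18948062288919446365143073,
18948062289086574011613206,
4380735209089051578131381861868257818406350546997055106302185977935355185878,
27695428370607917961772114288239183126,
372671736470136464389504844267565710322765970838599010401858931159760666811342253205339357649982242411216747374438,
6739914644065034549407257082950030693322212249355437094410703066482671389867,
63269151921248579067130143622620512968,
221363444719364220863336270074293115655508918803873,
16789563535615430093963269,
18948062291429721171296271,
11708674471163055617081359,
366508827781198887550022465876695330392184641815240,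
9550183821040843481153541,
1605595552816151434605184047940458808430624252810299056905549079,
600724615515856731385774264107792368179301869639561723764806191237732307372477037455665769996028081838144375524503,
137127174082622688536011226173843803837983807331840107624897021459612861951244082286108883060600657811,
250975823363266252273314253449085950630007857743116,
787129841928495594612431544793014099040787531049100768889012940,
27222929695777964090117009686621586721,
14178619592384765837181675,
2652426431157280796797177768442975336146030214302547334095285563984176505491709265667506002590338453301395073375138194498031723,
31179122852309049115134761701205268922084678204397468704011794998389968357425201107222671,
63207817352503622186723703417261523292,
136588963777873528397319576683971039759943448929770890554888908283403914671681630929724498919106318419]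

def tplKids5 : List Nat := [
6990368227302262927121505673389371374891183548816037102734729394755668577430,
3431107006292213622597586019968965921950356710150487479175128863018884304023,
603091689551629567149846804682434524187613173883439689950370481967340134771008935921089831744023981599296575277132,
1626572484442306172420029943174313956204568715291532121340527576552756538696345893923779227316742371433966283012402324468423647426990363618827873312160040957332254497693651619843223898959881149972009720480095650272595179823603260743089136471,
62396846049322993033285903372896961240,
209974006358091161885636278444673013772823860114700,
73716377436948687966298029824275382812,
31179122863008002463277521329179947940343359898494250762951308429401892774764628865463492,
71685540167669408214772366691889579291,
31314134761878485312774898682276610395,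
31179122864461876864677838015773501801866021595883627259394291009983828946322206966694231,
52946865375875920173387176911520924961,
31056734725171547189016459209053031832904197688299456634808444927535450636163463902189467,
50475332776394544365781922136473994139,
7089311763218084851390765115426814075216114863470160645036596201890320013211,
7087376173327513498981818711917770969473742866532126003309418443059304128859,
81880615581638722632360197477476860128,
7089311763511319351389730249954039863743628645733652364185892814475581457372,
52721974522823081975604385985360560840,
137127232551825460700427150005814918355815834445825754460199924444907439621340796128291568685965902812,
155554479737118176647515521444332468022314956489440,
37711043902600534418042678360395789647,
69050413908707760049143008183642489563,
7086953151874963473432599,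
18948062302306577806262284,
366508827989070392609915352024297987306037740307163,
137127232566402999406078793857409798595276000695636273184801659588437956185505874020277748227985405654,
1626573180539339661942263046567699705838963173367304163411285537738613979775666519678577805593314619927053475482001455283764330226907033761588364019359227384615484155614486630670429684494759664437133001907137852119334504639694505273448243616,
1346777771561739622437109919510028424891748374391506108064951018748507976605874407285652951553573397468467659232430381055617441,
59700385982068653579277018508608671507,
50965968591647567614867983169447005971,
365130102445017491058235506587840847291772083113175,
535754533883118429933716796474333404997079254819613741303936317859936343713793320193638120539890961297810758104268,
1632982472175653639101028166451766260807003149239634466069425031939153963450340697410048621875194149424310625197140437949043959074988945030379564882571041784555090442453754635830959312938956126149791305195376356352656607594374280335950145371,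
52740111671542503361360239680674857510,
136588963850952194048335736203091947898842903233028393669733653848860712899108528766552451903018535073,
46434103396195044517943623591124795627,
137127232588042139764217389574122225953749634727485920108759722860201306830770172862831672912148233806,
31056734735772699420250808203203502194666029351782272128109930110450866703515599239130500,
31179122862066401347164715178638237909365968863245375514795612328699308040744073720793238,
27580557942782839460517775009175958349588282955060647852043060282651504914732118490493527,
4364579783326907624123475470061479393294725249004371545677439719157977939984243034432323764633911400548813130291816103704038137304350731244440818348887976387179031489370710270473322140821955,
80390426687326367423079665989560058667,
70352058493380252609636946936950948760,
137127232602242101114722704694666852193183798838503733789291853502105626629842033832086483821366906012,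
6285203023883337122831854864433279488051583386120307593804761881419752714254,
1429089714775104934956651021506884252385843324210443908286820366,
4437970943240398255991732470314348814509612758405025576386547129623114038528188889417697567552838738757456326624140305582871136838962161372418883259493562737564226252807998936341791843439890179385439701655223223742971488795250955103243979792601027980183,
132821082738168263400439428026279920470269943124574837679741859989757617186473516460662421113046106564,
42292921278961018935760675635120310432,
31179122882928921551891421997842548019073544600562531202742530958915777482874279296273999,
16203842713157632402915360,
18683609500965802929815595,
18948062310468859818410016,
366508828146492008439731735637533237626486896505998,
366508828135570595157365220817424839078906840744854,
73882171057602500179881774245810013078,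
355638907927554016079985537186355630322799301627086,
18278666840473527438802963,
366508828174368897942072453460147943939570550486158,
56635957190725303057101704344153359254,
14385731429285375280152609,
18948062313002625040384022,
1611922873135807860307009875816522109618318815676573376302812366,
603091947105056879891987865886216330841920387022368553114007451941158661569395682286186883515016165237662838489548,
1450654648831381467567627991377945555049948175178310702565917578337753415224539525171539006072886209707233776243215128395512983176042521205353961437200427693869270866102910913976603240294047691819746702077357238353490874111369624137605871564,
354719601666920880888837000489725442774963591315980,
600724616207183631151614250176774526303396889337262140955646974152595536582694408130805481037979125890874005840339,
19756229778211316052448274416624536227371787283485609354943294005241529764931446426078379,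
11708674401080768729186331,
366508828234795137270998375043019383989717061078236,
8723761576757557209333783,
18948062315870249900048411,
366508828251128690883203422421448861359614665462379,
278260670597936924842427290396226901543277589169579,
137127232665390216381106175037915484194692875145926457320287248188793989220440536749674422896722753564,
229985292902724417672118039674531966386585850872555,
83145914081781865434146603024577987995,
2642014802883495194880613598806040712366703768992592046204172666225876440357744910930362814237453055644453342010784160057198540,
1002667778631186897719735539693909938779591169931121574295608896672093909953254672451103867171557773043539295803411634572619223204815405455558479890996988763236632037631734543958195429735205547357527247233115258340112005349212948078753022763,
138373543070449331687706784812211856068914111122556413036944317400644211962865090227210745350913160320455724805016939460294429020726499530840846662539090086314467227441459939782852153349392605165163990255298715948305087596273900957729507313982818806593455158996012369498888771914,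
114532524603801796966573276375541536872343370205333,
82171348098584486288952271099603979600,
31179122898165403385806908085499116199140134092895121805920774825027330886005824249982677,
35839185847620997130041924663264674504,
13236499256643932184117260,
8070386274391292643639320,
18948062320087933401694227,
1589425741123857273118138514495292714464090673896410208941376806,
1589425741135076490437093306100760060325611686678404964991431880,
71701442745259594289450740458318726432,
17711023356558719622316035,
6859173060256333144784917,
18948062321824620607701035,
83334459387572034924883278854312955238,
11991721221062944148946965,
366508828376637245246510333821907699466321992355594,
59779929181579102580897039145964146016,
366508822806015471389577721289125140563763147050320,
603091947419181079982500053947212092128332072952173726242763009454987479958996149655811834323612632648278188560458,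
996063157538387521536350295504829010565692780041571592570938971,
59779893687386112994905887403158015328,
31179122907023485844513313982142875330477260348207847707294617658565128153531116129947722,
79209143378443130583679707264657130208,
11276864774163715076390937,
83334459401233416663104636824087167504,
26041646139812254841936945213771612874,
137127232731402913489210530239547187556017075026850099602046201902737810293631307561225787639498870858,
51393070503234737362889410082483733192,
51393070503491563042954086104883793232,
137127232736559160804308544228451572184671501001689359140153432774549669463136843691178584088126694992,
278260673988933110364626998694738810946619112164682,
26082534794193541937905048859468366344,
137127232742924898230355150993133290854543058943573488523563681883345889740285028963311900230752190595,
6764653552268877249895925253306492834440191408599308583992802581296818693706,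
11286800534820067189284389114437014037253370268830576687434803946766157747050591858004042,
2566318299938534330339905014955707117774260393608371375894264807496513294409,
26031158431717964411272955895186170048662845324758356297810871381074095900530960549029450,
371297385248213144526315825527753689250205730546835405321504596499488788794603922864376060194676542656446960997135419555886237126461280301086369218904785317683294125568087296322259645750201499477989602445050459012680198672886602,
18561713421260533765508454,
6988822347530703661686429059924527868446053859273013681058305440828201418904,
130847430230610572993729661710233959626338550074165064725788741435413258305002744508354937514289569048,
7089311727479753866120250457867120333286449101612792709261751729093376750788,
324937224804754699720532991878753224923923844432402,
69611507026033599462462754799650604172,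
31179122917676370422299100454224460847215655847468014109820282207644659347407646455033546,
27642601943932601410405111535843073818901067081243697526710507122075448456080001259808338,
361313644497421426382417698855439520060954042696844,
7089311775203243514609267751167377095958070655066733302622644105854719416197,
5081069186495353812504929947633542814315667872001839494826689167481786128261,
5737919104282638097261555330540294605565394542239377756454332800139184318034,
271776533064727997490809578935529695960841414771227,
61558578605254024834493428669127590118,
80826543428743394391569403110261522662,
137127232785511681610607699422595594603858726005346953905110452048357194051319863408750094782509927398,
59146143997764775512710475595170972812,
7089311776046232302333083032400717931430844137610803070821062362577070514629,
1198538039912365820246310418224000234666320280697238070881170395,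
4400253273735977079197645285318667435990377165219827578710512303698654582661,
371297385365420755117259521842451240959378754411028569685665745063222059528689027975042582999101312875665642138662784304821032299232256590293002135476838499968770205333420787084965045152327018008726946625353671408921226544161515,
63539475598123230537742455165253846187,
7089311776573351048728368693682147018655979957515345052678742567294991348952,
27697010352590559860634514765046828481889371077126884871465339187634858982992796090119364,
6866689015141779993354557696821855417624334095542087394679195355321896848330,
250276628229386160733772098235534919118372722455108,
6960994475122302872308728502284447358382588606334996733020145699577959300676,
359874979612345443446744034416373057826151473614162,
68777818338372552979470060743827652833,
31179122928300294609825286782478295849476078236523107137803143607747200419911347252245708,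
45854801399596856186289456085819721120,
31179122929239322420444793755626179184935280164784183002284336424772129045050870152047008,
5918800170547919021058947173499582005783025086663652776801786363936063366736,
12839828693635946594435075,
18948062338740526992326681,
366508828692047241635814496667799774079979941265947,
71665060165404925611612252786233979035,
8037321498403528543043617,
683739709425803428675489508235237532847296533047022246344798352,
255817396445334788182305775312358362075755074718427025969708394002146103276007513336096563803777228444280155302438,
4364579790978593915027712311233761591348249209882501575322585569320465829665455370628435424179385892936108585615926652774993649374921701214032737258903066714725062512517867522484444067862220,
117985050764453261218547754855777960089793774543898199019442860223166457372782576943392841219084399811,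
30635162204225430597411340130288472509640225580957635833881559542578368754793713418643026,
248438176225488700347399386281751047250594626540128,
114702366877002232392590431934031428799354252821004,
26243856090043366694267656089729237902,
137127232848723454251251687561262390311289106301971218635066616010055333740307870222980298077118671264,
137127232830102693174848949002500575662046697379975215922904661097594073325611277795865572792235736650,
227487607179406884950112833657435233851525600118048,
271057198400490979063184404501802683078828942688786,
137127232856744283408070434459260645845012820818181195736940432041527715446103918564276732049041142732,
11276872968219414029926404,
366508828784579652677187024460895606488274481490052,
56470128301522841518495154111617696299,
603091948079345842739559273803792599954644876950610549782215267562198845792282036531828798246981187621481114514636,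
370649624529228645564850353829374349337975399423776834859282506280928313189440811470135779691619374956488556694563396357330693100089490332044076581192354833288087634771706541410098401769926097961528577491751140338126722219426069,
315346278506167786766190872559693067510642672414424,
6608665983283872963493907,
366508828816482305858623878508786632928701139923076,
13995250758399244636520464,
18948062346010490357153825,
1611922875932227988886863804640571678293348284516911332745848965,
366508826076783154091810188138328851977562841154258,
62358228062903539902414627287605445336,
209983996215102612750310477097664250606002693472984,
2652426438562397703664672362985557441051293594690133657413474353137390294195948665285650214358722222829069880608928958723143769,
324937380288785628585285672998083463782917287970208,
137127232891559420856218101642866349629950641015952932596026988809118257014276361299417066214879435808,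
31179122945910754696179484223548702113389659263185776736730431500821761387559672350784652,
13279844160213223175172682578619402657757310062475760779273690567898342034279944371322016,
6951718514891008466562247344692188424402889403182118651468617866826540394912,
13279844160210050025252803783279357439833628271706338635891420340026188808505468911656516,
7076943849650719652673373248863759079888713353850838815759553223333592997444,
4401799253337018297164748035676105683292190621075625136258117699313078410252,
886960854277608035207026655756412017180840216291997353416604812,
3046408033385937035027872942433547581409883490768039853147019075691048579084244162644494317169009413744905145497070558208286434230333337116996280138637895448377084661970680302438572396159563362414254649744943459546072675479273883657252519131668423941077,
114612296820779165231672734874914521290845183803925,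
50332184927963911009617266846096952661,
26059854087581180765702808782531204441,
79227351797658458461033923747912887811,
218318474262880905490278251787229398058782822965042338693673712949237309752553741710651154608696191949902836725267]

def tplKids6 : List Nat := [
10558400953622982675398664,
18948062352153584228106250,
18948062352553844041580576,
1609110734906637774317060802576201554764005123440411209208171360,
27824911269232319785638211553452886853,
31179109674925910283700738646567225106922084078185994320286641411188188675490633203358752,
6099681045625647958323740031518837821471865205107088189628525730022597603920,
133761393325697553596352598004537272854309954564496997232875811022143583102292982572476768608386649301082169586850854849173076461935369761395975258915217788264752059751310977994276125326568484521264255274353793999994161148764356,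
4966276372652167697991772736117951056992772541702513488500692449879740658892,
134408996219517182755213422336629683718806025364404070509441170053968489353909851381721180547133781765726950824288758729959677613892012645192838835689048063318586660532223381959051361284672017999550736580509362890376396511980949,
46272817340574411704198009647985066700,
136888002394675007911601596168276362739535699253528373584868585390135328041494527344216198430255494348,
563872835455420080635066317015598356880799099426825662613173202,
4356965400231948613660512735555031728648805461614119300378251017024264245949825118201955056733780065447160739199008642130313432969927640044151681264629135971010296047443959308577326246160836,
583513911775298409652762970858528824343513167091207257834425484,
1386600004463877685559285543627505708271761936458260816062329810,
990659236873956878287538872111205531510461358369643486652559637287025559753374323879619599806199604220970893611756676079019257931377361141154706523865198985748599325978116767364,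
138676488569490891097529207876599040684468139221117803568078536968358645690009448494601458023744326175589327989047357561956208002607389636843867253846911124681061420284073792413715778628430267520202398203830541987468659319232699454380704817801933218265904871627787965030557830480,
80717541296741145026513505252613816840,
311749614460327893870934572186493624816563785041307,
79477231232384759911084125137357767176,
603091948510636689655269723036224286884875216569748442647120056559343466516430356191772661589867554695568657754512,
18080327189838611569967142,
366508829066262304751535371193753674667155133565258,
27663589846337881491867351684730586528,
366508829067038264634585195940505541399972853844134,
83334459547360865889955184417938868966,
70104486966161804825880089766408797280,
2652426440293623350919147875126256311409287164614632512130608123989548665551212332205559463651750446710992929888039020007591312,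
361393566878759173688719945400447317371905609042091,
31179122966258166240156127883944879709443543545533251176041043264659954958176100548915208,
1611922162484748336154622407319035271879262885520563202087497742,
31179122907023275589696493287538344075371757964156220628968896225555184710274216041426954,
1561304317445512579283396043660223358691303470028226292168830986,
6990368346724725022134404154291443305775610642688209756471098339714843018192,
30200017625244681011025600557012236951086815475286364985275586305962002906130015882358794,
324937229454048675779373772982900338302868387049480,
57880810248782220656060057531904689446,
31179122969954680434061016675836886000047147164213398217413688904769693815172081467559078,
84423251317760422689564178261354378600963003794469771359176910967347845413562162231354273638583743292215411163301105996909379245283891959541895765714558037763630608642451452682841019875890644492397471588692567048475,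
83334458612877169811833327740394671881,
70935902463190073617812587041211286418,
7089311787228024342477072559848135446925420489606345410502132195884875700118,
30635175457986047691964912442625317333807918016858144291940545709223257800079269660241936,
17748720642914901224063009,
366508829187923684521121285968247259038234716671200,
83334459574291449455987230636144329616,
7089311787762813323606578775708096358092380168599249234123824376049601405398,
30743951784278578134783828754488194279136376660984007308032576210764133077214213035065810,
208974933627476301167751831985605213635887457370657,
47015604927215594464208458841325832358,
31179122976115190459270420435123058885655817025373513181187152817289803094117428163065819,
71165302623625020185612459879541508246,
50475331928504182696587147048778990880,
61703999376701566095693185575349914859,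
7089311788557541406244523562334887406202036100828740265845948799624786556496,
1611922854865219983559872973699348787037053800629967224666632210,
74994786495344232586344635298289831526305690702173521048955943089419146834874507324376855350874637554822480691618213962709222154123170380778440839535442715037046866795028655118009016183012401189095346543333136716438,
132821082450663648986977601511622326493891952118840519455352806218946627807779266058136414462341844117,
132945290627504856586082618232719183855624950908178,
1611922877854951043832802764508148404456324766195532234781638213,
1429089028958041763441964285079671893205662420851113703596146837,
5405337805312575916875883407253523011970735626758376581783540680831294057426,
325576792159881460416388255541999903475783518138184,
6285203066024711648663044331448668617055954815319814378497838648068787191948,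
6285200035232396691222723208677112792701211788351291612872638811064563416652,
370649625036659225305506993260096813096420637392409565904341593541633252077380424706177820749861895832485796778167858691724773065263304088610076890509179207024043439094627658371044587397384686278574835867638739380448304392356108,
6965632441519811190259355597594494054076592726944286247361582150687878307734,
277990921172190245995905898276967375675181660114273,
7089311790073101722071503269806284361787491223630151936895364009149123853724,
349004903649950259947583111764123075868722959745569,
7089311790257142283674060499086950256803233831715485639550987970146048489435,
41654594300275496009628743083308876705,
31179122986309422741183246726146908034417558890079137415055715838924222280600514958738785,
30254399215339361491522275055516788214634126933291287208642901318172788211752724865300933,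
229437721464113769550074739252888915442940134858941958784023923841983460667867550870553306332473725637041300223196209743187177009708050578648235864220408933922180614088884981341736023969036727487105385421238816838902022536238858,
62360499623514953939716534658591362265,
63544018788537381093565528950782046341,
31179122988656921124790057500802037133747195697966856604981816330897146477350218035706309,
1346483070783599954873276652729554687237959915527568664350208014,
5271226086690322472788358200106186100625437965146033414551196873856498306638,
50475333093169051044387016249236785323,
7089311791420144560602981556174543263413012045268925731888636337282877787307,
278019798442836699019228913460919914842511621984148552036185703160655477444892948925305151922297109498543848438187470299853857525575137664652484100830835202497551900133595508854282448225271021434731796243957161519788220294969416,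
686551829399199205694922562851151667554303175463040841202795466,
83334458867462479723101339577378414177,
31179122992198971667879381971194403716063630131784983944207561208116020710294100859998794,
5737922132196456453812522787788099330258528916331581833362288180675597042634,
1609110713526318681009757859454255833698103946803749411805725642,
6379850867270565296156580064642017647148137774088998547053036625835459383988746936098787357230807553302074221714858697970367897700057616298013057161731932724719181981783998094685919942245801312861337354863713757413435680665111817382879092805676921035996,
62376401380444929927357854312944370392,
1611922878592715872896095082573563294908258480416375897766030808,
1611922876506896472792034702639646795174166163380809932801877509,
71665095604784856832373898360892951387,
31124728267055220721801177088071690868000196578825922181511227767601881866903574158846763,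
4803950315191792122096547605434309689635486004775206271419511672614307283088,
21127996923245839062393682510910299229339318983952753197587760252038377996041323957765516,
3583776778790439339919809061333987446280331211579114123698471430323213484172,
370649625213169378905850781033754148798286453509344857697695778512378899605551453786903228206084773918596317500031369049041537969660409669802720244486362399142891003173739598132869925316363225821881933318694480647397438174319893,
123404263040415484358514415386779018948508960195813195091256799581103319870500406333894144698802718621903459009410158499640873496937289007708587304543868851208514229868675061540897325229512979169377655269538528389003921678296627587597090464523459271567340670869381093065859557138,
5382534453842647428762091840539573191118759029773560722891698312752614649870,
8154060707585325225213970,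
18948062380631919656435734,
274434226350330074406229338785635848768890746472214,
23346282027158314724598530984421070746001284190151648888327107002391653924872615419490323,
18943930147447192085069847,
18580308020871496741421079,
1611922878979634283075084054215657128970510063534809360258566487,
18914489143087514989625366,
366508829535663161628616016665251280913613168100494,
366408920912968068390988520715808652077982311254359,
41093465670670058811116381111274442510,
50475331928562211128123128870609096475,
71701407156756010142823383573752449368,
16724491483405645823344645,
16832434129585390863253532,
18948062384546181051318295,
366508829579229956303136953072108109719185184015147,
2652426443844729159369981565095785873115370116294504934213567403383487731838907590495351311189428741511885237053955206218299414,
104113357707995063317897266463447900253974038504280883216112506203790153838861711963224209462399087595,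
4491853236761744426979092667098424701072155951365066812472716228714154995735,
26409649503703145132328260274306941459,
137127233168726963449484387710180141936534538077088171788155667858648629452356867182996939636215919580,
28549524871642580601797952400924084375,
46313706530383345704786563060046234139,
137127233174840182587624904634614649855244738606307923296127641400294610110573734217358814197586374679,
1564116444694648652743350996724652875708716638682347252710944782,
11760833669680916699545604,
366508829638748165099436817434024131819346042552837,
1156355924275906221050078130120873743663556527487814203311391250,
31179123012647594613651989330668615129779603371372426125410558615426236068035842858598537,
6295831725911023430824638602985881203903438025676792385091562842700889732075,
137127233172922893692997183699993267073302212849687554700737609478745235590473158461924712212276228119,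
6295828722129691443295105858681314877118932061929277850602390097140889489491,
996019234727554528757741992545056993766787468688656457546379283,
3050796238399298829116426506041756680076002848572187595268293590928936940507,
3500679723885063992816739995030216490814982492595497748596939953454648180873,
80642576862439061047112532410283066268,
137127233201353478967097877606904821222149968643122773743261754011418264551243851771135491493012226396,
371297386467172294672131582554290435785150028431481035974421878653496178150341138774419835177392934652147598761896376067278131056175105328424664489689214972005783103894720239103206612412461102896991994910667678922803918632195859,
134734925567814787760226034213597832882756088764292992786093100052359723410071223051216283876102278304,
274334317873128602737541363371747196532637239877025,
355369155186535100248928523747088845031670544598305,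
121816478137580022683083110256083578682924026272991016286003069657086653137660935506097452496057568422,
13102731605244351707349537,
137127233215123931132538090222607154022518257898347777102296457250113601634404679763506877287408612321,
5963830116413472959076465049976916535674848505624617930546595833438607290386,
1229031523088564122523501538188596456331635770364871899621635041,
1154773404967711016524529954716256923536968269296114996129074336,
79390873655678245026405180634910950295,
535754536732213726030917672595090137452323773244995312960102510717784262789400870594041827979273287779809377976772,
16977014493269087444664455610301080132923300834738731024012094762790517268649452722587578445050530941538803862582229822736371983146004491622581287809266488303975217018591924666894430211928124073357429326,
6960994409069128002993535066862157467324181075723895410851376399611305470738,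
39769105250270953150719649409195316819,
1611922880103557484368530393536515259506214607337375699428192851,
81880579471967848675960486763643797724,
1611922880151817238964169171623482574627126456583442325429324946,
35534822463158711530911802700335153682,
6990368363811676333469831921954830323059173894809222418837576069295106195731,
86885019927961729589660071752633775131438418678027344285618936095827751349596224593615644938104509776,
80862925000973966113104472544540625766,
1024140642506660274581216342852878577349326599655088673718810390,
82818102465271055257392396757709380966991481769312544436483673870651050320809009115372621268548376458,
6960991442115012982683587619486204252665090695343115003487685711243897782432,
6251750305728341104147152,
31179123028914217987775747937409836713212335461229718914130996386836731090666072408339029,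
4364579804399683333130300836466090788411715236143228712793731262625272961370914798309429817034574135758834324965856469122432320655826421529180482779369913403058371859750115111520608192582596,
6990368363584393394833077642438915453173621746168072669674192189354953469401,
25635096745588075899866675377606420792540314208600379194570170616020612379486301441769040,
30200017451895537162970665002236652112637243107567296060339189226267462581733923781421847,
80862889462171975487213118704362459750,
31179123031532125192019802579155839694272074689690606680350049627849510727868987319025934,
1561303628624112603440188488815748704453468900641948491988349906,
532894657823570678221599525932671840607924205090337440877786918,
19265814188186698423660985857413179124064952665583333527182145951008018453064719934963286,
6281721555421784498403668851698738828007672900671334349587916521797964868572,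
7081699796282329920100942686207865834656251503260288595990868942643416917110197947083565620164835427401190468836188842317310502897191721217554906973053634441363726137091470700088790314096601464818185187355296001950657682531760974032663701930191190515728,
79477230735981384324620786654160884436,
62396846680599872731839661281500203739,
1431945819743691700179543206648370549844085526980865292625031187,
274334317873156230264056843925586138759911064994327,
42313366950441452258807610184495532372,
31179123036623002543874225267623162554289673190357561811367486777253177218157723711999556,
41150256959797293263227599743313249185,
121816478221130448788086791943041835845422353751817363074222178005180020573287641823704641309082190276,
117271096246697387269247320803927148281520045114897695520711707618863740369783405399933104165499503062,
136887943683303057277156183431362167061222115443673487560831318510052602012848968619586652250776601046,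
1219189732162874243012882510603076370033642361404340412675535836,
4952365491088121164476985765944339837564802359812405828103723367622286282308,
5349295648365793322414928805591254399670492964622911016038176765706563239493,
329840681098688572641987136260051699635942173700612674004539060330352415045932147646829289879791043861300439068874090411528070679018400589840978543151392633136022572069393281511206722838656584039702435309043096974733125005431254,
52801481176396630255820373967767601894,
7089311802996872017463082554304665267100899065549640917226107623578563272609,
183218824578813443328972512418777545937332182480150,
137127233315709600247688627896188696382441708046002736082031586468408929791227947717112549860156923809,
56626906479303413007899035411790430753,
137127233319903914784168949341107771338230170453468777701375298969248524403478512284608653917254103056,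
232862619882701520566894410812629636826300162509654,
137127233323691147789527544450332669979105044367772554009455696159210746878017378554262024508951025574,
1361597646277385502806779590524932109420100999416499506805805136]

def tplKids7 : List Nat := [
7076943737795854057774349154934945561209477266077429547869201237128346120208,
26603153040341706455703216696420350291971114480325819223417070573555081939167203303700931,
80717540996057077466863133549706354283,
42167981798186905555470190875043433820,
256450899155748800595140237728801097988673353286160,
137127233338119858510017174038541260037404619675506580081718399808419645547392527788456547280341713106,
27697860389338543959723947085876965722280595451959938951548599139669352649055038450229734,
996019935984368707672710641724907804278578966953499881269145618,
329840681196472960790799816835289361667244612748470476137835250339545549796155751171184462141560488942880316775300242751343640306719712543655437415880618431830223920894196018367979867340359335481278864329072636997786273197411669,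
11774262751790418880626712,
18948062411004476070821907,
18948062411289868057706510,
15252958183672100967153668,
18906741704545948852813828,
16761155704896998097551388,
1611922881562727352933607182578394510733526042599915659638918596,
325486875980829292238495633426082201458720978764956,
51783791631955548935207720130871299416,
1260593763492392111104907824112336798534280300876016523413595758410538098859211668324928158247481307179465437430378943593340496,
690154894753100042549525282168474326593098856326732636674327526,
1579934745164798470859741623672749482517481445401849283993404390,
3513527301361672619813689231867376763894476679110398021442253508700575853192045120827363900681462309739327709229353519978565462129830768681782127041134724086981931890896698278284168947325811910172560716994299015333836618221360613695991124061620508073674,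
35680207230786847449048535299241549397,
365709571012011947920464106776963088590986471803017,
262595051075717680786828127198834756332807189169418,
31179123056648588523842147249417486698695023044172387182004447192563186669646591234671562,
121506225667241705805272586513991957751246150941877607792750282777145647602799006352006989009907629670,
978540050308429493885887363544662777478605122863252226577298143816003314764688325748240499909977230391327603814044890869591591495282630800482600833646040117438104927912337626052,
277990767585281233133036346658812252117758829134364,
69534271624156789183428717422892287378,
137127233389174561722617777910905521820880812906318629843181528616669071125164451142496243299614211670,
1140712698582678264118527451419193634610653984123150018262658520,
1024140646665649637930265590175042728359241167665050530636366822,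
1349558848064872883478183187718957233063610792685275413257126886,
1347800574178137253237323705535471631403047169649029986446750679,
978540050427747885979273974794706432579812622685520278393736861875816868423122407170252806453217587181343009939194330514150643474557923499215628973604227513736517449493361218500,
354999347458582603983216644028818465281663460967142,
135213389018533099193417910604301209936864582304500760548392348714711790047380529068969381657615285862,
7061483849998489036408783692330694670205986293623868316015556167450887193574,
1610192112597214303082848961275742723886137355728657787627067284742689707175871501987192737094879083482360668578389994159588804137740018669564889378725206151687780378032775263041260396381569078734512178342564654899565166335231635456354758026,
136979995820806418601325854182493538652980828178654605102496570569921473551556757468866073753772393712897434023740220605235969269004903576415162079584767957578292641669433281755846883464600472159158517507145437579138434153892799989893534868294560306383223823940460335441624737825,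
352751584267479338664821366429526822699101591962898,
70863174671823602968211086419542672786,
59782199543719175815126812566399222123,
603091950509468888003028318190427157174456785102863680541262317680748383080502554693516312371788020095195950623122,
30743964927991482705642277660862381438650174220922497387229457006033712221683804509876243,
354999341187346251243471246619701635294213479597483,
232223213021404841863342946940723405685472754928978,
603091950545164819831495145858960550294362317903338903383465843300649293046791698738117968662708756733961701732375,
1386906918656104589360082949886700990857129142513436766888833039,
71701407156935142785374214279990873308,
603091950570151921915458279615420268892620205289661031889623779353344996987474446578353969110869734652567427046802,
71701441628598960171240105784008249103,
116151022970110700904915812645965340768073404184171,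
603091950597658837226299824826937838660321570906451840311926264845391569501020121271783069170749989427007482802199,
6327160595501089118224399,
366508830336289921246474873259187129988105984016918,
31179123071360359346300637592130181508406693724868072139193705595190817051519200471823314,
80862925422009541115420080629442940686,
39800943305221840958505711742623155104,
137127233449999182828494192997820166285578765205317614109437698466524437978235313823888145468719717778,
84423251596371891606497456666108468677880533393920256289695638084024657071695413229480323353848903903422945637922256068814452053771251760152762596908196214589681397780766773742362675263035143118763196871329785588695,
232223370933802546550954249350706319935352025908508,
31179123074256000470673098840198363968445650831300712258272077962805471420014228140209116,
137127232148109414035319920916897006383877945964866239635447884891022463645701458717497871850434264678,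
30743965195494527691429751395528989910148359383939629615270841367327910831858589479518352,
30743964977375707823384725284769177626688514749302918750256783159899588798495034133785564,
992390553380374632285494100400414616974568710297668059998445582969672482606208026835160005376437563338081327139373688548614555596475611205323137664625049564833439831232480564163,
6879056922872536528071493367577984848385050636392615303209419949961069724626,
4437772155549555526757066303974143748788937577374800950073420570231825155631980775815059511634463910015283598028402796343263406079674916815004254411102701208685880286953135551570388951855451473547863305753137827718918564903369750498020403064682083032604,
1000589637286232528883692746004773928145005919011104403818021840,
222494247955756085102715433920855096730414216756556525144820809211761251450249035083679941339889428693092956214730870767925012377313041438027415445213312043194536900,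
85838997452923790997340823518488214828430770470718133293786844061243342415195053057572366248879770043020664593106597959850661686321710411391015790075589479973176718481914071014359658638110343998285157815190715918679762659837643072068111462876802005207161154792681265902020235095,
8154060707585326164738070,
18948062429028022525100050,
10571830186164004195401738,
18948062429656530139742230,
18948062429788459086381070,
366508830456158573916125391550598762426979760248604,
26368795656233368696522647138551726611,
27245610028095512295400613047957455379,
31179123082651149563202874391087801251672842164107229482456270588217352798228457484977106,
11989130545543135484706824,
83334459869245180370190757009960207048,
137127233498726791629302497495489529013481357253900696668713365230510097567990884005151695760284189650,
9758648513506051844594776869159678499870945765695740318797589627522542401034832287403163,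
29122308750810059207473213117035295759650375424150820752110774910580309480759824035665811,
7089311812698152610914558166850295863751793244646277085289781099438702343131,
35655218805595792501695595495060144654,
7089311813241696742215327762008660813745188367628539552602542105589685683154,
2218859779792151810084342861688229327944501497478401361987302703624238412763,
4504218225226421591630955633838974440415306863783292691795078275228688724955,
1632983178851533743016499467048679893367722986904407049027061148547628599561644302442114678565618997842296787912078873636017788926653224380193444500945524725454250840496538609820585057497412250623296175880215651563532402652328753478575920875,
315256363718419796928887741074586339060444418802401,
18600443503467619095151123,
31179123089135167988425260966976437113823060759367591461288853416943852376828980737620188,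
1206974479828534858665098964556418933662435072959721081430615639,
29898908535137137482058385233889461656,
131496790368778803354186566404594353834733820970388,
137127233529284442469906043217126820616019547563318074486564601791002396258081588934643437429202105323,
1554995003642768717372859155685074325783553698958914311976780516125228487758899425694804945847451747448453164462669282141504027464479893108912270938493651688871061058676365916781862649970395215567864423749217321525429967643060515620622751019,
1589425734338875515086177123985404919099250996815919650592261072,
58900807241000598888242324634060457126,
31179123092803284143223951851353446325104427785892858244857926399373110062371319635263846,
690154885455932110162509289578037275440942696953831060324746192,
21568253815458984964112700679954894673672398359184081283399643766716728882662801925997520,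
29635659059284366751110474291293516547341831442302118883860478498737193856143926323315666,
56483793011447554611137431424850736916,
7089311815212195768716200648099208469908558545963940478027452572568874163472,
5983345234707185761780931331433229844214512228069414900553952004208989582300,
371297387409400828930066091884729085959747207888103445157285787577953136144843967655363830479212381727787173422579111251282310676157004278710174309532560884389726632355913266552465286735794365143313494156486947767916919896742101,
324118140010507523267303806527416681869772152905301,
248178572025190983640173904384535652972166427705557,
83007344141356010984273646424584098411,
52749197984785000568473128889424807339,
2652426451599536503899659981063594084898493742324605274761643580486801022367217098752218504025808864565761745164155927954207979,
1589425751051772801594454455353852960941386968618250982848999251,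
12830531506208595815694364,
18948062441408195912269862,
83334459913524684191837653147689418972,
137127233572094026660068252686918741274100252106255566448901746891633085573409361586477139360342881234,
29758060633198887116427605431801098601192078954176797692170172605181508648555561403561170,
51783791061146558108634109972932723410,
31172323760930771464269572626831005770309192061113032214795052494133582824390382894200018,
25335925758019081171325941337220506703303502488979137673678550354112967159981647392210071,
83334459051991454592551391115104755291,
1564115770440644120262483943208798224605994781414821864839054615,
67083217925709867708402098743948608668,
1564115770440644120262483943208798224611965107246652485449811223,
365869416101221794494492438628839588114462840718492,
31179123105339162048144671797672516199655062374720896290086355978233846079325570563370711,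
3035333328032647684047514254990337013772542538726735180210812976472606936230,
7181935976652025334045853633334247311951380762837238297462825797541252881014112721086766609015576846788324354139780756068782413127000501132852149612886997459845758037196729420453586837369756410081211376371683948768332050177736026940268560722095146815760,
30560382678351747149703523784441890829050838740151430208108252368982135203006949160398675,
35680171677163709477473283201401097558,
13234958106814266413940759,
366508830772771189693927185888021199622277804863634,
232862625905094300574171739488186366968106410061990,
31179123108907005797770291593917171340148282991382794254521745417092639855076070565947046,
209769782205028665998405899140692850501892212079082855880297981567569373487594229963197531111074111374182880392406,
7081699813779199791981658629004918388175165546569972419876954235555218940498329148476294298406472792956983710187135480998558227289049307959484574204182547210771874996207819962752950919343654172787293271911298058810295873637338735091849441480390725623504,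
31179123098224834625553613506027699926298188158034515435425028530839701768601631073541158,
2598284999132894953563531958233650503573799542267853241541256522561916039126734705580889424884703821078528836579522153195864348437290309298246777939814216183360710972096044435226432914033342604980893875968432867633703844934391340550895704339371301838492,
27582271301198972512461717834489560553282085549997581021453803207645386567390927681233367,
41150256959790309547458206234551781542,
355369155183664784951201810609582338481000351269587,
137127233625661707100253093014425414933556169485776830026518071565422452286511786017121775513460081102,
29703665449898277183198637759711974986533017555653787192117756195318297004617837794296791,
1361641573903985171697297209877525970569464592310691707090121692,
84423215749028412270331630575792137097679913405596425476545573436654124967352873938417827419644628747244218839614292103141997183356831884083810218226442987419119385911972968366907555289959087655150003600995525855826,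
2598284999132917743932959748227986507089806739274793072139848478049555350608470987165144751091471620863011103130632055740773512389804093393464283732405056062798601297695180105210864811180071875152551771526935975023541237839428148857999706283209033555740,
115971035371565389775868405109498250748160410661010,
135213389252584783474879372879814229514451804965235353112317781847783689631070668009339491798589912272,
7081699815173624920740280603328954653346350301708454979698880270830701197097091682552906203673856661624496112986843972465530769089035465465807325526821924678489411380335827798139655216629170378222534272394428864445288224682516926574953593876722518892554,
66022593684811686951650838206737221280254075249727076062335269071708685863782885250022168124375523587057123268752077763577688766568883026772131345966598884665433587545971198999277164207270932789627515206340099097698303469539665037984776443638056709289663475878166333494522845525,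
41654594822482785432428791061888895702,
7089311820283514488394849881778151158721237850264522256000712439049408786447,
35821048302864692350177747915918803662,
23346282144817551400893218464505082098108547838738877813113910303544859466679683964246099,
355638906529078088398140499925889337126099490178475,
42167946020261188146254998637283379545,
603091951556969507110548506379895420066871085681758096256705418269304264702267924696658886119343643499824337457243,
5073339184505229851160012359831223716347432336445670565453114270480005608427,
56906281376006092339109042219422582935,
137127233661819095680195446955264652099509260736891708738808197008577025862091786224509605695793225106,
3587252227916588112226041416093869967696321814270362723784425303740697031644,
996019234768617061603391110260541775319076514784288207571781792,
81717058866427902772885606311735069399,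
31179123122903374584334070767059728670183761585565219974661006858960154449666557427932562,
83189038272809510612349151781891082390,
7089311821758313314244680100960993370632867026625899286006016220275444592655,
71701442651155944887879399039909759319,
52801445405818204673076307345591501340,
14386256027987480976556042,
18948062457263055639412763,
83334459983294703843106076410054505627,
71701442650997206670810780650663315801,
31179123127079126802455720711110818688286524843359447631334400439584218094695626225845782,
5073339195212069626548167957585821636516284887166155231651944285936466015195,
11708157895611414554345476,
47017877673445138608710186414060368453,
17591476532705850745020048629118497260813707451998633164636198621691931494240251805709275,
51531290280333370213314032102293800819751044065834361178999168547836348122734923583163399121145967579,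
83334459677409205643077082527043683730,
7089311823233203226429620011496251079427594990487067991323687020142371349519,
7181935982361512692200500510349024259261258362918187227494860105233347438363665577832518680930973742881764862774051456079177854587238490723759299538081763717213643653109141227574845380069372735285062392223428211068202571814917284134882025290646350233195,
1554624796616044455631363284887923284586890188771331482899981911,
4364579818734508547870595520710577127101679019141176658170015803966053785980321217613794720112065919836302620833377490595656364175287714820844740336285742016014960522364332008051612649280451,
132821081475032784197483875800894648461774135667188230393086224802718888351214790219580843727553320978,
1583801456255548712347289334976598804931737714886791225998851652,
82818101629160156385127237239248436123992296207707695534058626008001397101743249561282349966412503058,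
19195625045329871709347260893625535921080416801637734617783047948630756221302785810715937885204055251021231456481746248627566696804045098726305502529544030388929306917538920243289041972634471811120124868,
978540052725893827901456309363166879498608299895729119163106990708954265226239959526952696353969938812432910629095363095533964843743511613269887635244934448643044989752442115011,
1024141324047588365281029927684976018787779902337118100151922136,
15593319817571137475191953205323549687960053567572827019706324936448177372505341664965842,
4303664665125986277697060160486052026776663226661352574793669773214822345147567455918173293427941164639788736742634556242171983297331096813516887945855617160998085200283347996409151189439427,
250276474630236761992981623777050160471409652924949,
9058976012695822875492367,
366508831108901426095905956236098319129292071502544,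
137127233733433641723223703049338091403630258355738500203717231133801564966437824334525426295560831129]

def tplKids8 : List Nat := [
50589335020713522738794473852037671381232859190075749507526331655211115319246283906658681815909696230314969926804276376873962772648084218095558782374852,
136979996153054151073440400689557796117348555256859020564432115194811366509840754770411966651065328305197960016413974112922758150831194565238050896646778959754351467775901061917597529117281849613048939443414961940776947773279281728583824005535141067273440458721194594530324688737,
25671643178178261146892316239347338362656034711085015423433209661332726777324928260713815,
26827544417615486502778918303278392365432848217918166195737876650602788014650406916391378,
19195616873191791203531521356573449941238352908407905325674718512432435356275815750516842974183746349912974774486455664569826266690856255690062226342600347990350036339304858392756386658772753951766958550,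
50475296434181558256075297566123886752,
137127233747278195900532613357181697744105535554299245063273935013715789882149649095612440300331516256,
10571830306634650653556763,
18235279987778755902832667,
366508831168284497290083840007028890172446119822038,
12038715668763852704579606,
366508831178214204227345068787194900759616046499090,
137127175353605823020500950288953877236593763643862528237973397569059882138756861246772624260969039954,
74007145806358873161225793953631063891,
9476314978598401580466180,
366508831201916812582778711430263145988634466846871,
31179123145084796678862374511513253191040600637552314302300725006428479015408910177726167,
137127233431378795702469475704814551275564646659194343818922920204935209108100095692709061058825117074,
693670067195644983481465604925180326120778938957574098051412946,
371297229868152153746637354056876231736208315851197981367496409397640651844178636394747191200723233896140259858947821114837686989027018737479780110084155510593280936436430299421883539587985504743612955076872944476310264734550615,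
360114602121635080154112736613474054136438072819269,
1156355238749897165691092837672262732530207085323422706067324485,
31661694133053327688289370802795578649,
349164752940543610083679088406419196468366179044054,
274434228098530734427452583124885146063228757127182,
1561303626756489664848851588646719415196701251588913693273980505,
30743964983479100983492001970735847108649188078479279490285065039235847532080362694978908,
84423251804809578700218030020928424563779940886616817874420548095749744500573672632583779812193052543566974153318469004622065583079526295791788581292547693666389123543665540845417008530579410655928587944296057996065,
119530292601570819026011537100296085157498756114766595184084537667031526283557294560793683514460182257717583939650580576322535549524738386741032763462366651968422142201550219686592792457960605682725570576650520439409806410398250599593767102287665277866106963290297403767236106960,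
35839186847935203845287083041792197910,
11761874817256998236586006,
366508831288741838225057723100812307731031188048215,
262285487572431111939002763649538788411499897686176,
71680996922497250051691871418483474972,
50475332015196555961401867595740614425,
52394824742719161826568340527562883602,
603091952229452865949587045528900689504903338783664829022194510052976833857538737880838207893866699993474096500827,
79536293757958806669292923503475950102,
52801446074414260054782857669284988183,
31179123155730431883120658019236269307548184510395581415285002362971280163641369823342295,
7089311828892766210873467457255380368923420359681093753642378511626346181595,
6831904209344651371600377961572332362996416033120292920530699951173072335826,
4380541936834644807338403082860731457551483421706293905784202371455942701079,
61799406962450262627010308661240399127,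
7089311829542174034000028896873907645373308354631064623886076295306176157587,
1611922887046099721929493435582650208199792282228298579938653147,
690858607841616778237326274691096284329064405481745086832194514,
360114759381841379900233164682508078824104784835547,
1632983182635796593000337938227361502469007073281892364775567940623217260355427497477798907008945244311982192371483189788655838432371658336796891318095406398356247825473000685414053239103919098109441916738336308316186925896708606938019089747,
5085707096873354104910466275790747568639166062354649133671545739235396202519,
21857226411172472217621835126011388644823561411232746310717785078533905941144297795498564,
1632983182708477600989233979989103438813113044615042938755631970596328891466543400372522863998117180224631895372110676334404258095415066995911515912212037635193603386640784073133212962024478593041641768496056772146958453025716284226558559275,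
2425636078537474739790219784966652492669718964932060037409190251020872072772,
73659586972441561874957706783776572821,
137127233845459251059925101011091684378965428361159324941624236805755336092556186485672019360259034086,
1222616317601343629879456085122602407078778385054472649970824388,
132595779039739854484727267974244752604715288638020,
80862926161104895934650958497615708699,
7089311831019728419628010882765678299379732613842565564401245094282501567061,
974928845198924447103724317201104703416026729121975287085607698,
992390556229274001804745973698192395228169666951637181235016744148652961089828633196648388139332477523206795674948201312586412805443005533177612415240686812824172815567202309060,
1154773406906123549728830881848777516794909515938603061265564629,
116028937755764329944671297488265771305435372768713611437366266799894441729491136602551556199182173305795827757779668960349558474599840628302791313334293778432662337285325107221764778700107507885243335647587623081689863604445589,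
4303664669351481745911065422809642578095793291096275427155768968670760487031206005689031282469237900062234584696693448192358005528514351448807779595906085481105406180560781597276385474532291,
15281357730654349575585819,
18948062482752361042280521,
18948062483092880744513541,
18948062483334773304459284,
1611922887616881166525431831185545492797955945279610609356259716,
6990368396595111434735163966107128674006703891626090249455348270774702124395,
18927709210942889709122519329401451921055854239825899565823884964490223311229758130146384625723249933709770031956079678975838419405644031280390927624659100479102542452009960063118911658996834862023070659,
136979996297509686930880773535784297320939911175784134004346884891044904833414674194574902994463702205819326036753307540276889660311007097256816128939643073836421497223704355774592404546238655492667125825554809326013479229434086663574395446339261214226348406952771002741777540193,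
366508822675037154822570059839527043249542105402066,
272515842606599835182492548290062428783973110909665,
6835405408129356975570977,
1611922887787648205875464320838409477068482984216585971750144332,
126281474778448027312525254170299535282973286860971,
28658563943467043325210097928833863448,
262924901909456571412586379011719704356085846773528,
185276916312140150509412825403030963370099726356248,
354999504109042823792408118864479108974725803542699,
8734881193829280705470850760639356526896151273065282605345080287754169825226937781683524250754540823833189572994567529910473781465730593294,
1198537358909652814649789598958960854446736795424358471338877384,
6097941849689794111375638938092529612226272994319583753400818482891628491739,
612074724669710882523069849461414827478369780956894017817447564,
5271226066770212955327517370292299050845346051847238346159723059977023163538,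
31179122407740479827798011630518617073677731097402129028979484691923993107913866404228818,
84423251880036830826865178903345357414572934389727418937163745628905772415090416099880195640034734544091287304560442889364238686831532863340954449492865172510668197165760211271325560109900495163140259993853901193504,
1206973778682781318443303526925905040152939557736617716119512652,
82153211337838532312026861753134744284,
102678035003471477760838104521791317328489137561740177908486600423577243043428782982766722993417620370,
70102214925237462060101590795746807137,
137127233922877986658863323086871971267835369114489692171044376056136037595003609862973449525560148443,
371297388418140709743725899487526432947105238101130475480569868823412770539049872142442279093530752426106292617068902265403861318533936747287339458123246645132481403270219357028282350741050149880376789010734081149931492963570976,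
117405271790359653318617115339055973822404114154203676964602666114482791952280022116378928933979685112465384381796943556544650439195715064072462252229963463856586337175928329512536434221612916118808665159330811089275909488825628,
6875964901073378592619206763773448594029150819473235538464753036570367437781,
57069839797778249619168655385708200486,
603091952773763334926773772753080531413995366101106826230808501120144590346872368941813455698489610863492517346892,
1632983183833539395354383794849047022507580199876849720215671517225096684628293649591229037229242181266063359709264218042959452729322704137703905064391306525169537871150388784158005361429396351977369092035160214386263067865906796171387825795,
992390556785782102413006508028127849630057872062402158896060344955539130007356394104278650533438005218387307156697790900684696448955559637950062774551663672240190071032969974723,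
138676489566234143619289431263711900117070235316786483478788961089497544120019389797432522259885175994404205583395952405564891414198462161233626575465149353396100724483086194311879762932860070975934568810802689143576210106332641175449404455017768939417862108467123094261141122326,
2682393421002758909600723969566866588421083097451416994460952714398456529514104976366876794874441941961422828501731702575802693098808652274104333254321047585931488298957268594366054048514293568527453431825542362040868641267627807414187989782003832378381782598669107792888323935046514374985037926893662103,
1192166122177596154262940865640059230120057437098640595828606229,
83316285392967778575843156034376958670,
6297764350851713886364338036113584808712999900342814591218590168996309676046,
16128956888447864478367764,
18014214094869819727806484,
366508831701762178030506405626932781758521830015334,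
83293569668618284719312864972772476181,
31179123188159453875153932121036937841045435744921067479488888507130073405641040383241946,
82130495116676552815428263736540135959,
31684410905943239178704337611530438995,
603091952909075411154319083278738454385188209422246431973766082819098005319317666999417501042203989726805232822738,
17938803782468546718859279,
7061483995683267006986990811751971419195712842708742426109108049949153570534,
31056735050755507523146129649476118575281083695933449862661999451495946372060366835300582,
15833009994893845066941242103442583312195257874778835274268679564386600642399308974698514,
31179123189548807052199615114191048240385608140079214517673740170214843506095534714746254,
364240929096459696751804035053745752714244620551314,
42317909207317084411821874181780276631,
82836935804432081120552734894952808981,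
137127233981379114467743766609055230482883252443006752606524184232691041825278075789740260235476804307,
25658057769918041793854056270016403320425573485809715795843587933951742320097330750079108,
3600009576875498174256033148373543214515883548431833651007332540163072984028,
1601947860879606360797753108829509961675681484906468041425945552,
1310232102473238189660097961577749596974965858579426815879733710,
9744186557328379930924978021704805885808843346401510500940169388462977401206139133110672,
84423251930318969127463574510772645902181697520298554470462496477170653665335862139742285643716730519176262394852299026270856369235316856155764053057812326863026211214984404708375256237453351272627924913276825193038,
5760722486975899038710064869414953013107015849442678103670981576408759796710,
27868036928566410245276489465464881880,
7089311838604819408731118929585988316187239067171214166554198098711660261074,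
4854581421311665280297632142867911179012768472791290267418697069417551898194,
3584549665066510237271040547914816841195296112823064223792175782634941580262,
4303662815097481971182431445055996715851038802524542014570022643568197303676710868279235003761914961016044189162300085819415682202720690306959510314426729665904576307756225004832883004697032,
1309837331761126679407057834105383168874049751022719578251734852,
818195891427900960817363838145920328007977425583117054878155735,
7045637428189710895326929834396481271287972388028069110400901893404678480208,
41154834631979762124463378053917049370,
603091953143260041172258416573356123068158272774538385069690624477806710641635897112001527877717525984674601513564,
17018875179010690971460700746698667477732243140868076495073154484979364850695930777931469085997418560583294474429390426938485546436898199885488716285537478629825274112840220066213270560524786749413595344,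
21357460989391772272753938037801272007387679561210836570902635705968691721211127055525450,
892849462904703648442126883172521883727147444148595067786899268,
4856127416317004504219591857960802563260004534681126122739820023540386628582,
7045637428417536186752712088292190773652792678431830714959968554562917249627,
31643520238577544980096064983421681894,
78059698590824733948546696118790265371,
137127234032368671250378122119832506058797123388504244504738054831017886785671120690903139692574945883,
84423251954754599081027379844675358842473521967028513692628769049310301550657882438174598031625740920883143412079708050004934632078375180330008161008459769699404734223564297835404100048397688269808150041607060640388,
7045634407826400601707665406996790842621967075551527150142759028179421103063,
17895854231639130866467233328732947634221601832378087303178193043350574383411112367711976818582109287637493015440312036111354400770239164917554174595175583091498483654010674416523052249250843256791520200,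
22037395249925319331287266319693791347270537274074786747955762173173634089871982920480983,
761600864693116422463703673734909481071593192817241748861415122,
7181932941158479025289367242161017534525443744447022158129606751797748647452674391568023593876840990526033863282066455937193442054619641355227272920814852498939663752544814987361390483194297348785921293038866684964029407973849791830680415107341986322826,
38501537194553486669614748216955510364,
31539026727745347746336601687927821658,
2652426461058480616423760573786853288395968079414520275799857967103684691500974373539972631608419454156410076917082660404477520,
1522410213638063695586484607785750835182202117386447824776067126153764958208780661048194851052405976044488182787710251270327285767039444205403952732069844516969323565716882234213456379885069264012957473559002549232694295853323287845270566085,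
11634296928205457101946904,
18948062509054515359252506,
18948062509186930041683993,
366508831989977485583479856238578499916704239600394,
19266677565141396004310948013204080014915085766123576493723014105575167839844517825003672,
203649717578989104882677572660751145976728307893207,
371297230659529816281992116678473383410804445891865361003028190137146821997868611646957078430916235810479787882158200165378264128693211359694580653147263819618476584473913164427941345956282904928377214059074414425201332977705362,
11854545309441781576963307190405212557895985722350631919180592907628788806627339429479398,
19195616919084015205935669069737904531060458519993627190070322947375208065695609617819541451160945523481562530652088356223876751909509369351616405993010034989998899153060124512284004492711067701638915914,
4364577971292355794139141246168881521253252062824516578114942809280726874873939705318031420228465596061208443555791973563169304112731028616425598158144537078675840006539276195586090821768136,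
992390557775115178134256167890159870289392228959371265072030300578018583622117481186848340834825451325276796148811690514471126955630188638494639131949773718429490814790374806472,
138918845879664617087119403294309607899901824632374680697481756584756549279281154803632612755331271481107449152899784544927961112860180371736954009494331165846393912497848395801900318034644802438118500618028318864107825556170769468977180162613250182824627676861585437765408938913,
27659046665655243322665492303543534094,
1589425757445159269995060781765339256122992941607874638932676697,
301609019017532609167004544091509288262392673731480,
8569850133769861719916569,
366508832061680254592890405083078458571401216672555,
185476728969406761827908209231251348582418264360208,
31179123218793698484008329937038833766242611000437884104541478954797788828715226023373840,
15843319505701996249219098,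
18948062514292995334864924,
366508832088707137876780555761764410250558613490884,
169331702216638896820069422772608989427647633163548,
8758367754305596022587424,
18948062515418896298672156,
1611922890353053383817822971372102174234920045718649212907076698,
169331702216601785167938344742323490719221554349483,
18674821045125042002984963,
18948062516654747368292373,
83334460244221961709826112349079389331,
169331702216633667529396379319499717989784505813163,
603091953589677844683754553764905916935111428962218696522818417624920917926285412776671515538139313920332854792282,
69634313550840840349984175517652676642917991612447145903367755151806961255349382423559142801064077739,
49832425176220310377021848011944495260,
122564920964486613865092536541638101116898362262938,
311979241352986464651367793146257279230095023669776,
603091953638252308779745549474380819803618395313043521831347059779158966699118484029034684774379594276084417605660,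
15809237993332077305790467,
18948062519402530775236613,
366508832188791297511068062703415617440969144664599,
366508832186282863490596267338284581476597596423314,
137127234139153916572311499240320838044633542512805157112537420044996352896252659277889533704509862871,
31179123226620525534198614751573319095718577497776993187177101544717015895183283770929180]

def tplKids9 : List Nat := [
9291413159805983741968388,
18948062521158286864285719,
18948062521365055179849749,
83334460265284444353452607569129726160,
137127234150752008388978762791525259122536469257297033985569911492526753187495067587108976631459358288,
6271095927131313747037599287613782768327960733185057494590931343551261622403,
38437965403219833066423566050328121369,
7089308827208786928901057297484638384516176976360443327172910567599120650329,
1632982490982542916499956571021536750067597786255916526520354206473175036175464000095776626556564061595435941361116705018076642175442473413456960304312661536039741785895442576372626788314354975278112211579976443056574162916808341669187429611,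
4932654032256229102030428600746980494722253455733384259372971762395081877079,
1632982491027132749694795565338365281242748405905621145842201858939730462319562483132351562248129428334056372652996153610420918087744467192680875254071041620219730410821185236123986337674067388999682732993756630909088940656499844569607772256,
81919427261822710399908688388824532015112550602830953527058137470828097548275069055249097139938600099696664636275422277780330266305047616853094724284834338910005451090422309452906592027011255713940852969174279971406,
84423251928934093626232865511753775257790212731321831738301774491363704619010635150566239246071319878790686105477936161410578352054065153173857638352378115449947628515196354707373709765650506481258616788421208760910,
921296568597163120043189357655479993456524944958128586318162419520154394146852731824217381667796146934828963903736535768713964339457486413291333865066242878926905618382050682587378390005528487281118972668675464881657812856162560778791080580,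
116200841056181682673111309900100179622616221275446316567100114806437994255031914431261540409403743566425195324250090453332860432730774342499988276110326933674238991979246761192168593198621761674751854077545619128050047162564885,
15778615184280218975578174832130981707227477304426927985598920417653251161442642921793106,
14373278674747483805810913083498438063071643558328453554736473241683821050750344376472691739269134536120811690039350603921464731560310683760349143714156510457077709274041866504422818629487580307888595524,
138918786811957227689089726191461777055214190243186134397730423027535648041359855411399083285774756923737647327015235831381722954124085470350999309273960218401935207336168995243972258415673109824651345478210305621172739988151939989040269232177614079921675053883296966358054502054,
17674351229375925371011092,
18948062526070453963063305,
18948062526431694839349280,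
18948062526699884542689307,
11893067852201572649926670,
18948062527249157556797455,
18948062527610279230963745,
18948062527768609844887568,
7089311848730399864786801469877170766273634834313697010612756165234681771169,
73552819940379527100543779628682052304,
61551799448666406958617936347543896784,
11645143471612946756065213659881822868955125279280182789566169906254569193541521723731795598175401397064979061925991132561420418857604288603,
49744536849854109435054614446802007104932812192394564725206027521877839069007288511825040017633322587,
42008967454912472352293132309477982739,
31179123245294821360713661093382314073099309021850239101331207998016635132545360061277787,
2679371878504969769977301410152203357258365205217668968920890411678546798171,
155454576035532084282947430995723593978956172550612,
26637162970820482259501753344299299122261927315147117795542449143307731760941226570867155,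
17929506593302830745911312,
18915005965805805641924616,
18948062531528940668846094,
83334424815819341613549489832293565134,
31179109968954152234955348279004708029780542703246527238661234914094261224951571573651681,
1377109048929864486326261143394099447103428674936027168328695950,
84275968268965581781460874203703550254750944279616511193475931001244496605194807040570447176345371913704544072154798152081906721597855686749017969261454275331830359646817578292117033386856107908056688301738603648725,
21318364768764132151889232873874307861843163439121713117597650450623561304033870192325216,
225643488861009984728275974855222180425745851191515464622180608568562229508283059172494891466055879593744936949884014180947297930651254662518954176360272575703574980,
59918908654430437230432816892130529222429429106657699974117259110164957271200170057550880862764599403016806061564378318531583289105529217264990641033337823312376660656404786021358662397204831142873048380781837197719,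
2571729261049913544358633331658333253218734744630182873965590422111802885066,
201812653180290665306598456485369380658343039586045033361981246368077327543562808153659781693820864698421002428757,
4356965441385699556832775982072623656487515239414682583175392967982270983684525228238749745244511605885759050552564145225611247086688960579420954422619236170308484429977829513916878040361412,
6624738309041145822760274798869119346920112983705254134205329222796598063712,
74849804743108171171842826911974689378420475650658640855689544649181130520507264813024405116003808797545612030716604784489176437807108088300226557693098339117767286828611613877854424665080551635685957422524915793541,
1226032922254616870774835044369809176556138412096358011399245532815901505995102576399569792559552123652833187136552959356190340,
123165635655752025866448565213598614716935601479199969806833264869976133002582009705452742084236259114706940049215757572218322306540830968964844244809574549500131110408380955402563157120148201455934115398356407534553930114321350455749217067275615385034981094334125951180737675548,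
1139263374795879650546072045549230834841461861530265228568430738,
73991244543405342363125435288971905184,
82836971967428397230459707919396244838,
168012773874960039311815575034074608646509339619031,
30986191952515654113583785058662198707254929144768148230575863575596554625570488990124832,
121286262825340914896916255483358358643059009265237,
29003853036359078635762834833251038369,
137127234264176999619869474815586026887577262577460673480907392124174226210135346057912351554757798677,
122005439868144166152744077866784318762466417051029,
137127234269168253516165799017331687693530843628798347626168949356975521827342043341121394447902617627,
23330970352893262644337933189494071292514517789731750582053608327189383423479960134004759,
29212840845682282076759298368889422369,
1611922892344821224194120938811266215758467846830453137810184087,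
7045444352423830600341333405246839639161751221986031037728623900294442717269,
7045444352213227416349534081534338322715383458035649484957960433818614683547,
134234099084657715886595740322860010659538366891285,
361223724527612189082492022414950888780183539549072,
31179123262816403410930514581618718867824131555850733504040208310677952018853639097507232,
29067493289397377377495387874577615195,
10537748686026558775754768,
83334460352097175982148023008513755479,
31684410472816280530484912408251076385,
16715186766353758817353756,
18948062542198691581657111,
366508832627499841579081379179613624233336963862293,
10839389844838315680858122,
18948062543047515497824288,
1431945145186745781290838853096734954257691712237525299854936539,
366508832627447253310608832255773111109363786059541,
2339859482090599152305392806880934494420053663184290894348248419361287122869786599787410850224211091969536617083393718691645527,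
14405148479036744043576335091450885210685215957436357606445499044425265645346510323626007,
84423252127097195170610387820113096977688579123683969538636412313056357737810101437830609046784956502787160160525474461831589214389919489485247205267197393570578737380718590870668496096137740353279903262898930176154,
307873214530991929264273827495212218795814572524058,
134234099927960937913569588085361546979023880454368,
137127234320131831594819857397227121385254397133594725382319856396857585206122787007655748052969615625,
6027792489365583747226396477250970584927549556029495470269307413876256615195,
11593310795459758475404797301266282431655851473895653385167379411863036671506994439406926935163242282476743785955851215858032075892638897096,
6960218467380941384717454453387449496124403513761695409371574953703972549595,
18528648911482316715720728,
18948062546684338478776348,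
83334460376720800215792176881633334608,
599360120373762169857997270093796157520727316800432601419871001467135601995776880109171623044321662759687604764805,
7137495372497915703927854050859734662728053367797314985989305379067556455651217329793108155021016022855200598970020394381592765610263566931667364751932915069945245936621359150143905037659156848402237243360154576112392518960156226593341247784784874477523,
5732508172394166748579087210945124166504267363421376615037272205311439088988,
3850249442236658245585674128407949215306932702431262500870664262951023559379912991968191991001869397288583993372971206574512993368749179191637721846277429076868603431563081911717917309817796,
138059239098044140519280155188296907366812221955558254016951984477884972891048984059587242987609864873727839009152462860466136246105041996591399459746489445508762347406090104468172963586077365832246490776920670236744623175298179086256539958172602805402757205974648579596207861675,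
315356118290544083272869290031480893790786672657104,
14187917106381854232018967,
18948062549187188427325461,
18948062549538879945310234,
16715186767158625756512266,
18948062550084389915590688,
18948062550334926363820058,
14178619652382837891399696,
7089311857262343806640846645236408350301158023985220714085418788927855135068,
71703679689223437174337096914940723920,
69064043734742587822035167124994130455,
31495829069938083296178619011700097744,
603091954693312066392118070284800540003922912101027411295220590724136742763373786203816060864646131039427031535706,
168052887557778685803806886787544105000379135316119,
15997763659521990158451721,
1611922893513829113444088499966906618363158974758899734951231824,
61733494260043849700008971686922684569,
127840025620232784416948956598595147864983914676757,
67737412211911429766365915122921374231,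
31179123284874796410644292325582180611367763527617305268805333032731488292388517745542357,
47797080825088727360481377809770480324,
7089311858627931821216866949797917799733819182181457654827486956539286389722,
132595614987007284832389036970623767269020205580826,
7089311858801692078283574825420349691190221135148671612408009170378119185370,
139249445194129742580906193642102213317455425571150,
137127234395335186442490153957672228341148175072686385622786733120325403873559475733012066909376588252,
46345473367551023634303586343401292106,
31375432959787674083704010373863835012,
31314098414639439979758521226385949208,
31179123289636746080529969048779551218212484213506123155981217348949330544565871106449240,
15765016786869196782955544973411356597282174064595211063640183226264347687384046544894182,
7089311859461336536113142363118691315388535685616933712825992001546164158595,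
28985677851992576685814648578049836437,
7089311859855658988979571141749298731312387639746564107779577211873245791194,
12988583326802751065686036,
1611922893994559204092855208909213916169917382158281548599664213,
7089311860171496252619270167044168727075638941420268511893657382455303209946,
5737728880363754759521531212287666339070439859277629360761501738834826694745,
74029828887487758093185611668381562010,
31179123294252966204488096989712951641608993066584508152377432116969569698775409906225242,
62358228656033528607473384704400687504,
366508832970791143879325576668204258937601943406741,
47017875866146445018728756679226164233,
366508832981819371795608067825906352585048894737235,
37695109112737796687898493258402367630,
31179123297047439791719918526132265990156875595588537572186349979733960664757288988420569,
7181936020744270771473790734820322973793910358990153771642669815577361548769790781581595837443146679708356415051725413332571562139758717531295999585456830810238074205995460816958473356532905476844368544149750015299489388273040063413397975816386038234726,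
80653936660260643548447305497913066022,
31179123298446887380222427741069977940497495594111998066244168422053468907729513362063491,
59043922117071685789506732805664813217,
15842294449473004543148065,
366508833023830439378158116270574014649388591295619,
138550249483941433910327526015713910387832420052513,
603091955057410571042480949395948743462349396199250324120087653807544043009243025833098703048769086077806739222177,
4364579842462573702767000289105164728560139084905421601744817433914428586313084806960469363911684060532153774973791753862120290995284597017836333102030370049761190132759190674678222914868168,
122548384988781296293682363030793370624970995170088707947559817357816368473262865265998671413888667748677909456163048368030950784956167675134865976251221459542810192554051986860137385644998212379608710761839661828432057576623393791137583860442589495173223075891797739546311995499,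
251235735944886065898917695713838489163252914717395,
603091698224549240257148317314342420092697806655446250313910519912994273832128961592235533138287133300949157675996,
25234785595420119984233188990410818995110628467571222251273959607051597694169744068838379,
1222397322361279377154944833572470592436537799699317835354399187,
371297231741319371536464730751106559105567165989444966882660683403939940347638738134379861450263387256954705780913969430624563294496228336992694714453271376674476708900604316273537848911417855771121249217466507774231489185689366,
3462416365083640808014739514573079952775550139149134921376599117629610796646,
1421971483032775624299145417744001439268493249834682078086622935,
1632982494712225052301345399690652928426408389829418429084084383371397183468015238388674286570355372204762408946762359175754305708090728409535920531416982889862597952742970058715256223061707791232396721150862973774746923768926986278895937354,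
2023101180941490244361005292474194426420182326695395130003374264698553905191375220905446218455150828405358071339053716414157764,
73532375256075137414735921106770724116,
1611922208179648085337917089342875221017103600150149028689014212,
21112698283058526800824203376375165833242009085299571558399214041844299709192072280948315,
992390560751625337556917102176336143364769424915993334720434043267785578465707784637299947788648485915712890509717381105636834562033558279709672641950479459161018069011138630596,
136979937741426401874377458356929353038289782443788109814323723953466011202014312415701678165708734894194784185080698945952417636042960135158115778674368867652020255528287444264107611018274236889225731224559167131176090948447701399601069535987992062652049032113961187756321315541,
2649577336116252988938345824179202109083144510033368200481591472552675096885457072200814376116970600999750231330009913162281570909112660961695776705844219442113297315468967156856462629594362089965118030012341247994756015687201630405607235102528620673614942836493723523091334847162442739467952689179078816,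
9547601542039439176630284,
18948062569009192624193559,
18580307927175657733488658,
18948062569475385554370583,
7089311864298521249808191919810809551461271263481422790302961398380987681104,
62380909777176432696084941536072042832,
18561705852877136598401052,
18948062570578753123254298,
366508833177525786816824942165516560947840748403794,
2652354166891021852711696251599704367575543880191788999778087719037216438911189120233033598838244384110739217624973509042219474,
61744888709537750791592178338456666638,
7089311865047225823383041947684669026169971351578881417719247911989096219612,
3600009573820831788703270767466979479420527604774506511078482889360361697296,
186115976160920214182437075604047225685853962502677,
7089118616489341447911557364494174570829885838868724332543534570963076427792,
609350470474659647719967469635884010601090009585570968217059878,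
38501571536619284234454686732608604495,
7089311865672517599111446604997854765580856110724389094239291234683914909070,
167972961910378536986744836988963402456040462090773,
15810262776766939923742732,
11444214162503093935407122,
18948062574532212906262551,
18948062574844508031418411,
18948062575055599231565845,
7129823429293919548211219,
6828182224512751730163720,
18948062575926427473149962,
18948062576326634673274901,
1611922895522803920511974895016341658751003082879327145589484048,
137123496570012138737783455953026725105633104279699722223785642301793244408304081099407751242632405582]

def tplKids10 : List Nat := [
82130495116526260550357988341515813582,
39273889494479746864181543135340397734,
31179123323925678505938022820119842120043323568124948916556901030111521992635875445441500,
341871519376014495630090051251137246937433736785934,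
313118346643441449768025385879919254276889288901136,
31178273407530094708771036212604908747545329665594922394606256745570203020000024781254670,
302468064378936113683563362966967635277792566837781,
248807987620167071414613041656688822320465075765781,
137123496589459465724438052134503438619529412165961817304681329886206020606484521857423893719756877840,
11854531753527102740514920810714800121404199259652464481071441828440166879814946600038416,
21291168113319603109681555168736718204634133252218752865376270770276057243786836900317712,
371287268906542236058749384133277078008343316425441075332925617571354583767202432866028530397887990986979040377904068232034522737231144985788559156112812380053063054149369590584873866121359374918750808505100599721620756129491538,
180920951753353181832894879059497792299543233066258,
135213390191864721768648299686615730548533751520969931885229796785012736129347518932888036593771754704,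
42317874339243054293331089726300488220,
11276348395418626207776791,
366508833385086215855008716476310977247444205580565,
121573452579660991695153587058606761338006163405615887537901885806492654132847279225834425118097460176,
4364460871766534496582684239076788939251177500865015848811529977640773530884433080659601685730213208326707281385514621675227422616418819979373271640657095717833883393754309256238771118035912,
5963830287553927853637687329746539433367818193838520794157007104556769752650,
2246877870426563895302320397226883097101393558629955199785233288417545347525,
19195101910795948114233160083363472389093609458464173040929912756917994046241528892683230385578911262289412862297342555322209795145222908441318028231703288276243263303839026856489779528790862496817768904,
59046156630970087547466586074673840842,
372671745814868268933899584503574896835156877604893854638231833231629015020929688369399421089875836415819112267338,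
11665176997691810298375953393915965801918840486885723215012342422342668664454961774558051326376676040556769656768435555661123468103279203272,
603091698768416790488066018047236653056326252366509161497493971942693424017573158384368992263953244224664190966149,
4364460872291302334639530653556316994860884831792747048811217792497145238338116490356895286668664241760457176438246142554323494171492156364963931534110740242626844310854814566438196647842766,
39373877404886059587904346215686340828,
73514167152530518677615825606884197070,
58900807819206720126901094884153754322,
2695408506755746019871591280196823915747644799997027901235898610166624420568,
98368089450189357725745694012325394418014811473512780151266303384092211285478384707593540396612906706,
7181740256242219604383170395423443612182851657030906216794437989150479592509098079056722267761947984573905143942071094146655150763630568863686011781420400523301055603123827557120242279269858068439117139628265498079804802913143585647918837062740834551240,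
343789893870655872847442123040867939561479369519688,
534702395782372743112758307856611088839213549650595675655194999688139543069302018250169248840169694399393503130203,
19195101914748044994066783083135154313519343619065585709812094326975738082346663245750358162633483412337429836368583960657755420245966526890014035103650857400808398616245214573532928074885725543540478926,
14013853328449536834928664,
1611922896454984306793605520168177258794555001048294239747705674,
7089308851529417753337451620775079057331225852500427657123799571393488694618,
371297232182561979137377954541389829963510607634184598551912639881404146603838426732163283488459818439459115186095364466695327262593448947916592252448801761641992154428330835860308718517164613253353920790073984458992840024914250,
138915059625774794118511312437174589851810248148107354402067847484590975417517894465050315913792565684384698971046941582070449787540331410368718072635773971098249160104684580052293458818649278546660309597228122783914546497791963744013508464187466445006341305393959610219363345505,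
2359541977072439760605167150053193859911338279793414019575557522640924356640,
83295841536357287661103410230690318682,
31179123342940034773480716844153220681001054571421935228069192310250810842367091468791334,
5850969812020126292491928419119156010929379845076326075248132151296632352220,
796050305999513231149064548325651240995952025217510996134915558,
1431593608283567566547818465783771649198102648683930245987888608,
961199879589396284361267524384132608473583482511660355150057621897315579528820818251106701757226727251976901652509411612118229174197875295787061825370333039742516574696803161067,
181000724143875361383490122229975465256225408813397,
603075516129708586624565870333498991302914381705244389494056448344902445145395048486466947691479408917107668214241,
3499520214497587402764770449816748536932442516346685700976427806908578312213,
23609756445663723352251726315411502095831364914850652217612711559919242849652568905527323,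
52469787461466953292737660707351298586,
7089118623747659589649641752198235030242660942633203496498235304475973955605,
225010059108844628239360436161722502277279701535072,
603091955982357626738434694932191082563921116231222029760510234227744612480812564985805097982897161317933528723994,
85214205729261171713197318244935975604532774705352127737547434030766976051003147353260733599618249242,
38374360889880087749207131821768182107,
168772224027631614681615531644380044644788576717153,
2652354170048723255545367137363982218608988232123767690567444847372151150552099927068176545039963673741839484509842590962641621,
603075516221161536929086435156918927654011942966977298808452853741500860940117034122906442175652797282278405434907,
4337572544823356335284775305068582498273418136633905286290666477580588475527708729668027227021426026427382052398228816090791317437010193555875148440771851454827170525717344632516463116276250,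
10363000002123001339871727136101987963304352631147339853367522922955149855917433323046967823576944799758205505426724616592553142278795842539,
5256925687352353397143015191795484453832863025813924209698587253942987829275,
5256925673309665311374606756627778125349420321760403775027351935668908765205,
8734563268485627669031223626183812083762859976405678813750525465246042602997972230829496351038899762729673019190729981375394439293030126571,
50997772157293455840460082956518866011,
225040041026438526932608258197242163956110774502299,
603091956098191955923465543984472195329057027203620178802011177370514685469756222363859638594031121310992272780757,
6749963708837327872290150903992768530565483097079990321326897577607915695595,
274424239292444871014577988845104400119751493291781,
10873995993736568415453193,
1611922897296153335542464388620344216258548557358819139542611212,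
81717022130705094937900065899755342171,
40700509404658492408776757298390369185,
137127234702426192716055509270371893611882434973122827383422544729749145994034253842223857506747514347,
31056721702342648913888748897790594056402109600040548614151140148728721388971942435941847,
15297886025461829445091353,
15623287080424426646536235,
366508833727207896536123256893406652682780410950809,
225009906748389853726811506793210664544703447567577,
137127234714839380696846468787639424794902139863869037977150454275697829455223477023989125260861595026,
761601561195885144226237582836735869037014788879666462471815643,
6939231921040273805672481,
7089311875901826055850519718367570027774492653285909002522561369707695574236,
83334460613058509043979708118841167056,
204468959746437230366754668508954497961210467911584,
2652426474141177986323341128596295112546896831624986467378431190232102284345470320263814375656237949907550013549577817913897498,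
40864031282211651971572883576181493525,
274434230026544415334050349109600909107825517793050,
603091956296829317745395744125552423111540512328878880027285644440531897406997700476685268997551359452040481026586,
18906741317744190788993036,
366508833799497668333129543732432775138575575463058,
7132922638944054879977504,
7089311876946903756301742635735823440025728336038559336559613647772996340956,
6609182773874532265492512,
83334460628068561469135139882179542118,
18051394622072922237304865,
83334460630425904385266383097534919826,
11665495002663071040562747518833979312815598376317804592259003434256374242964899914199669771640702427140927191857555424630412323295452031701,
1611922897275581546625222228882748054057664765737358026757996011,
84423252399122506424235205484761677038045785542270308602638161678654383088616261130123232373386960039188291938231505859468252055859460394469869656795792501371133844549274690012172233584528243069562312776664347654234,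
203130354662412381582888445884011764629856348799893,
181000887620894204313278453488693027103593292106949,
174367031575581965387137715789324675760598477177751,
603075516631034824747717819858182095812364080522329226814735377186727632425102999828356801771745934454366721354539,
23528164003106548788137291654032644436455001700531895919553472480576146859866392832830955,
361223726097757901745385452693138700825748622574748,
57124357274253739517196632953796702339,
57983069277745179631011707778318205847,
7089311878620992916735259070530703866578484238189287075934024229124573322640,
1611878958447906231558823101256991940849884144179259049905286625,
6988432822879473274186565212091498613348257255710630570955850755801480247747,
137059891452472152186057766398051338011649330464848200149566580983964592742680553087546293288555339152,
41990794953850927190338979853712229291,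
31179123376182411808880981051851886686768003180524343904728051779120994949089080035815451,
371287269486892274918454238392720797718823073342514587249595296777424903065278772220979864654004049731769093509108683925356931749905245540004083569332937513963408864195243632136228181343243382660042446044596853337662956171780070,
26190943193820670982517423056006503411472715048483262276332417843934638671058379676380651,
11588328080920325078122539,
366508833944702316842167995846996311527859737859419,
603091956562213341136594486416988029948940991217941471893470342797899618423715641131631121986731060396353201986954,
3349559088121918185427923284437454725687786939858009954996137715683983158747,
277531190846589731352533538313572209717460412139867,
15268665152510062505589539978598963081486538635867245423297536604918642100447666589743561,
84420951118549395010468326676248319000622151403301197254771111708249092037418312770342591164557157770704975945685299564742809071965716438102779339310880056667654275314697140229677750400871600108084714623405916291865,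
138915059800737245101004358071046649834617734568356205140909737395585534877868908283205382514457616012013084392391852650096137473195968825165211132161896077216832225701374259241782579588453200959103823640934251236659778014400080806387379935683071950618900382869316099648373473048,
6939748151495687292321817,
10801676614257568120832025,
83334460667646076852617984401861885059,
184757394967169384163132207422713478546422535293781,
83332189036566332959935091847438011238,
1535554954819347841365365059581931016505345773645306681792662723,
137127234818887358075662451757329177926591730544073869949343848935347227423106417798735727549573365849,
8145271802514614723280939,
8148895314908778816602137,
18948062615082427930902556,
18948062615355445043265579,
7089311881467693347022071283250660999969076468138881013040389835652101049559,
10520179636564879837495334,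
366508834053401820386787188451416305394587791570250,
1589425762427211835892564815844423710985507961426410283236067670,
82171385985776553126027830700334497431,
815735264907594477221078641606067880692307025634161245015771478,
42172525267977258174787647035626602134,
11665177018511202171520281301723188241884422509682080174992808470637930402795897224348544528860138479974302177282240551764696759759945204437,
8120479456241409448738859,
18948062618121635910123546,
18569969784514153587933222,
18948062618662776019615762,
18948062618966242168406028,
18948062619392672291356700,
15810270847138307336306700,
18947546111099568144777232,
18948062620171125584298002,
14187909045998099183435788,
18948062620800047174909980,
3369267583031217775130682661405350337691249872817211749452990817460602149074,
9617838454398327533338647,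
174367034970919372547501172527600446533700981883653,
18947546113070056458944538,
18948062622071253610004508,
18948062622396717507543058,
7089311884141660750488788835596591081453421829257344372076427746391458319595,
179482132752284490439792484947702530807689117962006,
359375285406081487960267544622805893168519173902107,
361393422262134682158901679484449511914204859469590,
359375438641422113641419174074064537057329833838928,
174187051402439082182984050911804240626659192999707,
51305389649232430831714975102736579911683257562230873238991479903326520317951883896454223788560154473415596030903050276812955192431668840397495473353234,
349144773922351898361506463830500821903159570204048,
31375468616501372437581187381393915351,
31179123402309685720792652634867772009149680376886088723892349240903008922385421466733209,
74029864273902212858124141662856023829,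
14072218663073503682494482,
18948062626003116586172428,
366508834252219859784617228295834658665052663451419,
137123496931044936856022948805252168824653780280575694348138705655884217578891634547132630624509231195,
221363296672435969193608175251546913900874642273610,
83020937662166578145392035579394526998,
274264382106513899005224945088034622230738235297563,
603091957101877568512122076747208482760451418443052062335846937404317506977215023665473077135868320306465134221158,
10681330196041797759664138,
1611878960219199904671174157477605204505523128878113978188893258,
1378471200670205192272285536246718504488483940893166257219833045,
2615406213974134360983588066901980029922814317692510898570432747191664013506450543406494434384155996404597965353211339944848082,
30743115562377111565955459695292693228815004582392607975405229673104446827634502811126422,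
49654826333212717614430178310817869186283379100882627984860916958252954728165262021581276224575117143,
29364387791910117357820220700128500783129158757997508772509302543330654186805937654792198880796442137529732424761905962538897248510872711777040790394322162023159476892997237186448737053318322888556285989560179098196,
17576177991123455455820356011317445008844601303942294876225679080073141843576689247988508,
6253896733323956315437051141673485382611420306777108800791810178264900582992,
134338643363657144694971444600162778717827451422054489728629204966019045667429417611475418470651280970,
11665177026645088584706323421008637130460631858407873015949802245067307822146567019032500819171097274632442897965718798741271653450195686360,
9854212917612494056910997740126359643712160090665361867282597305371470854983401140121001730112352509075832540142037156886662680555957801923,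
278270515925192436913519899174140821283289031545298,
68516616934055874771514161864919757071,
8717055084169463947329564,
366508834364723108216320011572234133246803535999253,
594658340839719340213693026147064500870434237176457906731765056576100546665422385660192404615254845821078365938836,
180920798032484081243051466418428762998840811122117,
26337979253402958028343309747402679609029327157616750832469761222372890529666313421340240]

def tplKids11 : List Nat := [
222494250398300482690584449656840380664437187372201700875494647916429472097881734569192677966809507948068908363875066296061931112517276052789854328741071296231920581,
128447589431399184330996396797976728871205379811413172249034614752690258779402337317421452186072667080,
48319233965909221323679151010362482519796387082892041048214675436665716731340579865834293999204290403110858698378010949192972650002765698155993008091352215256118959114314405879330214678804594276702469056632664708092817508861041721099971019410095411464284321030848606184977559585,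
922244455151607641849638657512641083567053961856136881259998945,
922244455151659623639646459388984294435942628694594602586354651,
1014693633869481771029307546327374623790192172363959825659420059,
1554449046940041549870239975455764074463584803242515099317001627,
976378900836147578451855569966152491928708554575658848845127067,
609350436283443769175059905993738034494520960650803729731171296,
329840685614274708627785283387158778720638600374740643172417007225874104753157006872023692696923590761864490539367932743370555347041569247479497156440838100455381410395729820259876799837675055616106132158830025567095236954762642,
283120760091542664642738683832729325445450399701128208784268590257744532309510641966327641530525156256182344190781607658545874704348692671894423806726814875549196646287317785652038751942272455087913286853944481382405146075803020,
6096399041465561007805179016899790338658030120633631948731747097282114281808,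
6866495890408036881552218530320172007081040408360468803135786558432101854678,
98132597013461885354029405948074706225030923204330338110057071496221225671496955831751998087708601810,
18373180171486890914218005,
18948062637578182279299105,
83334460776441781079235145621687114388,
42136143808623522735032757007444870418,
7089311890021048533798867157461274852998453186745155675722045467002017027913,
19130677214530321394964712944773126447323308002431100298435141010601947319084215469178322,
17048177718792500624771299847823190937190241404152260152856892424012944300289269417496619079257426955652997825629119518286379620323656916639540582667868080357783886749118047582499019404253342966279703817,
61579023275933210183331070689134248659,
365150085794490838600861349078873795913218762212046,
122565077872532125849808743572567856360169639248590,
7089308871130668039465532626696129600169651706742587594128200332127871511894,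
29135921036756876638212135692239927566006899587314722171626266241331457033293838529129930,
6380043682009552238410108921706555294885425906557977599957015842678820185198559689503304201041352291058363873184710701124702932229349973881830565565310090650470088885172301292492046229686003986561066052956724409710537882608554304285890871624953191556618,
123407992601565874822696170278651491578420986143914640892391294550886891784540447003099923972493896021132499384529224924989985870447307020897988388445053038474023158461326756504183096570246756631105282981955616918034566049667098657629148835743177255613633611953163798787337328400,
2687008044549074563880780013450658493649576703873972613799309450410188245335012579009424586070296741092128406111064252522092223557310100067641707362329042952765964611550605790859444858265296021368159556800039096446932468251321823232253338203024914667998418090983674635135374698894587148804839568765461014,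
67448950544506402337988638041570280713,
536585624237012457953476847522126429305662835958171358680394963,
2652425350079513902889298065382315819027247371317419362432424463985526119825654012976385942838052005844179918900790054197658592,
818547448416806048571440080855657938679644850216560383561347081,
13177108815650721122747407,
67739683460343015327438962203543208985,
366508834577209694574640273343124674270860159484421,
31179123432372069102572506715470159241784911621097486557628814555556998519572660022980616,
1119622355219097983889292229908366548437832299201405098169265889,
341861684747392558916292850368702769271422429999112,
6766199705457289478049162479253300858208428596190319969712729903584617002376,
84423216615621274384393740454298201798297839037109420636385660161279216947258800305975050238750192124162313225741357098709723699750349020001630766714465331045445075651022332451489061267548538279459645153508696525409,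
1422015422655514563981221483370761281227866426955517980100017737,
371297233302076597861460064813862994682804401487998426085298161162625929497264658205175071369153992800362675549343071518669996060380322584431024124491698151292650415351173315742055174639275922359137165451771317692243935282390864,
371297391446858138201605673972662439167436567505750156119228857092306791185595820220755061103328894481897920045537125247335884675405242669931283493721874926744781909163953914673004394724847157327180931569388570703903814645244484,
2596465036885694390356586362640669516252871817137665026174427206420705373916,
1037566625128688824629829947638791544588607295006915493963679606086133705953530910540961594059973207954160607576801643161679924181027107947205242989351697818155542860283010701078574375399946181346112475944084832555768857644320314726828585936,
1630133613361274617845219054587917631761615247380311552494147966761210955172863484076994069367355257171547658248744144565016401933619455793755765089664255642387521685592649381331976273441881023896673082174141201863602867706580805087572058692,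
4563266275684771501707616000167427329898377710973617334311449857423916849653784266887587069194983680750736728804434703578358394990519222617533995893378024437867878401095835357906100188085623711361285124875470216192408242330485003853609706828920294245333,
83903936487338771068857198761543464386356362464616808240615179733890803933568911374027361705238841070709760819242518727938565459125825313531943247389864491519512998513858422342177067920973081840685502800540446530931003650756800736392595221813408810336751436604544740549483076298,
39646437744377479417852034206950230732,
31179123438758766444179971150087281874594961859432552305014746065094060586847902250610702,
5306780907524924345927738464673895301566897774583635671519665910088409887636,
224610276388704885520825198023860253426676137985431,
40809548587638878639612659153332340892,
71038091233080778788156957643625249870,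
137127235070079357757383406274990437152703732961351526295054465560690833870307396307927331079849383758,
70935902322072851052741993358447085701,
7089311894137610568304179856446671314742301425256527985847315783066109390862,
2468150897461677748594091385300211894564809872816030132711206440041632062870,
3471689425458500398945246641153987173047040471250245516348449794741428641174,
41154799050833159509797854042904332431,
4966276484777012700863424185763760729023691519238055614196909474351924953446,
29989773729776475858760493177264931333,
31179123444802567990828410228958332760775256073501971131813119353950467062241088808170454,
5257312275255624670227555292776062171173604477818105003228707107010401923214,
1220683663770160847090596505358490370724969847993801084745286614,
84423252605992550866720520992081575204350224424418200776171137539741989908958686132697323085221932068804616256527771615773581120832595722930592378910164739321619553716777398633902910529941058092813816078441124030875,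
39646437744376652995668961764191514326,
31056735307059277985450133480665198699336217275532815300993445832487959687748910384757193,
5405724343161194058074702155833216107295380301265374878869919704960804598753,
21796018853544003142025121584520363053588409306749556031155190275424493314240733572563401,
84091864050857409289224454334246989869727923646411247246022971307746087971987424975634423536279011018839697038695213560567374572583981969127175514613980156124171654563795135059539875274423639655524866817451857367515,
174187207436897936123199995150747220534618184791206,
79531749702099416496890605294862775450,
315176439063622614960256670257558177842039852371163,
594674524465594033734204930239920962976070963813299219672632551697636299796291401979640224461938636434105841037847,
78168772275449968448874681916293434841,
84735745097491991794282865184130549729753383535582257061871588386287285640596971998144068182163653083,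
7089311896235303022704923736045305064803306970330369660787602226764314664348,
132625755379463505974747966225442606871557863508630,
9390832023993314560472325528497152216526951850465624816969818103100331120702348438490006076260091853788578451327124141622883087719529887420316748453786174891266199729781417347081910456499954177372458255,
1576331695113731115902748830527109253265574078992721046619352517,
15289062582208764242631726868455489827001688478619895206524282596839992474938411409489482,
17018867158244540700092423932872262719183132438072456018265121858873650854913853249171254404980195645655702347732351267261867573919532687966420202662228357485236759955588311203882237103479305393335051657,
61744853845342545293618396244100525779,
203649872320209655093974038005925572474390882550284,
603091701180524252586036528354785857067276825900318121002621007371855863634376478995001537691480271534179420734412,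
7181932998246661800642636415395509894062516571037472488455826294584822569891375820247628623475571728264913718638667179007470069558571669501540490113003179696219114690280327006219539074987599253130969476954152978171600421511067328132229066927001984656906,
6652955717847227075310926176266618859295382271952470505430273979728357762646,
366115303500614513780960535576934892900099070423681424127925846833532593245332768283272819091984537650288961858235712475255124991787956488238022884619321000172668741858649379892215185426568398270600205984280226676320431816194761,
83903936574192566995505840988478948677406859838015593691268275278981995662457575540574860303858266026463554766372236478649554488841847314078322026068168717284076031579171076252609495450298349887584060330514897554825430311782136591374196249204203686210720045851044746039518118165,
2297988587243328121041656156603685254960698120063379020328522277843731840122070363784027822119347982641753764114851425474881566657292218586773949722436509657525009683512850147988416939803132950797815842190889687333778985025387000257593788733570705482190035669956673862061199772969509270582527975200233302,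
6610827449803754758091709947943939284723913207610302211782120957149142320092,
275792015408473697565373431719393615700796609092228930168445311520941076298184363171290204397211002724454009974796,
18616972387587220566179859,
18948062660185222738608152,
366508834908103692969350754520608832781066788930056,
1206974515533655709089749694852673035814138532053629133551611912,
18617496842740751598092296,
366508834926081476624527468600115865211144660720392,
7089311898628574078374348072704618458859407266826217454884127443578007942536,
46104682863273830485038643169363755722,
79345440530745010916702050010007601690,
31179123463259746886347758968906266183232543396633814354385257169337370280641181872599052,
3270130880590914850776715603046391344236848044899540748287046905882132874204,
185316873591842114146002140253701404724605743008588,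
603091958230388744734465824925476067206392978846904381041969870251376384027396610403515976382482170292329991155722,
1503128143992930941581449801477710851994330100386378532790472451,
1583757539465072029810904886085742025138326977530415047533135120,
137127235178997125117042871467061779430933563401601383117536204347261213721605837132593804260233490440,
84423252660958021080874711745964521370408810540799974671740550066189830971692026318006635049418939813304892265723727115514162527681095709239978949115338845836922108321364738883954751828200919217701436648575605942346,
30521300623240844288929153815104717020,
16167178503910637155909655,
18948062665154990870364178,
366508835006017302182749440372292996308956092833164,
38192630207509219092081454381493387992,
31179123469280935526689581737421599983593030061220816045699823611872546179634912079179474,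
370649630835170459490857751019779988623082022915034393339457730705989167374881457240904361673175010543725639916663888027463844023774220368985158334385835094718479783254563135838238092525541606730956092717806324537470169773310999,
42810975034459800772261524568188203813659245720669379671757715529324620410957753350652458466569180642743381316107479289539562641871720556611424447466084287666814877345968346780503237623679389583449157047148349543692,
1604493665285619924159692165715027288018373225466976037382372668316816184958589475276080140971102715953806881483916664598731023205690720042868282343517540709969966056657764934900143463055659913472581795782539332317733076947989980799802896008,
7169406539956108526679731203587439667928118343998007424193907062460720902289879745176844407629266369641823934244762802888721864193505711971131644449887251815143903811589971501680208602070841031897185932660148773538223604024129602253771380381845731444940,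
83900149822619509232133481536751952263387882840164915942137150593091196143345869738299828572013789294960882305029126734341465748750651740434148347389752351440709153003822785571621998109467317214857641476769448814782072083742777981008039180768988940776244018687118529552791416086,
9551733436076398145961988,
18948062667994766606598160,
18948062668280699759362066,
366508835065940100951591196585036333840839743638724,
603091958413385071283383795437005273405600269834826324289234886959695319235353536623125287015299594626171626733739,
366498687258454850868907152243619046830872876936850,
8082774311376450801106970,
18948062669684224219676710,
6990365446651371893549157548967068767628732768413655699728694419337164885227,
6596778637768456801615900,
18948062670502260870742054,
366508835109659549731684113726353501456636762394390,
2652426483877783111262700570327560830930761982808596559564272065858866817452179959594615147320572353000737491140683658399396370,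
71665096573137408048283052316339472727,
40864066808704077585104946695478970709,
78205117843637099341947012998496304215,
7157190283046144763494438,
18948062672494866253217808,
83334460929999642644456544939624412490,
51305389781405157119423113820208847991714097328913315421098389193988012435288999649251688072944258189945033736018031577853904468531904736863110075401751,
83334425205808865856845145610528231186,
224830225899560733226958704335649496739710834575718,
174157235303845263172328020749436784283784507866194,
137127235252903336633445174247675417010634764834176134671408617842011504157440812893194865960705985174,
98132654774698788917923084192671075194579991591824531576224053022294359164306095058634455427384966610,
134154328229805294828620781971991471628391175992652,
82857415805339285409436792902370987798,
2652426484468813204208770899140910143865707448619360595925754774688465278604353358742718329737507941223552979621835420163524118,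
5407273438111427145332460131486580358018740784878051531579055662043983121028,
42317909579903185133607785154262075730,
62399119300936322373811481948501315344,
11665177054740030791974284149238126159951675169775794312320261956972554004788927152094091504715775142918700452172858688783636154824880687766,
30743102282414021702002872486686073288306922733033407779054529449074879418310189690260118,
10875427336357767100173679441700328694073371553198517282959407053021589777329942247392795,
30542694403742641617504599574783670734140316869605661415067342837003367251826572066074999747425455446626975318958084761300373240038571092483364348111932023315439733803965312591954048923937455500475372398271604858645,
137127234944704056441296057718770000058664783602312501882973542690969012870116761045922527939777604370,
51305389794087110179012535403416179465830555660945948308818901465505770778550599349149067951874605268530287424864135855201724416584800131618975904977859,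
939071118520864547629201996149748379447355896766664010368694444968603728274154149463735578407378692549945342059097661173086109098319390085589566542277070475930149665386944144776,
9389254053662611826766664482951905871907199928813412507867383531734025607546163425778227991480172996404989762662803295862138288461089179869624398707935712072153572650901995236049086283540643411803860611,
48319293463016699983515412649953648750111088548575815180424245456409441590014525003210966939690486488496954643192662247711193502824666046262274679605858303263112365909462062338723950844204853100494365089897028767217865591128109137704852956710587338118548045514237708749116884193,
2297915342418804780165702168718863031924683576275585600783364064110319647915945545071134378556001463649954014259422258484059647337348081004991566183278504324413750429164946089566765559354503304385340400409041754912428881824579861803624852633278875071739363104105609351603947418020837326192660521389500768,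
44404247869164732180949163733964282195796034561452975251007219575139225584790325589137891384085358040100586588514929190399795270224359565309586638466803812118931755319236217710371982159721967043233197450705238486837005512021719298955241648214690264332687147602853015050988970900151872367193880829688918626499035788326339946326426]

theorem tpl_ok0 : tplsOk tplTree tplKids0 1 = true := by decide +kernel

theorem tpl_ok1 : tplsOk tplTree tplKids1 201 = true := by decide +kernel

theorem tpl_ok2 : tplsOk tplTree tplKids2 401 = true := by decide +kernel

theorem tpl_ok3 : tplsOk tplTree tplKids3 601 = true := by decide +kernel

theorem tpl_ok4 : tplsOk tplTree tplKids4 801 = true := by decide +kernel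

theorem tpl_ok5 : tplsOk tplTree tplKids5 1001 = true := by decide +kernel

theorem tpl_ok6 : tplsOk tplTree tplKids6 1201 = true := by decide +kernel

theorem tpl_ok7 : tplsOk tplTree tplKids7 1401 = true := by decide +kernel

theorem tpl_ok8 : tplsOk tplTree tplKids8 1601 = true := by decide +kernel

theorem tpl_ok9 : tplsOk tplTree tplKids9 1801 = true := by decide +kernel

theorem tpl_ok10 : tplsOk tplTree tplKids10 2001 = true := by decide +kernel

theorem tpl_ok11 : tplsOk tplTree tplKids11 2201 = true := by decide +kernel

end TplData

/-- `M` contains the edges of a path from `a` to `b` with vertex set `S`. -/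
def HP {V : Type} [DecidableEq V] (M : Finset (Sym2 V)) (a b : V) (S : Finset V) : Prop :=
  ∃ L : List V, L.Nodup ∧ L.toFinset = S ∧ L.head? = some a ∧ L.getLast? = some b ∧
    L.IsChain (fun u v => s(u, v) ∈ M)

theorem HP.mono {V : Type} [DecidableEq V] {M M' : Finset (Sym2 V)} {a b : V} {S : Finset V}
    (h : M ⊆ M') (hp : HP M a b S) : HP M' a b S := by
  obtain ⟨L, h1, h2, h3, h4, h5⟩ := hp
  exact ⟨L, h1, h2, h3, h4, h5.imp fun _ _ hm => h hm⟩

theorem HP.symm {V : Type} [DecidableEq V] {M : Finset (Sym2 V)} {a b : V} {S : Finset V}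
    (hp : HP M a b S) : HP M b a S := by
  obtain ⟨L, h1, h2, h3, h4, h5⟩ := hp
  refine ⟨L.reverse, List.nodup_reverse.2 h1, by simpa using h2, by simpa using h4,
    by simpa using h3, ?_⟩
  rw [List.isChain_reverse]
  exact h5.imp fun _ _ hm => by rwa [Sym2.eq_swap]

/-- The weights of the eight vertices. -/
def wt : Fin 8 → ℕ := ![0, 1, 2, 4, 8, 14, 19, 24]

theorem wtN_eq : ∀ k : Fin 8, wtN k = wt k := by decide +kernel

theorem wt_sidon : ∀ i j u v : Fin 8, i ≠ j → u ≠ v → wt i + wt j = wt u + wt v →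
    (i = u ∧ j = v) ∨ (i = v ∧ j = u) := by decide +kernel

theorem wt_inj : ∀ i j : Fin 8, wt i = wt j → i = j := by decide

theorem wt_le : ∀ i j : Fin 8, i ≠ j → wt i + wt j < 44 := by decide

theorem wt_one : ∀ i j : Fin 8, wt i + wt j = 1 → (i = 0 ∧ j = 1) ∨ (i = 1 ∧ j = 0) := by
  decide

/-- The edges of a plane of a mask, as edges between the vertices `ψ i`. -/
def eimg {V : Type} [DecidableEq V] (ψ : Fin 8 → V) (mc o : ℕ) : Finset (Sym2 V) :=
  ((Finset.univ : Finset (Fin 8 × Fin 8)).filter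
    (fun q => q.1 ≠ q.2 ∧ mc.testBit (o + (wt q.1 + wt q.2)) = true)).image
    (fun q => s(ψ q.1, ψ q.2))

theorem mem_eimg {V : Type} [DecidableEq V] {ψ : Fin 8 → V} {mc o : ℕ} {e : Sym2 V} :
    e ∈ eimg ψ mc o ↔
      ∃ i j, i ≠ j ∧ mc.testBit (o + (wt i + wt j)) = true ∧ s(ψ i, ψ j) = e := by
  simp [eimg, and_assoc]

theorem mem_eimg' {V : Type} [DecidableEq V] {ψ : Fin 8 → V} (hψ : Function.Injective ψ)
    {mc o : ℕ} {i j : Fin 8} :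
    s(ψ i, ψ j) ∈ eimg ψ mc o ↔ i ≠ j ∧ mc.testBit (o + (wt i + wt j)) = true := by
  rw [mem_eimg]
  constructor
  · rintro ⟨u, v, h1, h2, h3⟩
    rw [Sym2.eq_iff, hψ.eq_iff, hψ.eq_iff, hψ.eq_iff, hψ.eq_iff] at h3
    rcases h3 with ⟨rfl, rfl⟩ | ⟨rfl, rfl⟩
    · exact ⟨h1, h2⟩
    · exact ⟨h1.symm, by rwa [add_comm (wt _) (wt _)] at h2⟩
  · rintro ⟨h1, h2⟩
    exact ⟨i, j, h1, h2, rfl⟩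

theorem mvBit_testBit {mc e o s : ℕ} (ho : o = 0 ∨ o = 48) (h : mc.testBit (o + e) = true) :
    (mvBit mc e s).testBit (o + s) = true := by
  have hd : mvBit mc e s = ((mc >>> e) &&& 281474976710657) <<< s := rfl
  rw [hd, Nat.testBit_shiftLeft, Nat.testBit_and, Nat.testBit_shiftRight]
  have h1 : o + s - s = o := by omega
  rw [h1, add_comm e o, h]
  rcases ho with rfl | rfl <;> simp <;> decide

theorem lor_l {a b k : ℕ} (h : a.testBit k = true) : (Nat.lor a b).testBit k = true := by
  have hd : Nat.lor a b = a ||| b := rfl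
  rw [hd, Nat.testBit_or, h, Bool.true_or]

theorem lor_r {a b k : ℕ} (h : b.testBit k = true) : (Nat.lor a b).testBit k = true := by
  have hd : Nat.lor a b = a ||| b := rfl
  rw [hd, Nat.testBit_or, h, Bool.or_true]

theorem appMask_lt {mc o : ℕ} (ho : o = 0 ∨ o = 48) (q : Fin 8 → ℕ) (i j : Fin 8) (hij : i < j)
    (h : mc.testBit (o + (wt i + wt j)) = true) :
    (appMask mc (q 0) (q 1) (q 2) (q 3) (q 4) (q 5) (q 6) (q 7)).testBit (o + (q i + q j))
      = true := by
  have h' := mvBit_testBit (s := q i + q j) ho h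
  clear h ho
  unfold appMask
  revert hij h'
  fin_cases i <;> fin_cases j <;> intro hij h' <;>
    first
    | exact absurd hij (by decide)
    | (repeat' first
        | exact h'
        | exact lor_l h'
        | apply lor_r)

theorem appMask_spec {mc o : ℕ} (ho : o = 0 ∨ o = 48) (q : Fin 8 → ℕ) (i j : Fin 8) (hij : i ≠ j)
    (h : mc.testBit (o + (wt i + wt j)) = true) :
    (appMask mc (q 0) (q 1) (q 2) (q 3) (q 4) (q 5) (q 6) (q 7)).testBit (o + (q i + q j))
      = true := by
  rcases lt_or_gt_of_ne hij with h1 | h1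
  · exact appMask_lt ho q i j h1 h
  · rw [add_comm (q i)]
    exact appMask_lt ho q j i h1 (by rwa [add_comm (wt j)])

theorem kidLoop_spec (T : TplTree) (i mc : ℕ) (fuel : ℕ) : ∀ kids acc : ℕ,
    kidLoop T i mc fuel kids acc = true →
    (∀ b, acc.testBit b = true → mc.testBit b = false →
      ∃ x t p, kidOk i mc x t p (kidMask T x t p) = true ∧
        (kidMask T x t p).testBit (48 + b) = false) ∧
    (kids ≠ 0 → ∃ x t p, kidOk i mc x t p (kidMask T x t p) = true) := by
  induction fuel with
  | zero => intro kids acc h; exact absurd h (by simp [kidLoop])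
  | succ fuel ih =>
    intro kids acc h
    change cond (Nat.beq kids 0) (Nat.beq (Nat.lor acc mc) mc)
        (kidCode T i mc acc (Nat.land kids 63) (Nat.land (Nat.shiftRight kids 6) 4095)
          (Nat.land (Nat.shiftRight kids 18) 16777215)
          (kidLoop T i mc fuel (Nat.shiftRight kids 42))) = true at h
    cases hk : Nat.beq kids 0 with
    | true =>
      rw [hk, cond_true] at h
      refine ⟨fun b hb hm => ?_, fun h0 => absurd (Nat.eq_of_beq_eq_true hk) h0⟩
      have h1 : (Nat.lor acc mc).testBit b = true := lor_l hb
      rw [Nat.eq_of_beq_eq_true h, hm] at h1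
      exact absurd h1 (by decide)
    | false =>
      rw [hk, cond_false] at h
      generalize Nat.land kids 63 = x at h
      generalize Nat.land (Nat.shiftRight kids 6) 4095 = t at h
      generalize Nat.land (Nat.shiftRight kids 18) 16777215 = p at h
      unfold kidCode kidStep at h
      cases hok : kidOk i mc x t p (kidMask T x t p) with
      | false => rw [hok, cond_false] at h; exact absurd h (by decide)
      | true =>
        rw [hok, cond_true] at h
        refine ⟨fun b hb hm => ?_, fun _ => ⟨x, t, p, hok⟩⟩
        cases hP : (kidMask T x t p).testBit (48 + b) with
        | false => exact ⟨x, t, p, hok, hP⟩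
        | true =>
          refine (ih _ _ h).1 b ?_ hm
          have hd : Nat.land acc (Nat.shiftRight (kidMask T x t p) 48)
            = acc &&& ((kidMask T x t p) >>> 48) := rfl
          rw [hd, Nat.testBit_and, Nat.testBit_shiftRight, hb, hP]
          rfl

theorem pN_lt (p i : ℕ) : pN p i < 8 := by
  have hd : pN p i = (p >>> (3 * i)) &&& 7 := rfl
  have := Nat.and_le_right (n := p >>> (3 * i)) (m := 7)
  omega

theorem pair_of_bit : ∀ x : ℕ, Nat.land (Nat.shiftRight 9084392560510 x) 1 = 1 →
    ∃ u v : Fin 8, u ≠ v ∧ wt u + wt v = x := by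
  intro x hx
  have hlt : x < 44 := by
    by_contra hc
    have hd : Nat.shiftRight 9084392560510 x = 9084392560510 >>> x := rfl
    rw [hd, Nat.shiftRight_eq_div_pow, Nat.div_eq_of_lt] at hx
    · exact absurd hx (by decide)
    · exact lt_of_lt_of_le (by norm_num : 9084392560510 < 2 ^ 44)
        (Nat.pow_le_pow_right (by norm_num) (by omega))
  have key : ∀ x : Fin 44, Nat.land (Nat.shiftRight 9084392560510 x) 1 = 1 →
    ∃ u v : Fin 8, u ≠ v ∧ wt u + wt v = x := by decide +kernel
  exact key ⟨x, hlt⟩ hx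

theorem perm_surj (φ : Fin 8 → Fin 8) (h : permOk (wt (φ 0)) (wt (φ 1)) (wt (φ 2)) (wt (φ 3))
    (wt (φ 4)) (wt (φ 5)) (wt (φ 6)) (wt (φ 7)) = true) : Function.Injective φ := by
  refine Finite.injective_iff_surjective.2 fun k => ?_
  have h1 := Nat.eq_of_beq_eq_true h
  have h2 : Nat.testBit 17318167 (wt k) = true := by revert k; decide +kernel
  rw [← h1] at h2
  have hl : ∀ a b : ℕ, Nat.lor a b = a ||| b := fun _ _ => rfl
  have hs : ∀ a b : ℕ, Nat.shiftLeft a b = a <<< b := fun _ _ => rfl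
  simp only [hl, hs, Nat.testBit_or, Nat.one_shiftLeft, Nat.testBit_two_pow, Bool.or_eq_true,
    decide_eq_true_eq] at h2
  rcases h2 with h | h | h | h | h | h | h | h <;> exact ⟨_, wt_inj _ _ h⟩

theorem cond_split {a b : Bool} (h : cond a b false = true) : a = true ∧ b = true := by
  cases a
  · exact absurd h (by simp)
  · exact ⟨rfl, by simpa using h⟩

/-- The content of the check of one child. -/
theorem kidOk_spec {T : TplTree} {i mc x t p : ℕ}
    (h : kidOk i mc x t p (kidMask T x t p) = true) :
    t < i ∧ ∃ φ : Fin 8 → Fin 8, Function.Injective φ ∧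
      ((φ 0 = 0 ∧ φ 1 = 1) ∨ (φ 0 = 1 ∧ φ 1 = 0)) ∧
      ∃ u v : Fin 8, u ≠ v ∧
      (∀ a b : Fin 8, a ≠ b → (T.get t).testBit (0 + (wt a + wt b)) = true →
        mc.testBit (0 + (wt (φ a) + wt (φ b))) = true ∨ wt (φ a) + wt (φ b) = wt u + wt v) ∧
      (∀ a b : Fin 8, a ≠ b → (T.get t).testBit (48 + (wt a + wt b)) = true →
        mc.testBit (48 + (wt (φ a) + wt (φ b))) = true ∧
        (kidMask T x t p).testBit (48 + (wt (φ a) + wt (φ b))) = true) ∧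
      mc.testBit (48 + (wt u + wt v)) = true ∧
      (kidMask T x t p).testBit (48 + (wt u + wt v)) = true := by
  unfold kidOk at h
  obtain ⟨h1, h⟩ := cond_split h
  obtain ⟨h2, h⟩ := cond_split h
  obtain ⟨h3, h⟩ := cond_split h
  obtain ⟨h4, h5⟩ := cond_split h
  have hlt : t < i := by simpa [Nat.blt, Nat.succ_le_iff] using h1
  set φ : Fin 8 → Fin 8 := fun k => ⟨pN p k, pN_lt p k⟩ with hφ
  have hw : ∀ k : Fin 8, wtN (pN p k) = wt (φ k) := fun k => wtN_eq (φ k)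
  have hw0 : wtN (pN p 0) = wt (φ 0) := hw 0
  have hw1 : wtN (pN p 1) = wt (φ 1) := hw 1
  have hw2 : wtN (pN p 2) = wt (φ 2) := hw 2
  have hw3 : wtN (pN p 3) = wt (φ 3) := hw 3
  have hw4 : wtN (pN p 4) = wt (φ 4) := hw 4
  have hw5 : wtN (pN p 5) = wt (φ 5) := hw 5
  have hw6 : wtN (pN p 6) = wt (φ 6) := hw 6
  have hw7 : wtN (pN p 7) = wt (φ 7) := hw 7
  rw [hw0, hw1, hw2, hw3, hw4, hw5, hw6, hw7] at h3
  rw [hw0, hw1] at h2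
  have h2' : wt (φ 0) + wt (φ 1) = 1 := Nat.eq_of_beq_eq_true h2
  obtain ⟨u, v, huv, hx⟩ := pair_of_bit x (Nat.eq_of_beq_eq_true h4)
  have h5' := Nat.eq_of_beq_eq_true h5
  have hsub : ∀ b, (kidMask T x t p).testBit b = true → mc.testBit b = true ∨ b = x := by
    intro b hb
    have h6 := lor_l (b := Nat.lor mc (Nat.shiftLeft 1 x)) hb
    rw [h5'] at h6
    have hd : Nat.lor mc (Nat.shiftLeft 1 x) = mc ||| (1 <<< x) := rfl
    rw [hd, Nat.testBit_or, Nat.one_shiftLeft, Nat.testBit_two_pow, Bool.or_eq_true,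
      decide_eq_true_eq] at h6
    exact h6.imp id Eq.symm
  have hin : ∀ o, o = 0 ∨ o = 48 → ∀ a b : Fin 8, a ≠ b →
      (T.get t).testBit (o + (wt a + wt b)) = true →
      (kidMask T x t p).testBit (o + (wt (φ a) + wt (φ b))) = true := by
    intro o ho a b hab hb
    unfold kidMask
    rw [hw0, hw1, hw2, hw3, hw4, hw5, hw6, hw7]
    exact lor_l (appMask_spec ho (fun k => wt (φ k)) a b hab hb)
  have hxlt : x < 44 := hx ▸ wt_le u v huv
  have hxP : (kidMask T x t p).testBit (48 + x) = true := by
    unfold kidMask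
    refine lor_r ?_
    have hd : Nat.shiftLeft 1 (Nat.add 48 x) = 1 <<< (48 + x) := rfl
    rw [hd, Nat.one_shiftLeft, Nat.testBit_two_pow_self]
  refine ⟨hlt, φ, perm_surj φ h3, wt_one _ _ h2', u, v, huv, ?_, ?_, ?_, ?_⟩
  · intro a b hab hb
    rcases hsub _ (hin 0 (Or.inl rfl) a b hab hb) with h | h
    · exact Or.inl h
    · exact Or.inr (by omega)
  · intro a b hab hb
    have h7 := hin 48 (Or.inr rfl) a b hab hb
    refine ⟨?_, h7⟩
    rcases hsub _ h7 with h | h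
    · exact h
    · omega
  · rw [hx]
    rcases hsub _ hxP with h | h
    · exact h
    · omega
  · rw [hx]; exact hxP

theorem HP_base {V : Type} [DecidableEq V] (ψ : Fin 8 → V) (hψ : Function.Injective ψ) :
    HP (eimg ψ 2478308556706646872593272900 0) (ψ 0) (ψ 1) (Finset.univ.image ψ) := by
  refine ⟨List.map ψ [0, 2, 3, 4, 5, 6, 7, 1], (List.nodup_map_iff hψ).2 (by decide), ?_,
    rfl, rfl, ?_⟩
  · ext v
    simp only [List.mem_toFinset, List.mem_map, Finset.mem_image, Finset.mem_univ, true_and]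
    exact ⟨fun ⟨a, _, h⟩ => ⟨a, h⟩, fun ⟨a, h⟩ => ⟨a, by clear h; revert a; decide, h⟩⟩
  · rw [List.isChain_map]
    simp only [mem_eimg' hψ]
    decide +kernel

/-- Soundness of the certificate. -/
theorem tpl_sound {V : Type} [DecidableEq V] (T : TplTree) (n : ℕ)
    (h0 : T.get 0 = 2478308556706646872593272900)
    (hT : ∀ i, 1 ≤ i → i < n → ∃ k, tplOk T i k = true) (i : ℕ) : i < n →
    ∀ ψ : Fin 8 → V, Function.Injective ψ →
      Tpl (fun M => HP M (ψ 0) (ψ 1) (Finset.univ.image ψ))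
        (eimg ψ (T.get i) 0) (eimg ψ (T.get i) 48) := by
  induction i using Nat.strong_induction_on with
  | _ i ih =>
  intro hi ψ hψ
  rcases Nat.eq_zero_or_pos i with rfl | hpos
  · refine Tpl.base ?_
    rw [h0]
    exact HP_base ψ hψ
  · obtain ⟨k, hk⟩ := hT i hpos hi
    unfold tplOk at hk
    have hk0 : k ≠ 0 := by
      rintro rfl
      exact absurd hk (by simp)
    have hkb : Nat.beq k 0 = false := by
      cases hb : Nat.beq k 0
      · rfl
      · exact absurd (Nat.eq_of_beq_eq_true hb) hk0
    rw [hkb, cond_false] at hk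
    obtain ⟨hs1, hs2⟩ := kidLoop_spec T i _ _ _ _ hk
    refine Tpl.step' fun f hf => ?_
    have main : ∀ x t p, kidOk i (T.get i) x t p (kidMask T x t p) = true →
        (∀ a b : Fin 8, a ≠ b → f = s(ψ a, ψ b) →
          (kidMask T x t p).testBit (48 + (wt a + wt b)) = false) →
        ∃ (x : Sym2 V) (m' d' : Finset (Sym2 V)),
          Tpl (fun M => HP M (ψ 0) (ψ 1) (Finset.univ.image ψ)) m' d' ∧
          m' ⊆ insert x (eimg ψ (T.get i) 0) ∧
          insert x d' ⊆ eimg ψ (T.get i) 48 ∧ f ≠ x ∧ f ∉ d' := by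
      intro x t p hok hfP
      obtain ⟨hlt, φ, hφ, hterm, u, v, huv, hm, hd, hx1, hx2⟩ := kidOk_spec hok
      have ht := ih t hlt (hlt.trans hi) (ψ ∘ φ) (hψ.comp hφ)
      have himg : Finset.univ.image (ψ ∘ φ) = Finset.univ.image ψ := by
        rw [← Finset.image_image, Finset.image_univ_of_surjective
          (Finite.injective_iff_surjective.1 hφ)]
      rw [himg] at ht
      refine ⟨s(ψ u, ψ v), eimg (ψ ∘ φ) (T.get t) 0, eimg (ψ ∘ φ) (T.get t) 48, ?_, ?_, ?_, ?_, ?_⟩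
      · refine Tpl.map_goal (fun M hM => ?_) ht
        rcases hterm with ⟨e0, e1⟩ | ⟨e0, e1⟩
        · simpa only [Function.comp, e0, e1] using hM
        · have hM' := HP.symm hM
          simpa only [Function.comp, e0, e1] using hM'
      · intro e he
        obtain ⟨a, b, hab, hb, rfl⟩ := mem_eimg.1 he
        rw [Finset.mem_insert]
        rcases hm a b hab hb with h | h
        · exact Or.inr (mem_eimg.2 ⟨φ a, φ b, hφ.ne hab, h, rfl⟩)
        · left
          rcases wt_sidon _ _ _ _ (hφ.ne hab) huv h with ⟨e0, e1⟩ | ⟨e0, e1⟩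
          · simp only [Function.comp, e0, e1]
          · simp only [Function.comp, e0, e1]
            exact Sym2.eq_swap
      · rw [Finset.insert_subset_iff]
        refine ⟨mem_eimg.2 ⟨u, v, huv, hx1, rfl⟩, ?_⟩
        intro e he
        obtain ⟨a, b, hab, hb, rfl⟩ := mem_eimg.1 he
        exact mem_eimg.2 ⟨φ a, φ b, hφ.ne hab, (hd a b hab hb).1, rfl⟩
      · intro hfe
        have h8 := hfP u v huv hfe
        rw [hx2] at h8
        exact absurd h8 (by decide)
      · intro hfe
        obtain ⟨a, b, hab, hb, rfl⟩ := mem_eimg.1 hfe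
        have h8 := hfP (φ a) (φ b) (hφ.ne hab) rfl
        rw [(hd a b hab hb).2] at h8
        exact absurd h8 (by decide)
    by_cases hfe : ∃ a b : Fin 8, a ≠ b ∧ f = s(ψ a, ψ b)
    · obtain ⟨a, b, hab, rfl⟩ := hfe
      have hnb : (T.get i).testBit (wt a + wt b) = false := by
        rw [mem_eimg' hψ, zero_add] at hf
        simpa [hab] using hf
      have h44 : Nat.testBit 17592186044415 (wt a + wt b) = true := by
        have h9 : ∀ y : Fin 44, Nat.testBit 17592186044415 y = true := by decide +kernel
        exact h9 ⟨_, wt_le a b hab⟩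
      obtain ⟨x, t, p, hok, hP⟩ := hs1 _ h44 hnb
      refine main x t p hok fun a' b' hab' he => ?_
      rw [Sym2.eq_iff, hψ.eq_iff, hψ.eq_iff, hψ.eq_iff, hψ.eq_iff] at he
      rcases he with ⟨rfl, rfl⟩ | ⟨rfl, rfl⟩
      · exact hP
      · rw [add_comm (wt b) (wt a)]; exact hP
    · obtain ⟨x, t, p, hok⟩ := hs2 hk0
      exact main x t p hok fun a b hab he => absurd ⟨a, b, hab, he⟩ hfe

theorem tplsOk_get (T : TplTree) (l : List ℕ) : ∀ s i : ℕ, tplsOk T l s = true →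
    s ≤ i → i < s + l.length → ∃ k, tplOk T i k = true := by
  induction l with
  | nil => intro s i _ h1 h2; simp at h2; omega
  | cons a l ih =>
    intro s i h h1 h2
    change cond (tplOk T s a) (tplsOk T l (Nat.succ s)) false = true at h
    obtain ⟨h3, h4⟩ := cond_split h
    rcases Nat.eq_or_lt_of_le h1 with rfl | h5
    · exact ⟨a, h3⟩
    · exact ih (s + 1) i h4 h5 (by simp at h2; omega)

theorem tpl_all (i : ℕ) (h1 : 1 ≤ i) (h2 : i < 2365) : ∃ k, tplOk tplTree i k = true := by
  have l0 : tplKids0.length = 200 := by decide +kernel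
  have l1 : tplKids1.length = 200 := by decide +kernel
  have l2 : tplKids2.length = 200 := by decide +kernel
  have l3 : tplKids3.length = 200 := by decide +kernel
  have l4 : tplKids4.length = 200 := by decide +kernel
  have l5 : tplKids5.length = 200 := by decide +kernel
  have l6 : tplKids6.length = 200 := by decide +kernel
  have l7 : tplKids7.length = 200 := by decide +kernel
  have l8 : tplKids8.length = 200 := by decide +kernel
  have l9 : tplKids9.length = 200 := by decide +kernel
  have l10 : tplKids10.length = 200 := by decide +kernel
  have l11 : tplKids11.length = 164 := by decide +kernel
  rcases lt_or_ge i 201 with h | g1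
  · exact tplsOk_get _ _ _ i tpl_ok0 (by omega) (by omega)
  rcases lt_or_ge i 401 with h | g2
  · exact tplsOk_get _ _ _ i tpl_ok1 (by omega) (by omega)
  rcases lt_or_ge i 601 with h | g3
  · exact tplsOk_get _ _ _ i tpl_ok2 (by omega) (by omega)
  rcases lt_or_ge i 801 with h | g4
  · exact tplsOk_get _ _ _ i tpl_ok3 (by omega) (by omega)
  rcases lt_or_ge i 1001 with h | g5
  · exact tplsOk_get _ _ _ i tpl_ok4 (by omega) (by omega)
  rcases lt_or_ge i 1201 with h | g6
  · exact tplsOk_get _ _ _ i tpl_ok5 (by omega) (by omega)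
  rcases lt_or_ge i 1401 with h | g7
  · exact tplsOk_get _ _ _ i tpl_ok6 (by omega) (by omega)
  rcases lt_or_ge i 1601 with h | g8
  · exact tplsOk_get _ _ _ i tpl_ok7 (by omega) (by omega)
  rcases lt_or_ge i 1801 with h | g9
  · exact tplsOk_get _ _ _ i tpl_ok8 (by omega) (by omega)
  rcases lt_or_ge i 2001 with h | g10
  · exact tplsOk_get _ _ _ i tpl_ok9 (by omega) (by omega)
  rcases lt_or_ge i 2201 with h | g11
  · exact tplsOk_get _ _ _ i tpl_ok10 (by omega) (by omega)
  · exact tplsOk_get _ _ _ i tpl_ok11 (by omega) (by omega)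

/-- Maker, moving second, gets a Hamiltonian path between two prescribed vertices of `K_8`,
even without the edge between them and one more edge at an end. -/
theorem tpl_root {V : Type} [DecidableEq V] (ψ : Fin 8 → V) (hψ : Function.Injective ψ) :
    Tpl (fun M => HP M (ψ 0) (ψ 1) (Finset.univ.image ψ)) ∅
      (eimg ψ 2557029184398320027381530624 48) := by
  have h := tpl_sound (V := V) tplTree 2365 (by decide +kernel) tpl_all 2364 (by norm_num) ψ hψ
  have h1 : tplTree.get 2364 = 2557029184398320027381530624 := by decide +kernel
  rw [h1] at h
  have h2 : eimg ψ 2557029184398320027381530624 0 = ∅ := by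
    unfold eimg
    rw [Finset.image_eq_empty, Finset.filter_eq_empty_iff]
    have h3 : ∀ i j : Fin 8, ¬ (i ≠ j ∧
      Nat.testBit 2557029184398320027381530624 (0 + (wt i + wt j)) = true) := by decide +kernel
    intro q _
    exact h3 q.1 q.2
  rwa [h2] at h

theorem HP.concat {V : Type} [DecidableEq V] {M : Finset (Sym2 V)} {a b c : V} {S S' : Finset V}
    (h1 : HP M a b S) (h2 : HP M b c S') (hS : ∀ v, v ∈ S → v ∈ S' → v = b) :
    HP M a c (S ∪ S') := by
  obtain ⟨L, n1, s1, a1, b1, c1⟩ := h1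
  obtain ⟨L', n2, s2, a2, b2, c2⟩ := h2
  obtain ⟨P, rfl⟩ := List.getLast?_eq_some_iff.1 b1
  obtain ⟨T, rfl⟩ := List.head?_eq_some_iff.1 a2
  subst s1 s2
  refine ⟨P ++ b :: T, ?_, ?_, ?_, ?_, ?_⟩
  · rw [List.nodup_append] at n1 ⊢
    refine ⟨n1.1, n2, ?_⟩
    rintro x hx y hy rfl
    have hb : x = b := hS x (by simp [hx]) (by simpa using hy)
    exact n1.2.2 x hx b (by simp) hb
  · ext v
    simp only [List.mem_toFinset, List.mem_append, List.mem_cons, Finset.mem_union,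
      List.not_mem_nil, or_false]
    tauto
  · cases P with
    | nil => simpa using a1
    | cons x P => simpa using a1
  · rw [List.getLast?_append_of_ne_nil _ (by simp)]
    exact b2
  · exact List.isChain_split.2 ⟨c1, c2⟩

theorem HP.edge {V : Type} [DecidableEq V] {M : Finset (Sym2 V)} {a b : V} (hab : a ≠ b)
    (h : s(a, b) ∈ M) : HP M a b {a, b} :=
  ⟨[a, b], by simpa using hab, by simp, rfl, rfl, by simpa using h⟩

theorem HP.uncons {V : Type} [DecidableEq V] {M : Finset (Sym2 V)} {a b : V} {S : Finset V}
    (h : HP M a b S) (hab : a ≠ b) : ∃ c, c ∈ S.erase a ∧ s(a, c) ∈ M ∧ HP M c b (S.erase a) := by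
  obtain ⟨L, n1, s1, a1, b1, c1⟩ := h
  subst s1
  obtain ⟨T, rfl⟩ := List.head?_eq_some_iff.1 a1
  cases T with
  | nil => exact absurd (by simpa using b1) hab
  | cons c T =>
    rw [List.isChain_cons_cons] at c1
    have hn := List.nodup_cons.1 n1
    have hS : (a :: c :: T).toFinset.erase a = (c :: T).toFinset := by
      rw [List.toFinset_cons, Finset.erase_insert (by simpa using hn.1)]
    refine ⟨c, ?_, c1.1, c :: T, hn.2, hS.symm, rfl, by simpa using b1, c1.2⟩
    rw [hS]; simp

/-- All edges inside a set of vertices. -/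
def EE {V : Type} [DecidableEq V] (S : Finset V) : Finset (Sym2 V) :=
  S.offDiag.image (fun q => s(q.1, q.2))

theorem mem_EE {V : Type} [DecidableEq V] {S : Finset V} {u v : V} :
    s(u, v) ∈ EE S ↔ u ∈ S ∧ v ∈ S ∧ u ≠ v := by
  simp only [EE, Finset.mem_image, Finset.mem_offDiag, Prod.exists, Sym2.eq_iff]
  constructor
  · rintro ⟨a, b, h, ⟨rfl, rfl⟩ | ⟨rfl, rfl⟩⟩
    · exact h
    · exact ⟨h.2.1, h.1, h.2.2.symm⟩
  · intro h
    exact ⟨u, v, h, Or.inl ⟨rfl, rfl⟩⟩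

theorem card_EE {V : Type} [DecidableEq V] (S : Finset V) : (EE S).card = S.card.choose 2 :=
  Sym2.card_image_offDiag S

theorem EE_mono {V : Type} [DecidableEq V] {S S' : Finset V} (h : S ⊆ S') : EE S ⊆ EE S' := by
  intro e
  induction e with
  | _ u v =>
    rw [mem_EE, mem_EE]
    exact fun h1 => ⟨h h1.1, h h1.2.1, h1.2.2⟩

theorem HP_mono' {V : Type} [DecidableEq V] (a b : V) (S : Finset V) :
    ∀ s t : Finset (Sym2 V), s ⊆ t → (fun M => HP M a b S) s → (fun M => HP M a b S) t :=
  fun _ _ h hp => HP.mono h hp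

theorem tpl8x {V : Type} [DecidableEq V] (S : Finset V) (hS : S.card = 8) {l r x : V}
    (hl : l ∈ S) (hr : r ∈ S) (hx : x ∈ S) (hlr : l ≠ r) (hlx : l ≠ x) (hrx : r ≠ x) :
    Tpl (fun M => HP M l r S) ∅ (((EE S).erase s(l, r)).erase s(l, x)) := by
  set R := ((S.erase l).erase r).erase x with hR
  have hRc : R.toList.length = 5 := by
    rw [Finset.length_toList, hR, Finset.card_erase_of_mem, Finset.card_erase_of_mem,
      Finset.card_erase_of_mem, hS]
    · exact hl
    · simp [hr, hlr.symm]
    · simp [hx, hlx.symm, hrx.symm]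
  set L := l :: r :: x :: R.toList with hL
  have hLl : L.length = 8 := by simp [hL, hRc]
  have hLn : L.Nodup := by
    simp [hL, hR, Finset.nodup_toList, hlr, hlx, hrx]
  have hLS : L.toFinset = S := by
    ext v
    simp only [hL, hR, List.toFinset_cons, Finset.toList_toFinset, Finset.mem_insert,
      Finset.mem_erase]
    constructor
    · rintro (rfl | rfl | rfl | h)
      · exact hl
      · exact hr
      · exact hx
      · exact h.2.2.2
    · tauto
  set ψ : Fin 8 → V := fun i => L.get (Fin.cast hLl.symm i) with hψ
  have hinj : Function.Injective ψ := by
    intro i j hij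
    have := (List.nodup_iff_injective_get.1 hLn) hij
    simpa [Fin.ext_iff] using this
  have himg : Finset.univ.image ψ = S := by
    rw [← hLS]
    ext v
    simp only [Finset.mem_image, Finset.mem_univ, true_and, List.mem_toFinset, List.mem_iff_get]
    constructor
    · rintro ⟨i, h⟩
      exact ⟨_, h⟩
    · rintro ⟨i, h⟩
      exact ⟨Fin.cast hLl i, h⟩
  have h0 : ψ 0 = l := rfl
  have h1 : ψ 1 = r := rfl
  have h2 : ψ 2 = x := rfl
  have ht := tpl_root ψ hinj
  rw [himg, h0, h1] at ht
  refine Tpl.mono (HP_mono' l r S) ht subset_rfl ?_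
  intro e he
  obtain ⟨i, j, hij, hb, rfl⟩ := mem_eimg.1 he
  have key : ∀ i j : Fin 8,
    Nat.testBit 2557029184398320027381530624 (48 + (wt i + wt j)) = true →
      ¬ ((i = 0 ∧ j = 1) ∨ (i = 1 ∧ j = 0)) ∧ ¬ ((i = 0 ∧ j = 2) ∨ (i = 2 ∧ j = 0)) := by
    decide +kernel
  have hk := key i j hb
  have hmem : ∀ k, ψ k ∈ S := fun k => himg ▸ Finset.mem_image_of_mem ψ (Finset.mem_univ k)
  rw [Finset.mem_erase, Finset.mem_erase, mem_EE, ← h0, ← h1, ← h2]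
  refine ⟨fun h => hk.2 ?_, fun h => hk.1 ?_, hmem i, hmem j, hinj.ne hij⟩
  · rwa [Sym2.eq_iff, hinj.eq_iff, hinj.eq_iff, hinj.eq_iff, hinj.eq_iff] at h
  · rwa [Sym2.eq_iff, hinj.eq_iff, hinj.eq_iff, hinj.eq_iff, hinj.eq_iff] at h

theorem tpl8 {V : Type} [DecidableEq V] (S : Finset V) (hS : S.card = 8) {l r : V}
    (hl : l ∈ S) (hr : r ∈ S) (hlr : l ≠ r) :
    Tpl (fun M => HP M l r S) ∅ ((EE S).erase s(l, r)) := by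
  have hc : ((S.erase l).erase r).card = 6 := by
    rw [Finset.card_erase_of_mem (by simp [hr, hlr.symm]), Finset.card_erase_of_mem hl, hS]
  obtain ⟨x, hx⟩ := Finset.card_pos.1 (by rw [hc]; norm_num : 0 < ((S.erase l).erase r).card)
  simp only [Finset.mem_erase] at hx
  exact Tpl.mono (HP_mono' l r S) (tpl8x S hS hl hr hx.2.2 hlr (Ne.symm hx.2.1) (Ne.symm hx.1))
    subset_rfl (Finset.erase_subset _ _)

theorem tpl9 {V : Type} [DecidableEq V] (S : Finset V) (hS : S.card = 9) {l r : V}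
    (hl : l ∈ S) (hr : r ∈ S) (hlr : l ≠ r) :
    Tpl (fun M => HP M l r S) ∅ (EE S) := by
  have hrl : r ∈ S.erase l := by simp [hr, hlr.symm]
  have hSl : (S.erase l).card = 8 := by rw [Finset.card_erase_of_mem hl, hS]
  have hc : 1 < ((S.erase l).erase r).card := by
    rw [Finset.card_erase_of_mem hrl, hSl]; norm_num
  refine Tpl.step' fun f _ => ?_
  have hab : ∃ a ∈ (S.erase l).erase r, ∃ b ∈ (S.erase l).erase r, a ≠ b ∧ f ≠ s(l, a) ∧
      f ∉ ((EE (S.erase l)).erase s(a, r)).erase s(a, b) := by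
    by_cases hf : f ∈ EE (S.erase l)
    · have hother : ∀ a ∈ (S.erase l).erase r, ∃ b ∈ (S.erase l).erase r, a ≠ b := by
        intro a _
        obtain ⟨b, hb, hba⟩ := Finset.exists_mem_ne hc a
        exact ⟨b, hb, hba.symm⟩
      have hne : ∀ a, f ≠ s(l, a) := by
        rintro a rfl
        rw [mem_EE] at hf
        simp at hf
      induction f with
      | _ u v =>
      rw [mem_EE] at hf
      by_cases hu : u = r
      · subst hu
        have hv : v ∈ (S.erase l).erase u := Finset.mem_erase.2 ⟨hf.2.2.symm, hf.2.1⟩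
        obtain ⟨b, hb, hvb⟩ := hother v hv
        exact ⟨v, hv, b, hb, hvb, hne v, by simp [Sym2.eq_swap]⟩
      · have hu' : u ∈ (S.erase l).erase r := Finset.mem_erase.2 ⟨hu, hf.1⟩
        by_cases hv : v = r
        · subst hv
          obtain ⟨b, hb, hvb⟩ := hother u hu'
          exact ⟨u, hu', b, hb, hvb, hne u, by simp⟩
        · exact ⟨u, hu', v, Finset.mem_erase.2 ⟨hv, hf.2.1⟩, hf.2.2, hne u, by simp⟩
    · obtain ⟨a, ha, b, hb, hab⟩ := Finset.one_lt_card.1 hc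
      have hnot : ∀ e e', f ∉ ((EE (S.erase l)).erase e).erase e' := by
        intro e e' h
        exact hf (Finset.mem_of_mem_erase (Finset.mem_of_mem_erase h))
      by_cases hfa : f = s(l, a)
      · refine ⟨b, hb, a, ha, hab.symm, ?_, hnot _ _⟩
        rw [hfa]
        intro h
        exact hab (Sym2.congr_right.1 h)
      · exact ⟨a, ha, b, hb, hab, hfa, hnot _ _⟩
  obtain ⟨a, ha, b, hb, hab, hf1, hf2⟩ := hab
  simp only [Finset.mem_erase] at ha hb
  have h8 := tpl8x (S.erase l) hSl (l := a) (r := r) (x := b) (by simp [ha]) hrl (by simp [hb])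
    ha.1 hab (Ne.symm hb.1)
  refine ⟨s(l, a), insert s(l, a) ∅, _, ?_, subset_rfl, ?_, hf1, hf2⟩
  · refine Tpl.map_goal ?_ (Tpl.and_mem s(l, a) (HP_mono' a r (S.erase l)) h8)
    rintro M ⟨hM, hx⟩
    have h9 := HP.concat (HP.edge (Ne.symm ha.2.1) hx) hM (by
      intro v hv hv'
      simp only [Finset.mem_insert, Finset.mem_singleton, Finset.mem_erase] at hv hv'
      tauto)
    have hSS : {l, a} ∪ S.erase l = S := by
      ext v
      simp only [Finset.mem_insert, Finset.mem_singleton, Finset.mem_erase, Finset.mem_union]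
      constructor
      · rintro ((rfl | rfl) | h)
        · exact hl
        · exact ha.2.2
        · exact h.2
      · tauto
    rwa [hSS] at h9
  · rw [Finset.insert_subset_iff]
    refine ⟨mem_EE.2 ⟨hl, ha.2.2, Ne.symm ha.2.1⟩, ?_⟩
    exact ((Finset.erase_subset _ _).trans (Finset.erase_subset _ _)).trans
      (EE_mono (Finset.erase_subset _ _))

/-- Appending one block to a chain of blocks. -/
theorem chain_step {V : Type} [DecidableEq V] {S N : Finset V} {a b r : V}
    {d D : Finset (Sym2 V)} (hd : d ⊆ EE S) (hb : b ∈ S) (hN : Disjoint S N)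
    (hD : D ⊆ EE (insert b N))
    (h1 : Tpl (fun M => HP M a b S) ∅ d) (h2 : Tpl (fun M => HP M b r (insert b N)) ∅ D) :
    d ∪ D ⊆ EE (S ∪ N) ∧ Tpl (fun M => HP M a r (S ∪ N)) ∅ (d ∪ D) := by
  have hsub : insert b N ⊆ S ∪ N := by
    intro v hv
    rcases Finset.mem_insert.1 hv with rfl | h
    · exact Finset.mem_union_left _ hb
    · exact Finset.mem_union_right _ h
  have hint : ∀ v, v ∈ S → v ∈ insert b N → v = b := by
    intro v hv hv'
    rcases Finset.mem_insert.1 hv' with h | h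
    · exact h
    · exact absurd h (Finset.disjoint_left.1 hN hv)
  refine ⟨Finset.union_subset (hd.trans (EE_mono Finset.subset_union_left))
    (hD.trans (EE_mono hsub)), ?_⟩
  have hdis : Disjoint d D := by
    rw [Finset.disjoint_left]
    intro e he he'
    have h3 := hd he
    have h4 := hD he'
    induction e with
    | _ u v =>
    rw [mem_EE] at h3 h4
    exact h3.2.2 ((hint u h3.1 h4.1).trans (hint v h3.2.1 h4.2.1).symm)
  have h3 := Tpl.and (HP_mono' a b S) (HP_mono' b r (insert b N)) h1 h2 hdis
  rw [Finset.union_empty] at h3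
  refine Tpl.map_goal ?_ h3
  rintro M ⟨h4, h5⟩
  have h6 := HP.concat h4 h5 hint
  have h7 : S ∪ insert b N = S ∪ N := by
    refine subset_antisymm (Finset.union_subset Finset.subset_union_left hsub)
      (Finset.union_subset_union_right (Finset.subset_insert _ _))
  rwa [h7] at h6

/-- A chain of `p` blocks `K_8` and `q` blocks `K_9`. -/
theorem chain_exists {V : Type} [DecidableEq V] (a : V) (p q : ℕ) : ∀ S : Finset V, a ∈ S →
    S.card = 1 + 7 * p + 8 * q → ∃ b ∈ S, ∃ d ⊆ EE S, Tpl (fun M => HP M a b S) ∅ d ∧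
      d.card ≤ 27 * p + 36 * q ∧ (1 < S.card → a ≠ b) := by
  -- splitting off a block
  have split : ∀ (S : Finset V) (k m : ℕ), a ∈ S → S.card = 1 + m + k → 0 < k →
      ∃ S' N r, a ∈ S' ∧ S'.card = 1 + m ∧ N.card = k ∧ Disjoint S' N ∧ S' ∪ N = S ∧ r ∈ N := by
    intro S k m ha hS hk
    have hca : (S.erase a).card = m + k := by rw [Finset.card_erase_of_mem ha, hS]; omega
    obtain ⟨N, hN, hNc⟩ := Finset.exists_subset_card_eq (s := S.erase a) (n := k) (by omega)
    obtain ⟨r, hr⟩ := Finset.card_pos.1 (by omega : 0 < N.card)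
    have hNS : N ⊆ S := hN.trans (Finset.erase_subset _ _)
    refine ⟨S \ N, N, r, ?_, ?_, hNc, Finset.sdiff_disjoint, Finset.sdiff_union_of_subset hNS, hr⟩
    · rw [Finset.mem_sdiff]
      exact ⟨ha, fun h => by simpa using hN h⟩
    · rw [Finset.card_sdiff_of_subset hNS, hS, hNc]; omega
  induction q with
  | succ q ih =>
    intro S ha hS
    obtain ⟨S', N, r, ha', hS', hN, hdis, rfl, hr⟩ := split S 8 (7 * p + 8 * q) ha (by omega)
      (by norm_num)
    obtain ⟨b, hb, d, hd, ht, hc, -⟩ := ih S' ha' (by omega)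
    have hbN : b ∉ N := Finset.disjoint_left.1 hdis hb
    have h9 : (insert b N).card = 9 := by rw [Finset.card_insert_of_notMem hbN, hN]
    obtain ⟨h1, h2⟩ := chain_step hd hb hdis subset_rfl ht
      (tpl9 (insert b N) h9 (Finset.mem_insert_self _ _) (Finset.mem_insert_of_mem hr)
        (fun h => hbN (h ▸ hr)))
    refine ⟨r, Finset.mem_union_right _ hr, _, h1, h2, ?_, fun _ h => ?_⟩
    · have h3 := Finset.card_union_le d (EE (insert b N))
      rw [card_EE, h9] at h3
      have h4 : Nat.choose 9 2 = 36 := by decide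
      omega
    · exact Finset.disjoint_left.1 hdis ha' (h ▸ hr)
  | zero =>
    induction p with
    | succ p ih =>
      intro S ha hS
      obtain ⟨S', N, r, ha', hS', hN, hdis, rfl, hr⟩ := split S 7 (7 * p) ha (by omega)
        (by norm_num)
      obtain ⟨b, hb, d, hd, ht, hc, -⟩ := ih S' ha' (by omega)
      have hbN : b ∉ N := Finset.disjoint_left.1 hdis hb
      have h8 : (insert b N).card = 8 := by rw [Finset.card_insert_of_notMem hbN, hN]
      have hbr : b ≠ r := fun h => hbN (h ▸ hr)
      obtain ⟨h1, h2⟩ := chain_step hd hb hdis (Finset.erase_subset s(b, r) _) ht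
        (tpl8 (insert b N) h8 (Finset.mem_insert_self _ _) (Finset.mem_insert_of_mem hr) hbr)
      refine ⟨r, Finset.mem_union_right _ hr, _, h1, h2, ?_, fun _ h => ?_⟩
      · have h3 := Finset.card_union_le d ((EE (insert b N)).erase s(b, r))
        rw [Finset.card_erase_of_mem (mem_EE.2 ⟨Finset.mem_insert_self _ _,
          Finset.mem_insert_of_mem hr, hbr⟩), card_EE, h8] at h3
        have h4 : Nat.choose 8 2 = 28 := by decide
        omega
      · exact Finset.disjoint_left.1 hdis ha' (h ▸ hr)
    | zero =>
      intro S ha hS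
      obtain ⟨x, rfl⟩ := Finset.card_eq_one.1 (by omega : S.card = 1)
      rw [Finset.mem_singleton] at ha
      subst ha
      exact ⟨a, by simp, ∅, by simp, Tpl.base ⟨[a], by simp, by simp, rfl, rfl, by simp⟩,
        by simp, by simp⟩

/-- A list of vertices that is a chain is the support of a walk. -/
theorem walk_of_list {V : Type} [DecidableEq V] {G : SimpleGraph V} {M : Finset (Sym2 V)}
    (hM : ∀ e ∈ M, e ∈ G.edgeSet) (L : List V) : ∀ a b : V, L.head? = some a →
    L.getLast? = some b → L.IsChain (fun u v => s(u, v) ∈ M) →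
    ∃ p : G.Walk a b, p.support = L ∧ ∀ e ∈ p.edges, e ∈ M := by
  induction L with
  | nil => intro a b h; simp at h
  | cons x L ih =>
    intro a b h1 h2 h3
    have hx : x = a := by simpa using h1
    subst hx
    cases L with
    | nil =>
      have hb : x = b := by simpa using h2
      subst hb
      exact ⟨SimpleGraph.Walk.nil, by simp, by simp⟩
    | cons y L =>
      rw [List.isChain_cons_cons] at h3
      obtain ⟨p, hp1, hp2⟩ := ih y b rfl (by simpa using h2) h3.2
      have hadj : G.Adj x y := hM _ h3.1
      refine ⟨SimpleGraph.Walk.cons hadj p, by simp [hp1], ?_⟩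
      intro e he
      rw [SimpleGraph.Walk.edges_cons, List.mem_cons] at he
      rcases he with rfl | he
      · exact h3.1
      · exact hp2 e he

theorem ham_of_HP {V : Type} [DecidableEq V] [Fintype V] (hV : 3 ≤ Fintype.card V)
    {G : SimpleGraph V} {M : Finset (Sym2 V)} (hM : ∀ e ∈ M, e ∈ G.edgeSet) {a c : V}
    (h : HP M a c Finset.univ) (hac : s(a, c) ∈ M) : ∃ A ∈ GHamCycles G, A ⊆ M := by
  obtain ⟨L, n1, s1, a1, b1, c1⟩ := h
  obtain ⟨p, hp1, hp2⟩ := walk_of_list hM L a c a1 b1 c1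
  have hpath : p.IsPath := by rw [SimpleGraph.Walk.isPath_def, hp1]; exact n1
  have hham : p.IsHamiltonian := by
    rw [hpath.isHamiltonian_iff]
    intro w
    rw [hp1, ← List.mem_toFinset, s1]
    exact Finset.mem_univ w
  have hadj : G.Adj c a := (hM _ hac : G.Adj a c).symm
  have hcyc : (SimpleGraph.Walk.cons hadj p).IsHamiltonianCycle := by
    rw [SimpleGraph.Walk.isHamiltonianCycle_iff_isCycle_and_support_count_tail_eq_one]
    refine ⟨(SimpleGraph.Walk.cons_isCycle_iff p hadj).2 ⟨hpath, fun he => ?_⟩, ?_⟩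
    · rw [Sym2.eq_swap] at he
      have h1 := hpath.length_eq_one_of_mem_edges he
      have h2 := hham.length_eq
      omega
    · intro v
      simpa using hham v
  refine ⟨_, ⟨c, _, hcyc, rfl⟩, ?_⟩
  intro e he
  rw [List.mem_toFinset, SimpleGraph.Walk.edges_cons, List.mem_cons] at he
  rcases he with rfl | he
  · rwa [Sym2.eq_swap]
  · exact hp2 e he

/-- For every `n ≥ 336` there is a graph on `n` vertices with at most `4n` edges on
which Maker, as first player, wins the Maker-Breaker Hamiltonicity game. -/
theorem sparse_maker_ham_graph (n : ℕ) (hn : 336 ≤ n) :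
    ∃ (G : SimpleGraph (Fin n)) (X : Finset (Sym2 (Fin n))),
      (X : Set (Sym2 (Fin n))) = G.edgeSet ∧ X.card ≤ 4 * n ∧
      MakerWinsFirst X (GHamCycles G) := by
  obtain ⟨p, q, hpq, hcount⟩ : ∃ p q : ℕ, n = 7 * (p + 1) + 8 * q ∧
      27 * (p + 1) + 36 * q ≤ 4 * n := by
    refine ⟨n / 7 - n % 7 - 1, n % 7, ?_, ?_⟩ <;> omega
  let a : Fin n := ⟨0, by omega⟩
  obtain ⟨S, haS, hSc⟩ : ∃ S : Finset (Fin n), {a} ⊆ S ∧ S.card = 1 + 7 * p + 8 * q := by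
    obtain ⟨S, h1, -, h2⟩ := Finset.exists_subsuperset_card_eq
      (Finset.subset_univ ({a} : Finset (Fin n))) (n := 1 + 7 * p + 8 * q)
      (by simp; omega) (by simp; omega)
    exact ⟨S, h1, h2⟩
  rw [Finset.singleton_subset_iff] at haS
  obtain ⟨b, hb, d, hd, ht, hdc, hne⟩ := chain_exists a p q S haS hSc
  have hab : a ≠ b := hne (by omega)
  set N := (Finset.univ : Finset (Fin n)) \ S with hN
  have hNc : N.card = 6 := by
    rw [hN, Finset.card_sdiff_of_subset (Finset.subset_univ _), Finset.card_univ,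
      Fintype.card_fin, hSc]
    omega
  have hNS : ∀ v, v ∈ N ↔ v ∉ S := by simp [hN]
  set B := insert a (insert b N) with hB
  have hBc : B.card = 8 := by
    rw [hB, Finset.card_insert_of_notMem, Finset.card_insert_of_notMem, hNc]
    · rw [hNS]; exact fun h => h hb
    · rw [Finset.mem_insert, hNS]
      rintro (h | h)
      · exact hab h
      · exact h haS
  have haB : a ∈ B := by simp [hB]
  have hbB : b ∈ B := by simp [hB]
  have h8 := tpl8 B hBc haB hbB hab
  set D := (EE B).erase s(a, b) with hD
  have hSB : ∀ v, v ∈ S → v ∈ B → v = a ∨ v = b := by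
    intro v hv hv'
    rw [hB, Finset.mem_insert, Finset.mem_insert, hNS] at hv'
    tauto
  have hdis : Disjoint d D := by
    rw [Finset.disjoint_left]
    intro e he he'
    have h3 := hd he
    have h4 := Finset.mem_erase.1 he'
    induction e with
    | _ u v =>
    rw [mem_EE] at h3 h4
    rcases hSB u h3.1 h4.2.1 with rfl | rfl <;> rcases hSB v h3.2.1 h4.2.2.1 with rfl | rfl
    · exact h3.2.2 rfl
    · exact h4.1 rfl
    · exact h4.1 Sym2.eq_swap
    · exact h3.2.2 rfl
  have htot := Tpl.and (HP_mono' a b S) (HP_mono' a b B) ht h8 hdis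
  rw [Finset.union_empty] at htot
  have hXE : d ∪ D ⊆ EE Finset.univ :=
    Finset.union_subset (hd.trans (EE_mono (Finset.subset_univ _)))
      ((Finset.erase_subset _ _).trans (EE_mono (Finset.subset_univ _)))
  have hDc : D.card = 27 := by
    rw [hD, Finset.card_erase_of_mem (mem_EE.2 ⟨haB, hbB, hab⟩), card_EE, hBc]
    decide
  have hXG : ((d ∪ D : Finset (Sym2 (Fin n))) : Set (Sym2 (Fin n))) =
      (SimpleGraph.fromEdgeSet ((d ∪ D : Finset (Sym2 (Fin n))) : Set (Sym2 (Fin n)))).edgeSet := by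
    rw [SimpleGraph.edgeSet_fromEdgeSet, eq_comm, sdiff_eq_left, Set.disjoint_left]
    intro e he
    have h3 := hXE (Finset.mem_coe.1 he)
    induction e with
    | _ u v =>
    rw [mem_EE] at h3
    simpa using h3.2.2
  refine ⟨SimpleGraph.fromEdgeSet ((d ∪ D : Finset (Sym2 (Fin n))) : Set (Sym2 (Fin n))),
    d ∪ D, hXG, ?_, ?_⟩
  · have h3 := Finset.card_union_le d D
    omega
  · refine Tpl.makerWinsFirst (z := s(a, a)) ?_ ?_ ?_ ?_ htot
    · exact fun s t hst h => ⟨HP.mono hst h.1, HP.mono hst h.2⟩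
    · intro h
      have h3 := hXE h
      rw [mem_EE] at h3
      exact h3.2.2 rfl
    · have h4 : D.Nonempty := Finset.card_pos.1 (by omega)
      exact h4.mono Finset.subset_union_right
    · rintro M hMX ⟨h1, h2⟩
      obtain ⟨c, hcB, hac, hcb⟩ := HP.uncons h2 hab
      have h3 := HP.concat h1 hcb.symm (by
        intro v hv hv'
        rw [Finset.mem_erase] at hv'
        rcases hSB v hv hv'.2 with h | h
        · exact absurd h hv'.1
        · exact h)
      have hU : S ∪ B.erase a = Finset.univ := by
        rw [Finset.eq_univ_iff_forall]
        intro v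
        rw [Finset.mem_union, Finset.mem_erase]
        by_cases hv : v ∈ S
        · exact Or.inl hv
        · refine Or.inr ⟨fun h => hv (h ▸ haS), ?_⟩
          rw [hB, Finset.mem_insert, Finset.mem_insert, hNS]
          exact Or.inr (Or.inr hv)
      rw [hU] at h3
      refine ham_of_HP (by rw [Fintype.card_fin]; omega) ?_ h3 hac
      intro e he
      rw [← hXG]
      exact Finset.mem_coe.2 (hMX he)
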